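/- arXiv:0803.4361 — 2 statements merged into one kernel-verified Lean document; each statement's English description precedes it below -/
import Mathlib

section
/- Let n ≥ 2 and let L ⊆ Mₙ(ℂ) be a Lie algebra of matrices, i.e. a linear subspace closed under the commutator [A,B] = AB − BA. If L contains a nonzero element A with the property that tr(AF) = 0 for every F ∈ L, then L is reducible: there exists a linear subspace W of ℂⁿ with W ≠ {0} and W ≠ ℂⁿ such that F(W) ⊆ W for every F ∈ L. -/
attribute [local instance] LieRing.ofAssociativeRing

open LieModule in
/-- A Lie algebra with a faithful nilpotent module is nilpotent. -/
theorem LieRing.isNilpotent_of_isFaithful_of_isNilpotent (R L M : Type*) [CommRing R]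
    [LieRing L] [LieAlgebra R L] [IsNoetherian R L]
    [AddCommGroup M] [Module R M] [IsNoetherian R M] [LieRingModule L M] [LieModule R L M]
    [IsFaithful R L M] [LieModule.IsNilpotent L M] : LieRing.IsNilpotent L := by
  have hinj : Function.Injective (toEnd R L M).rangeRestrict := fun x y h ↦
    IsFaithful.injective_toEnd (R := R) (M := M) (congrArg Subtype.val h)
  have : IsNoetherian R (toEnd R L M).range :=
    isNoetherian_of_surjective (toEnd R L M).rangeRestrict.toLinearMap
      (LinearMap.range_eq_top.mpr (toEnd R L M).surjective_rangeRestrict)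
  have : LieRing.IsNilpotent (toEnd R L M).range := by
    rw [LieAlgebra.isNilpotent_iff_forall (R := R)]
    rintro ⟨_, x, rfl⟩
    exact LieAlgebra.isNilpotent_ad_of_isNilpotent
      ((isNilpotent_iff_forall' (R := R)).mp ‹LieModule.IsNilpotent L M› x)
  exact hinj.lieAlgebra_isNilpotent

open LieModule in
/-- **Cartan's criterion** for a faithful representation: if its trace form vanishes then the
Lie algebra is solvable. -/
theorem LieAlgebra.isSolvable_of_isFaithful_of_traceForm_eq_zero (k L M : Type*) [Field k]
    [CharZero k] [LieRing L] [LieAlgebra k L] [Module.Finite k L]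
    [AddCommGroup M] [Module k M] [Module.Finite k M] [LieRingModule L M] [LieModule k L M]
    [IsFaithful k L M] (h : traceForm k L M = 0) : LieAlgebra.IsSolvable L := by
  have := isNilpotent_derivedSeries_of_traceForm_eq_zero h
  have : IsFaithful k (derivedSeries k L 1) M :=
    inferInstanceAs (IsFaithful k (derivedSeries k L 1).toLieSubalgebra M)
  have : LieRing.IsNilpotent (derivedSeries k L 1) :=
    LieRing.isNilpotent_of_isFaithful_of_isNilpotent k (derivedSeries k L 1) M
  obtain ⟨m, hm⟩ := IsSolvable.solvable k (derivedSeries k L 1)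
  rw [LieIdeal.derivedSeries_eq_bot_iff, ← derivedSeriesOfIdeal_add] at hm
  exact IsSolvable.mk hm

open LieModule in
/-- The trace form of a faithful irreducible triangularizable representation in characteristic
zero is nondegenerate. -/
theorem LieModule.ker_traceForm_eq_bot_of_isIrreducible_of_isFaithful (k L M : Type*) [Field k]
    [CharZero k] [LieRing L] [LieAlgebra k L] [Module.Finite k L]
    [AddCommGroup M] [Module k M] [Module.Finite k M] [LieRingModule L M] [LieModule k L M]
    [IsIrreducible k L M] [IsFaithful k L M] [IsTriangularizable k L M] :
    LinearMap.ker (traceForm k L M) = ⊥ := by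
  let I : LieIdeal k L :=
    LieAlgebra.InvariantForm.orthogonal (traceForm k L M) (traceForm_lieInvariant k L M) ⊤
  have : IsFaithful k I M := inferInstanceAs (IsFaithful k I.toLieSubalgebra M)
  have hI : LieAlgebra.IsSolvable I := by
    refine LieAlgebra.isSolvable_of_isFaithful_of_traceForm_eq_zero k I M ?_
    ext x ⟨y, hy⟩
    exact (LieAlgebra.InvariantForm.mem_orthogonal _ _ _ y).mp hy x (LieSubmodule.mem_top _)
  obtain ⟨hrad, hcenter⟩ :=
    LieAlgebra.hasCentralRadical_and_of_isIrreducible_of_isFaithful k L M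
  refine (Submodule.eq_bot_iff _).mpr fun x hx ↦ ?_
  have hxI : x ∈ I := (LieAlgebra.InvariantForm.mem_orthogonal _ _ _ x).mpr fun y _ ↦ by
    rw [traceForm_comm, LinearMap.mem_ker.mp hx, LinearMap.zero_apply]
  have hxc : x ∈ LieAlgebra.center k L :=
    hrad.radical_eq_center ▸ (LieAlgebra.LieIdeal.solvable_iff_le_radical k L I).mp hI hxI
  obtain ⟨t, ht⟩ := Submodule.mem_span_singleton.mp ((hcenter x).mp hxc)
  have : Module.finrank k M ≠ 0 :=
    (Module.finrank_pos_iff.mpr <| nontrivial_of_isIrreducible k L M).ne'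
  have htr : traceForm k L M x x = 0 := by rw [LinearMap.mem_ker.mp hx, LinearMap.zero_apply]
  rw [traceForm_apply_apply, ← ht] at htr
  suffices t = 0 by simp [← toEnd_eq_zero_iff (R := k) (L := L) (M := M), ← ht, this]
  simpa [LinearMap.smul_comp, LinearMap.comp_smul, this] using htr

/-- A matrix Lie algebra containing a nonzero element `A` with `tr(AF) = 0` for every
`F` in the algebra is reducible. -/
theorem lie_algebra_trace_zero_reducible
    {n : ℕ} (hn : 2 ≤ n) (L : Submodule ℂ (Matrix (Fin n) (Fin n) ℂ))
    (hLie : ∀ A ∈ L, ∀ B ∈ L, A * B - B * A ∈ L)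
    (A : Matrix (Fin n) (Fin n) ℂ) (hA : A ∈ L) (hA0 : A ≠ 0)
    (htr : ∀ F ∈ L, Matrix.trace (A * F) = 0) :
    ∃ W : Submodule ℂ (Fin n → ℂ), W ≠ ⊥ ∧ W ≠ ⊤ ∧
      ∀ F ∈ L, ∀ x ∈ W, F.mulVec x ∈ W := by
  by_contra! hirr
  let K : LieSubalgebra ℂ (Matrix (Fin n) (Fin n) ℂ) :=
    { L with lie_mem' := fun {x y} hx hy ↦ hLie x hx y hy }
  have : Nonempty (Fin n) := ⟨⟨0, by omega⟩⟩
  have : LieModule.IsIrreducible ℂ K (Fin n → ℂ) := by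
    refine LieModule.IsIrreducible.mk fun N hN ↦ ?_
    by_contra hN'
    obtain ⟨F, hF, x, hx, hFx⟩ := hirr N (by simpa using hN) (by simpa using hN')
    exact hFx (N.lie_mem (x := (⟨F, hF⟩ : K)) hx)
  have hker : (⟨A, hA⟩ : K) ∈ LinearMap.ker (LieModule.traceForm ℂ K (Fin n → ℂ)) := by
    refine LinearMap.mem_ker.mpr (LinearMap.ext fun F ↦ ?_)
    change LinearMap.trace ℂ _ (Matrix.toLin' A ∘ₗ Matrix.toLin' F) = 0
    rw [← Matrix.toLin'_mul, Matrix.trace_toLin'_eq]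
    exact htr F F.2
  rw [LieModule.ker_traceForm_eq_bot_of_isIrreducible_of_isFaithful] at hker
  exact hA0 (congrArg Subtype.val ((Submodule.mem_bot ℂ).mp hker))
end

section
/- Let L be a Lie algebra of compact operators on a complex Banach space X (a linear subspace of B(X), closed under the commutator [A,B] = AB − BA, all of whose elements are compact). If L has sublinear spectrum, i.e. σ(A + λB) ⊆ {α + λβ : α ∈ σ(A), β ∈ σ(B)} for all A, B ∈ L and all λ ∈ ℂ, then L is triangularizable: there exists a set 𝒞 of closed subspaces of X, each invariant under every element of L, such that 𝒞 is a maximal chain in the set of all closed subspaces of X ordered by inclusion. -/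
open Filter Topology NormedSpace

section BanachAlgebra

variable {A : Type*} [NormedRing A] [NormedAlgebra ℂ A] [CompleteSpace A]

theorem exists_norm_pow_lt (a : A) {r : ℝ} (hr : 0 < r)
    (h : ∀ z ∈ spectrum ℂ a, ‖z‖ < r) : ∃ n : ℕ, 1 ≤ n ∧ ‖a ^ n‖ < r ^ n := by
  rcases subsingleton_or_nontrivial A with hA | hA
  · refine ⟨1, le_rfl, ?_⟩
    rw [Subsingleton.elim (a ^ 1) 0, norm_zero]
    positivity
  lift r to NNReal using hr.le
  have h1 : spectralRadius ℂ a < r :=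
    spectrum.spectralRadius_lt_of_forall_lt a fun z hz => by exact_mod_cast h z hz
  have h2 := (spectrum.pow_norm_pow_one_div_tendsto_nhds_spectralRadius a).eventually
    (gt_mem_nhds h1)
  obtain ⟨n, hn, hn1⟩ := (h2.and (eventually_ge_atTop 1)).exists
  refine ⟨n, hn1, ?_⟩
  rw [← ENNReal.ofReal_coe_nnreal, ENNReal.ofReal_lt_ofReal_iff hr] at hn
  have hn0 : (n : ℝ) ≠ 0 := by positivity
  have := Real.rpow_lt_rpow (by positivity) hn (z := n) (by positivity)
  rwa [← Real.rpow_mul (norm_nonneg _), one_div, inv_mul_cancel₀ hn0, Real.rpow_one,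
    Real.rpow_natCast] at this

/-- Lower semicontinuity of isolated parts of the spectrum. -/
theorem notMem_spectrum_of_tendsto {C : A} {w : ℕ → A} (hw : Tendsto w atTop (𝓝 C))
    {μ : ℂ} {r : ℝ} (hr : 0 < r) (hC : ∀ z ∈ Metric.sphere μ r, z ∉ spectrum ℂ C)
    (hwj : ∃ᶠ j in atTop, ∀ z ∈ Metric.closedBall μ r, z ∉ spectrum ℂ (w j)) :
    μ ∉ spectrum ℂ C := by
  -- the resolvent is uniformly bounded near `C` on the sphere
  have hev : ∀ z ∈ Metric.sphere μ r, ∃ K : ℝ, ∀ᶠ p : ℂ × A in 𝓝 (z, C),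
      ‖Ring.inverse (algebraMap ℂ A p.1 - p.2)‖ ≤ K := by
    intro z hz
    have hu : IsUnit (algebraMap ℂ A z - C) := spectrum.notMem_iff.mp (hC z hz)
    obtain ⟨u, hu⟩ := hu
    have hcont : ContinuousAt (fun p : ℂ × A => Ring.inverse (algebraMap ℂ A p.1 - p.2))
        (z, C) := by
      have h1 : ContinuousAt (fun p : ℂ × A => algebraMap ℂ A p.1 - p.2) (z, C) := by fun_prop
      have h2 := NormedRing.inverse_continuousAt u
      rw [hu] at h2
      exact ContinuousAt.comp (f := fun p : ℂ × A => algebraMap ℂ A p.1 - p.2) h2 h1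
    refine ⟨‖Ring.inverse (algebraMap ℂ A z - C)‖ + 1, ?_⟩
    have := hcont.norm.eventually (gt_mem_nhds (lt_add_one _))
    filter_upwards [this] with p hp using hp.le
  have hbound : ∃ K : ℝ, ∀ᶠ c in 𝓝 C, ∀ z ∈ Metric.sphere μ r,
      ‖Ring.inverse (algebraMap ℂ A z - c)‖ ≤ K := by
    refine (isCompact_sphere μ r).induction_on (p := fun s => ∃ K : ℝ, ∀ᶠ c in 𝓝 C, ∀ z ∈ s,
      ‖Ring.inverse (algebraMap ℂ A z - c)‖ ≤ K) ⟨0, by simp⟩ ?_ ?_ ?_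
    · rintro s t hst ⟨K, hK⟩
      exact ⟨K, hK.mono fun c hc z hz => hc z (hst hz)⟩
    · rintro s t ⟨K, hK⟩ ⟨K', hK'⟩
      refine ⟨max K K', ?_⟩
      filter_upwards [hK, hK'] with c hc hc' z hz
      rcases hz with hz | hz
      · exact (hc z hz).trans (le_max_left _ _)
      · exact (hc' z hz).trans (le_max_right _ _)
    · intro z hz
      obtain ⟨K, hK⟩ := hev z hz
      rw [nhds_prod_eq] at hK
      obtain ⟨p, hp, q, hq, hpq⟩ := eventually_prod_iff.mp hK
      exact ⟨{z | p z}, mem_nhdsWithin_of_mem_nhds hp, K, hq.mono fun c hc z hz => hpq hz hc⟩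
  obtain ⟨K, hK⟩ := hbound
  have key : ∃ᶠ j in atTop, ‖Ring.inverse (algebraMap ℂ A μ - w j)‖ ≤ K ∧
      IsUnit (algebraMap ℂ A μ - w j) := by
    refine (hwj.and_eventually (hw.eventually hK)).mono ?_
    rintro j ⟨hj, hjK⟩
    have hunit : ∀ z ∈ Metric.closedBall μ r, IsUnit (algebraMap ℂ A z - w j) :=
      fun z hz => spectrum.notMem_iff.mp (hj z hz)
    refine ⟨?_, hunit μ (Metric.mem_closedBall_self hr.le)⟩
    have hd : DifferentiableOn ℂ (fun z => Ring.inverse (algebraMap ℂ A z - w j))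
        (Metric.closedBall μ r) := by
      intro z hz
      have h1 : DifferentiableAt ℂ (fun z : ℂ => algebraMap ℂ A z - w j) z := by
        simp only [Algebra.algebraMap_eq_smul_one]
        fun_prop
      have h2 : DifferentiableAt ℂ (Ring.inverse : A → A) (algebraMap ℂ A z - w j) := by
        obtain ⟨u, hu⟩ := hunit z hz
        rw [← hu]
        exact differentiableAt_inverse u.isUnit
      exact (h2.comp z h1).differentiableWithinAt
    refine Complex.norm_le_of_forall_mem_frontier_norm_le (U := Metric.ball μ r)
      Metric.isBounded_ball ⟨hd.mono Metric.ball_subset_closedBall, ?_⟩ ?_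
      (subset_closure (Metric.mem_ball_self hr))
    · rw [closure_ball _ hr.ne']
      exact hd.continuousOn
    · rw [frontier_ball _ hr.ne']
      exact hjK
  -- pass to the limit
  rw [spectrum.notMem_iff]
  have hlim : Tendsto (fun j => algebraMap ℂ A μ - w j) atTop (𝓝 (algebraMap ℂ A μ - C)) :=
    tendsto_const_nhds.sub hw
  have hclose : ∀ᶠ j in atTop,
      ‖(algebraMap ℂ A μ - C) - (algebraMap ℂ A μ - w j)‖ * (|K| + 1) < 1 := by
    have : Tendsto (fun j => ‖(algebraMap ℂ A μ - C) - (algebraMap ℂ A μ - w j)‖ * (|K| + 1))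
        atTop (𝓝 (‖(algebraMap ℂ A μ - C) - (algebraMap ℂ A μ - C)‖ * (|K| + 1))) :=
      ((tendsto_const_nhds.sub hlim).norm.mul_const _)
    rw [sub_self, norm_zero, zero_mul] at this
    exact this.eventually (gt_mem_nhds one_pos)
  obtain ⟨j, ⟨hjK, hju⟩, hj⟩ := (key.and_eventually hclose).exists
  obtain ⟨u, hu⟩ := hju
  rw [← hu, Ring.inverse_unit] at hjK
  rcases subsingleton_or_nontrivial A with hA | hA
  · exact isUnit_of_subsingleton _
  have hupos : 0 < ‖(↑u⁻¹ : A)‖ := Units.norm_pos _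
  refine (u.ofNearby (algebraMap ℂ A μ - C) ?_).isUnit
  rw [← one_div, lt_div_iff₀ hupos]
  refine lt_of_le_of_lt (mul_le_mul_of_nonneg_left ?_ (norm_nonneg _)) (hu ▸ hj)
  linarith [le_abs_self K]

theorem norm_le_of_mem_spectrum_of_norm_pow_le (h1 : ‖(1 : A)‖ ≤ 1) {a : A} {r : ℝ} (hr : 0 ≤ r)
    {n : ℕ} (hn : 1 ≤ n) (h : ‖a ^ n‖ ≤ r ^ n) {z : ℂ} (hz : z ∈ spectrum ℂ a) : ‖z‖ ≤ r := by
  have h2 := spectrum.norm_le_norm_mul_of_mem (spectrum.pow_mem_pow a n hz)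
  rw [norm_pow] at h2
  refine le_of_pow_le_pow_left₀ (by omega) hr (h2.trans ?_)
  calc ‖a ^ n‖ * ‖(1 : A)‖ ≤ ‖a ^ n‖ * 1 := by gcongr
    _ ≤ r ^ n := by rwa [mul_one]

theorem IsCompact.exists_norm_pow_le {α : Type*} [TopologicalSpace α] {K : Set α}
    (hK : IsCompact K) {F : α → A} (hF : ContinuousOn F K) {r : ℝ} (hr : 0 < r)
    (h : ∀ t ∈ K, ∀ z ∈ spectrum ℂ (F t), ‖z‖ < r) :
    ∃ n : ℕ, 1 ≤ n ∧ ∀ t ∈ K, ‖F t ^ n‖ ≤ r ^ n := by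
  refine hK.induction_on (p := fun s => ∃ n : ℕ, 1 ≤ n ∧ ∀ t ∈ s, ‖F t ^ n‖ ≤ r ^ n)
    ⟨1, le_rfl, by simp⟩ ?_ ?_ ?_
  · rintro s t hst ⟨n, hn, hnt⟩
    exact ⟨n, hn, fun x hx => hnt x (hst hx)⟩
  · rintro s t ⟨n, hn, hns⟩ ⟨m, hm, hmt⟩
    refine ⟨n * m, Nat.mul_pos hn hm, ?_⟩
    rintro x (hx | hx)
    · rw [pow_mul, pow_mul]
      exact (norm_pow_le' _ hm).trans (pow_le_pow_left₀ (norm_nonneg _) (hns x hx) m)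
    · rw [mul_comm, pow_mul, pow_mul]
      exact (norm_pow_le' _ hn).trans (pow_le_pow_left₀ (norm_nonneg _) (hmt x hx) n)
  · intro x hx
    obtain ⟨n, hn, hlt⟩ := exists_norm_pow_lt (F x) hr (h x hx)
    have := ((hF x hx).pow n).norm.eventually (gt_mem_nhds hlt)
    exact ⟨_, this, n, hn, fun t ht => le_of_lt ht⟩

/-- The maximum principle for the spectral radius of an entire function. -/
theorem norm_le_of_mem_spectrum_of_sphere (h1 : ‖(1 : A)‖ ≤ 1) {F : ℂ → A}
    (hF : Differentiable ℂ F) {R r : ℝ} (hR : 0 < R) (hr : 0 < r)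
    (h : ∀ t : ℂ, ‖t‖ = R → ∀ z ∈ spectrum ℂ (F t), ‖z‖ < r)
    {z : ℂ} (hz : z ∈ spectrum ℂ (F 0)) : ‖z‖ ≤ r := by
  obtain ⟨n, hn, hb⟩ := (isCompact_sphere (0 : ℂ) R).exists_norm_pow_le
    hF.continuous.continuousOn hr
    (fun t ht => h t (by simpa using ht))
  refine norm_le_of_mem_spectrum_of_norm_pow_le h1 hr.le hn ?_ hz
  refine Complex.norm_le_of_forall_mem_frontier_norm_le (f := fun t => F t ^ n)
    (U := Metric.ball (0 : ℂ) R) Metric.isBounded_ball (hF.pow n).diffContOnCl ?_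
    (subset_closure (Metric.mem_ball_self hR))
  rw [frontier_ball _ hR.ne']
  exact hb

/-- A three circles theorem for the spectral radius of an entire function. -/
theorem norm_le_of_mem_spectrum_of_circles (h1 : ‖(1 : A)‖ ≤ 1) {F : ℂ → A}
    (hF : Differentiable ℂ F) {δ R r s : ℝ} (hδ : 0 < δ) (hδ1 : δ < 1) (hR : 1 < R)
    (hr : 0 < r) (hs : 0 ≤ s)
    (h : ∀ t : ℂ, ‖t‖ = δ → ∀ z ∈ spectrum ℂ (F t), ‖z‖ < r)
    (hb : ∀ t : ℂ, ‖t‖ = R → ‖F t‖ ≤ s)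
    {z : ℂ} (hz : z ∈ spectrum ℂ (F 1)) :
    ‖z‖ ≤ r ^ (1 - Real.log δ⁻¹ / Real.log (R / δ)) * s ^ (Real.log δ⁻¹ / Real.log (R / δ)) := by
  obtain ⟨n, hn, hn'⟩ := (isCompact_sphere (0 : ℂ) δ).exists_norm_pow_le
    hF.continuous.continuousOn hr (fun t ht => h t (by simpa using ht))
  refine norm_le_of_mem_spectrum_of_norm_pow_le h1 (by positivity) hn ?_ hz
  have hlog : Real.log δ < Real.log R := Real.log_lt_log hδ (hδ1.trans hR)
  have hG : Differentiable ℂ fun w : ℂ => F (Complex.exp w) ^ n :=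
    (hF.comp Complex.differentiable_exp).pow n
  have hmem : (0 : ℂ) ∈
      Complex.HadamardThreeLines.verticalClosedStrip (Real.log δ) (Real.log R) := by
    simp only [Complex.HadamardThreeLines.verticalClosedStrip, Set.mem_preimage, Complex.zero_re,
      Set.mem_Icc]
    exact ⟨(Real.log_neg hδ hδ1).le, (Real.log_pos hR).le⟩
  have hbdd : BddAbove ((norm ∘ fun w : ℂ => F (Complex.exp w) ^ n) ''
      Complex.HadamardThreeLines.verticalClosedStrip (Real.log δ) (Real.log R)) := by
    obtain ⟨C, hC⟩ := (isCompact_closedBall (0 : ℂ) R).exists_bound_of_continuousOn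
      (f := fun t => F t ^ n) (hF.pow n).continuous.continuousOn
    refine ⟨C, ?_⟩
    rintro _ ⟨w, hw, rfl⟩
    refine hC _ ?_
    rw [mem_closedBall_zero_iff, Complex.norm_exp]
    rw [← Real.exp_log (hδ.trans (hδ1.trans hR))]
    exact Real.exp_le_exp.mpr hw.2
  have := Complex.HadamardThreeLines.norm_le_interp_of_mem_verticalClosedStrip' (a := r ^ n)
    (b := s ^ n) hlog hmem hG.diffContOnCl hbdd ?_ ?_
  · simp only [Complex.exp_zero, Complex.zero_re, zero_sub] at this
    refine this.trans (le_of_eq ?_)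
    rw [Real.log_inv, Real.log_div (hδ.trans (hδ1.trans hR)).ne' hδ.ne', mul_pow]
    congr 1
    · rw [← Real.rpow_natCast, ← Real.rpow_natCast, ← Real.rpow_mul hr.le, ← Real.rpow_mul hr.le,
        mul_comm]
    · rw [← Real.rpow_natCast, ← Real.rpow_natCast, ← Real.rpow_mul hs, ← Real.rpow_mul hs,
        mul_comm]
  · intro w hw
    refine hn' _ ?_
    rw [mem_sphere_zero_iff_norm, Complex.norm_exp, show w.re = Real.log δ from hw, Real.exp_log hδ]
  · intro w hw
    refine (norm_pow_le' _ hn).trans (pow_le_pow_left₀ (norm_nonneg _) (hb _ ?_) n)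
    rw [Complex.norm_exp, show w.re = Real.log R from hw, Real.exp_log (hδ.trans (hδ1.trans hR))]

/-- Spectral inclusion for the exponential. -/
theorem exists_mem_spectrum_of_mem_spectrum_exp {c : A} {z : ℂ}
    (hz : z ∈ spectrum ℂ (exp c)) : ∃ α ∈ spectrum ℂ c, Complex.exp α = z := by
  let T : Set A := Set.centralizer {c}
  let S : Subalgebra ℂ A := Subalgebra.centralizer ℂ T
  have hcomm : ∀ x ∈ S, ∀ y ∈ S, x * y = y * x :=
    Set.centralizer_centralizer_comm_of_comm (S := {c}) (by simp)
  have hclosed : IsClosed (S : Set A) := Set.isClosed_centralizer T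
  have : CompleteSpace S := hclosed.completeSpace_coe
  let : NormedCommRing S :=
    { (inferInstance : NormedRing S) with
      mul_comm := fun x y => Subtype.ext (hcomm x x.2 y y.2) }
  let : NormedAlgebra ℚ S := NormedAlgebra.restrictScalars ℚ ℂ S
  let : NormedAlgebra ℚ A := NormedAlgebra.restrictScalars ℚ ℂ A
  have hcS : c ∈ S := by
    intro x hx
    exact (hx c rfl).symm
  let c' : S := ⟨c, hcS⟩
  have hexp : ((exp c' : S) : A) = exp c := map_exp S.val continuous_subtype_val c'
  have hz' : z ∈ spectrum ℂ (exp c' : S) := by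
    refine AlgHom.spectrum_apply_subset S.val (exp c') ?_
    change z ∈ spectrum ℂ ((exp c' : S) : A)
    rwa [hexp]
  obtain ⟨f, hf⟩ := WeakDual.CharacterSpace.mem_spectrum_iff_exists.mp hz'
  have hf1 : f (exp c') = exp (f c') :=
    map_exp (WeakDual.CharacterSpace.toAlgHom f) (map_continuous f) c'
  refine ⟨f c', ?_, ?_⟩
  · have hm : f c' ∈ spectrum ℂ c' := WeakDual.CharacterSpace.mem_spectrum_iff_exists.mpr ⟨f, rfl⟩
    by_contra hcon
    rw [spectrum.notMem_iff] at hcon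
    refine (spectrum.mem_iff.mp hm) ?_
    obtain ⟨u, hu⟩ := hcon
    have huS : ((u⁻¹ : Aˣ) : A) ∈ S := by
      intro x hx
      have hxu : Commute x (u : A) := by
        rw [hu]
        exact Commute.sub_right (Algebra.commutes _ x).symm (hx c rfl).symm
      exact hxu.units_inv_right.eq
    refine ⟨⟨algebraMap ℂ S (f c') - c', ⟨_, huS⟩, Subtype.ext ?_, Subtype.ext ?_⟩, rfl⟩
    · change (algebraMap ℂ A (f c') - c) * (u⁻¹ : Aˣ) = 1
      rw [← hu, Units.mul_inv]
    · change ((u⁻¹ : Aˣ) : A) * (algebraMap ℂ A (f c') - c) = 1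
      rw [← hu, Units.inv_mul]
  · rw [← hf, hf1, Complex.exp_eq_exp_ℂ]

end BanachAlgebra

section CompactSpectrum

variable {X : Type*} [NormedAddCommGroup X] [NormedSpace ℂ X] [CompleteSpace X]

/-- The spectrum of a compact operator is finite away from zero. -/
theorem IsCompactOperator.finite_spectrum {T : X →L[ℂ] X} (hT : IsCompactOperator T) {ε : ℝ}
    (hε : 0 < ε) : {z ∈ spectrum ℂ T | ε ≤ ‖z‖}.Finite := by
  by_contra hinf
  have hinf : Set.Infinite {z ∈ spectrum ℂ T | ε ≤ ‖z‖} := hinf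
  let μ := hinf.natEmbedding
  have hμε : ∀ n, ε ≤ ‖(μ n : ℂ)‖ := fun n => (μ n).2.2
  have hμ0 : ∀ n, (μ n : ℂ) ≠ 0 := fun n h => by
    have := hμε n
    rw [h, norm_zero] at this
    linarith
  have hev : ∀ n, ∃ v, Module.End.HasEigenvector (T : Module.End ℂ X) (μ n : ℂ) v := fun n =>
    ((hT.hasEigenvalue_iff_mem_spectrum (hμ0 n)).mpr (μ n).2.1).exists_hasEigenvector
  choose v hv using hev
  have hvT : ∀ n, T (v n) = (μ n : ℂ) • v n := fun n => (hv n).apply_eq_smul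
  have hli : LinearIndependent ℂ v := by
    have hinj : Function.Injective fun n => (μ n : ℂ) :=
      Subtype.val_injective.comp μ.injective
    exact Module.End.eigenvectors_linearIndependent' (T : Module.End ℂ X) _ hinj v hv
  let Y : ℕ → Submodule ℂ X := fun n => Submodule.span ℂ (v '' Set.Iio n)
  have hfin : ∀ n, FiniteDimensional ℂ (Y n) := fun n =>
    FiniteDimensional.span_of_finite ℂ ((Set.finite_Iio n).image v)
  have hmono : Monotone Y := fun m n hmn =>
    Submodule.span_mono (Set.image_mono (Set.Iio_subset_Iio hmn))
  have hvmem : ∀ n, v n ∈ Y (n + 1) := fun n =>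
    Submodule.subset_span ⟨n, by simp, rfl⟩
  have hvnot : ∀ n, v n ∉ Y n := fun n => hli.notMem_span_image (by simp)
  have hTY : ∀ n, ∀ y ∈ Y n, T y ∈ Y n := by
    intro n y hy
    refine Submodule.span_induction (p := fun y _ => T y ∈ Y n) ?_ (by simp) ?_ ?_ hy
    · rintro _ ⟨i, hi, rfl⟩
      rw [hvT]
      exact (Y n).smul_mem _ (Submodule.subset_span ⟨i, hi, rfl⟩)
    · intro a b _ _ ha hb
      rw [map_add]
      exact (Y n).add_mem ha hb
    · intro c a _ ha
      rw [map_smul]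
      exact (Y n).smul_mem _ ha
  have hTsub : ∀ n, ∀ y ∈ Y (n + 1), T y - (μ n : ℂ) • y ∈ Y n := by
    intro n y hy
    refine Submodule.span_induction (p := fun y _ => T y - (μ n : ℂ) • y ∈ Y n) ?_
      (by simp) ?_ ?_ hy
    · rintro _ ⟨i, hi, rfl⟩
      rw [hvT, ← sub_smul]
      rcases (Nat.lt_succ_iff_lt_or_eq.mp hi) with hi | rfl
      · exact (Y n).smul_mem _ (Submodule.subset_span ⟨i, hi, rfl⟩)
      · simp
    · intro a b _ _ ha hb
      rw [map_add, smul_add, add_sub_add_comm]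
      exact (Y n).add_mem ha hb
    · intro c a _ ha
      rw [map_smul, smul_comm, ← smul_sub]
      exact (Y n).smul_mem _ ha
  have hy : ∀ n, ∃ y ∈ Y (n + 1), ‖y‖ = 1 ∧ ∀ u ∈ Y n, 1 / 2 ≤ ‖y - u‖ := by
    intro n
    have hcl : IsClosed ((Y n).comap (Y (n + 1)).subtype : Set (Y (n + 1))) := by
      have := (Y n).closed_of_finiteDimensional
      exact this.preimage continuous_subtype_val
    obtain ⟨y, _, hy1, hy2⟩ := riesz_lemma_of_lt_one (𝕜 := ℂ) hcl
      ⟨⟨v n, hvmem n⟩, fun h => hvnot n h⟩ (r := 1 / 2) (by norm_num)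
    exact ⟨y, y.2, hy1, fun u hu => hy2 ⟨u, hmono n.le_succ hu⟩ hu⟩
  choose y hyY hy1 hyd using hy
  have hsep : ∀ m n, m < n → ε / 2 ≤ ‖T (y n) - T (y m)‖ := by
    intro m n hmn
    have hu : T (y m) - (T (y n) - (μ n : ℂ) • y n) ∈ Y n :=
      (Y n).sub_mem (hTY n _ (hmono hmn (hyY m))) (hTsub n _ (hyY n))
    have h1 := hyd n _ ((Y n).smul_mem (μ n : ℂ)⁻¹ hu)
    have h2 : T (y n) - T (y m) = (μ n : ℂ) • (y n - (μ n : ℂ)⁻¹ •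
        (T (y m) - (T (y n) - (μ n : ℂ) • y n))) := by
      rw [smul_sub, smul_inv_smul₀ (hμ0 n)]
      abel
    rw [h2, norm_smul]
    nlinarith [hμε n]
  obtain ⟨K, hK, hKsub⟩ := IsCompactOperator.image_closedBall_subset_compact
    (f := (T : X →ₗ[ℂ] X)) hT 1
  obtain ⟨a, -, φ, hφ, hlim⟩ := hK.tendsto_subseq (x := fun n => T (y n))
    (fun n => hKsub ⟨y n, by simp [hy1 n], rfl⟩)
  obtain ⟨N, hN⟩ := Metric.cauchySeq_iff'.mp hlim.cauchySeq (ε / 2) (by positivity)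
  have := hN (N + 1) N.le_succ
  rw [dist_eq_norm] at this
  exact (hsep _ _ (hφ N.lt_succ_self)).not_gt this

/-- A nonzero spectral value of a compact operator is a limit of spectral values of approximating
operators. -/
theorem IsCompactOperator.exists_mem_spectrum_near {C : X →L[ℂ] X} (hC : IsCompactOperator C)
    {μ : ℂ} (hμ0 : μ ≠ 0) (hμ : μ ∈ spectrum ℂ C) {w : ℕ → X →L[ℂ] X}
    (hw : Tendsto w atTop (𝓝 C)) {ε : ℝ} (hε : 0 < ε) :
    ∀ᶠ j in atTop, ∃ z ∈ spectrum ℂ (w j), ‖z - μ‖ < ε := by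
  have hμn : 0 < ‖μ‖ := norm_pos_iff.mpr hμ0
  have hfin := (hC.finite_spectrum (half_pos hμn)).subset
    (Set.sdiff_subset (s := {z ∈ spectrum ℂ C | ‖μ‖ / 2 ≤ ‖z‖}) (t := {μ}))
  have hnhds : ({z ∈ spectrum ℂ C | ‖μ‖ / 2 ≤ ‖z‖} \ {μ})ᶜ ∈ 𝓝 μ :=
    hfin.isClosed.isOpen_compl.mem_nhds (by simp)
  obtain ⟨δ, hδ, hball⟩ := Metric.mem_nhds_iff.mp hnhds
  obtain ⟨r, hr0, hr⟩ : ∃ r, 0 < r ∧ r < min (min δ ε) (‖μ‖ / 2) := exists_between (by positivity)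
  simp only [lt_min_iff] at hr
  by_contra hcon
  rw [not_eventually] at hcon
  refine notMem_spectrum_of_tendsto hw hr0 (fun z hz hzs => ?_)
    (hcon.mono fun j hj z hz hzs => ?_) hμ
  · have hzr : ‖z - μ‖ = r := mem_sphere_iff_norm.mp hz
    have hzb : z ∈ Metric.ball μ δ := by
      rw [mem_ball_iff_norm, hzr]
      exact hr.1.1
    refine hball hzb ⟨⟨hzs, ?_⟩, ?_⟩
    · have := norm_sub_norm_le μ z
      rw [norm_sub_rev, hzr] at this
      linarith [hr.2]
    · rintro rfl
      simp at hzr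
      linarith
  · exact hj ⟨z, hzs, (mem_closedBall_iff_norm.mp hz).trans_lt hr.1.2⟩

end CompactSpectrum

section ExpMean

variable {E : Type*} [NormedRing E] [NormedAlgebra ℂ E] [CompleteSpace E]

theorem continuous_exp_of_complex : Continuous (exp : E → E) := by
  let : NormedAlgebra ℚ E := NormedAlgebra.restrictScalars ℚ ℂ E
  exact exp_continuous

theorem exp_mul_exp_neg_of_complex (a : E) : exp a * exp (-a) = 1 := by
  let : NormedAlgebra ℚ E := NormedAlgebra.restrictScalars ℚ ℂ E
  rw [← exp_add_of_commute (Commute.refl a).neg_right, add_neg_cancel, exp_zero]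

theorem exp_neg_mul_exp_of_complex (a : E) : exp (-a) * exp a = 1 := by
  simpa using exp_mul_exp_neg_of_complex (-a)

/-- The average of `s ↦ exp (s w)` over the unit interval. -/
noncomputable def expMean (w : E) : E := ∫ s in (0 : ℝ)..1, exp (s • w)

theorem continuous_exp_smul : Continuous fun p : E × ℝ => exp (p.2 • p.1) :=
  continuous_exp_of_complex.comp (continuous_snd.smul continuous_fst)

theorem continuous_exp_real_smul (w : E) : Continuous fun s : ℝ => exp (s • w) :=
  continuous_exp_smul.comp (Continuous.prodMk continuous_const continuous_id)

theorem expMean_zero : expMean (0 : E) = 1 := by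
  simp [expMean]

theorem exists_lipschitzOnWith_expMean :
    ∃ ρ : ℝ, 0 < ρ ∧ ∃ K : NNReal, LipschitzOnWith K (expMean : E → E) (Metric.ball 0 ρ) := by
  have h1 : ContDiffAt ℂ 1 (exp : E → E) 0 := (exp_analytic (𝕂 := ℂ) (0 : E)).contDiffAt
  obtain ⟨K, t, ht, hK⟩ := h1.exists_lipschitzOnWith
  obtain ⟨ρ, hρ, hball⟩ := Metric.mem_nhds_iff.mp ht
  refine ⟨ρ, hρ, K, LipschitzOnWith.of_dist_le_mul fun x hx y hy => ?_⟩
  rw [dist_eq_norm, dist_eq_norm, expMean, expMean, ← intervalIntegral.integral_sub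
    ((continuous_exp_real_smul x).intervalIntegrable _ _)
    ((continuous_exp_real_smul y).intervalIntegrable _ _)]
  have hsm : ∀ s ∈ Set.uIoc (0 : ℝ) 1, ∀ x ∈ Metric.ball (0 : E) ρ, s • x ∈ t := by
    intro s hs x hx
    rw [Set.uIoc_of_le zero_le_one] at hs
    refine hball ?_
    rw [mem_ball_zero_iff] at hx ⊢
    rw [norm_smul, Real.norm_of_nonneg hs.1.le]
    nlinarith [norm_nonneg x, hs.2]
  refine (intervalIntegral.norm_integral_le_of_norm_le_const (C := K * ‖x - y‖) ?_).trans ?_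
  · intro s hs
    have h2 := hK.dist_le_mul _ (hsm s hs x hx) _ (hsm s hs y hy)
    rw [dist_eq_norm, dist_eq_norm, ← smul_sub, norm_smul] at h2
    rw [Set.uIoc_of_le zero_le_one] at hs
    refine h2.trans (mul_le_mul_of_nonneg_left ?_ K.2)
    rw [Real.norm_of_nonneg hs.1.le]
    nlinarith [norm_nonneg (x - y), hs.2]
  · simp

theorem exists_lipschitzOnWith_inverse_expMean :
    ∃ ρ : ℝ, 0 < ρ ∧ ∃ K : NNReal,
      LipschitzOnWith K (fun w : E => Ring.inverse (expMean w)) (Metric.ball 0 ρ) ∧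
      ∀ w ∈ Metric.ball (0 : E) ρ, IsUnit (expMean w) ∧ ‖Ring.inverse (expMean w)‖ ≤ K := by
  obtain ⟨ρ, hρ, K, hK⟩ := exists_lipschitzOnWith_expMean (E := E)
  have h1 : ContDiffAt ℂ 1 (Ring.inverse : E → E) ((1 : Eˣ) : E) := contDiffAt_ringInverse ℂ 1
  obtain ⟨K', t, ht, hK'⟩ := h1.exists_lipschitzOnWith
  have hc : ContinuousAt (expMean : E → E) 0 :=
    hK.continuousOn.continuousAt (Metric.ball_mem_nhds _ hρ)
  have hunit : {x : E | IsUnit x} ∈ 𝓝 ((1 : Eˣ) : E) := Units.nhds 1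
  have hbd : {x : E | ‖Ring.inverse x‖ < ‖Ring.inverse (1 : E)‖ + 1} ∈ 𝓝 ((1 : Eˣ) : E) :=
    (NormedRing.inverse_continuousAt (1 : Eˣ)).norm.eventually (gt_mem_nhds (lt_add_one _))
  have hmem : (expMean : E → E) ⁻¹' (t ∩ ({x : E | IsUnit x} ∩
      {x : E | ‖Ring.inverse x‖ < ‖Ring.inverse (1 : E)‖ + 1})) ∈ 𝓝 0 := by
    refine hc.preimage_mem_nhds ?_
    rw [expMean_zero]
    exact inter_mem ht (inter_mem hunit hbd)
  obtain ⟨ρ', hρ', hb⟩ := Metric.mem_nhds_iff.mp hmem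
  refine ⟨min ρ ρ', lt_min hρ hρ', K' * K + (‖Ring.inverse (1 : E)‖ + 1).toNNReal, ?_, ?_⟩
  · refine LipschitzOnWith.weaken (K := K' * K) ?_ le_self_add
    exact hK'.comp (hK.mono (Metric.ball_subset_ball (min_le_left _ _)))
      fun x hx => (hb (Metric.ball_subset_ball (min_le_right _ _) hx)).1
  · intro w hw
    have := (hb (Metric.ball_subset_ball (min_le_right _ _) hw)).2
    refine ⟨this.1, this.2.le.trans ?_⟩
    rw [NNReal.coe_add, Real.coe_toNNReal _ (by positivity)]
    exact le_add_of_nonneg_left (NNReal.coe_nonneg _)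

end ExpMean

section MeanValue

variable {E : Type*} [NormedAddCommGroup E] [NormedSpace ℂ E]

theorem Submodule.sub_mem_of_hasDerivWithinAt (V : Submodule ℂ E) (hV : IsClosed (V : Set E))
    {f f' : ℝ → E} {a b : ℝ}
    (hf : ∀ t ∈ Set.Icc a b, HasDerivWithinAt f (f' t) (Set.Icc a b) t)
    (hf' : ∀ t ∈ Set.Icc a b, f' t ∈ V) : ∀ t ∈ Set.Icc a b, f t - f a ∈ V := by
  have : IsClosed (V : Set E) := hV
  have hd : ∀ t ∈ Set.Icc a b,
      HasDerivWithinAt (fun t => V.mkQL (f t)) 0 (Set.Icc a b) t := by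
    intro t ht
    have h1 := ((V.mkQL.restrictScalars ℝ).hasFDerivAt (x := f t)).comp_hasDerivWithinAt t (hf t ht)
    have h2 : (V.mkQL.restrictScalars ℝ) (f' t) = 0 :=
      (Submodule.Quotient.mk_eq_zero V).mpr (hf' t ht)
    rw [h2] at h1
    exact h1
  intro t ht
  have h3 := constant_of_has_deriv_right_zero (f := fun t => V.mkQL (f t))
    (fun t ht => (hd t ht).continuousWithinAt)
    (fun t ht => (hd t (Set.Ico_subset_Icc_self ht)).mono_of_mem_nhdsWithin
      (Icc_mem_nhdsGE_of_mem ht)) t ht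
  exact (Submodule.Quotient.eq V).mp h3

end MeanValue

section ExpDerivative

variable {A : Type*} [NormedRing A] [NormedAlgebra ℂ A] [CompleteSpace A]

/-- The integral `∫₀¹ exp (s z₁) h exp (-s z₀) ds`. -/
@[irreducible] noncomputable def expInterp (z₁ z₀ h : A) : A :=
  ∫ s in (0 : ℝ)..1, exp (s • z₁) * h * exp (-(s • z₀))

theorem continuous_expInterp : Continuous fun p : A × A × A => expInterp p.1 p.2.1 p.2.2 := by
  simp only [expInterp]
  refine intervalIntegral.continuous_parametric_intervalIntegral_of_continuous' ?_ 0 1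
  have hc := continuous_exp_of_complex (E := A)
  simp only [Function.uncurry_def]
  fun_prop

theorem Filter.Tendsto.expInterp {α : Type*} {l : Filter α} {f g h : α → A} {a b c : A}
    (hf : Tendsto f l (𝓝 a)) (hg : Tendsto g l (𝓝 b)) (hh : Tendsto h l (𝓝 c)) :
    Tendsto (fun u => _root_.expInterp (f u) (g u) (h u)) l (𝓝 (_root_.expInterp a b c)) := by
  have h4 : Tendsto (fun p : A × A × A => _root_.expInterp p.1 p.2.1 p.2.2) (𝓝 (a, b, c))
      (𝓝 (_root_.expInterp a b c)) := continuous_expInterp.continuousAt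
  exact h4.comp (hf.prodMk_nhds (hg.prodMk_nhds hh))

omit [CompleteSpace A] in
theorem smul_expInterp (c : ℝ) (z₁ z₀ h : A) :
    expInterp z₁ z₀ (c • h) = c • expInterp z₁ z₀ h := by
  simp only [expInterp, ← intervalIntegral.integral_smul, mul_smul_comm, smul_mul_assoc]

theorem hasDerivAt_exp_real_smul (z : A) (s : ℝ) :
    HasDerivAt (fun s : ℝ => exp (s • z)) (exp (s • z) * z) s :=
  hasDerivAt_exp_smul_const (𝕂 := ℝ) z s

theorem hasDerivAt_exp_real_smul' (z : A) (s : ℝ) :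
    HasDerivAt (fun s : ℝ => exp (s • z)) (z * exp (s • z)) s :=
  hasDerivAt_exp_smul_const' (𝕂 := ℝ) z s

theorem hasDerivAt_exp_neg_real_smul (z : A) (s : ℝ) :
    HasDerivAt (fun s : ℝ => exp (-(s • z))) (-(z * exp (-(s • z)))) s := by
  have := hasDerivAt_exp_real_smul' (-z) s
  simpa only [smul_neg, neg_mul] using this

theorem hasDerivAt_exp_neg_real_smul' (z : A) (s : ℝ) :
    HasDerivAt (fun s : ℝ => exp (-(s • z))) (-(exp (-(s • z)) * z)) s := by
  have := hasDerivAt_exp_real_smul (-z) s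
  simpa only [smul_neg, mul_neg] using this

theorem exp_sub_exp (z₁ z₀ : A) :
    exp z₁ - exp z₀ = expInterp z₁ z₀ (z₁ - z₀) * exp z₀ := by
  have hd : ∀ s : ℝ, HasDerivAt (fun s : ℝ => exp (s • z₁) * exp (-(s • z₀)))
      (exp (s • z₁) * (z₁ - z₀) * exp (-(s • z₀))) s := by
    intro s
    refine ((hasDerivAt_exp_real_smul z₁ s).fun_mul
      (hasDerivAt_exp_neg_real_smul z₀ s)).congr_deriv ?_
    noncomm_ring
  have hc : Continuous fun s : ℝ => exp (s • z₁) * (z₁ - z₀) * exp (-(s • z₀)) := by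
    have hc := continuous_exp_of_complex (E := A)
    fun_prop
  have := intervalIntegral.integral_eq_sub_of_hasDerivAt (a := 0) (b := 1) (fun s _ => hd s)
    (hc.intervalIntegrable _ _)
  rw [expInterp, this]
  simp only [one_smul, zero_smul, neg_zero, exp_zero, mul_one]
  rw [sub_mul, mul_assoc, exp_neg_mul_exp_of_complex, mul_one, one_mul]

theorem hasDerivWithinAt_exp_curve {z : ℝ → A} {z' : A} {S : Set ℝ} {t : ℝ}
    (hz : HasDerivWithinAt z z' S t) :
    HasDerivWithinAt (fun t => exp (z t)) (expInterp (z t) (z t) z' * exp (z t)) S t := by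
  have hcont : Tendsto z (𝓝[S \ {t}] t) (𝓝 (z t)) :=
    hz.continuousWithinAt.mono Set.sdiff_subset
  rw [hasDerivWithinAt_iff_tendsto_slope] at hz ⊢
  have h2 : Tendsto (fun u => expInterp (z u) (z t) (slope z t u) * exp (z t)) (𝓝[S \ {t}] t)
      (𝓝 (expInterp (z t) (z t) z' * exp (z t))) := by
    have h6 : Tendsto (fun u => expInterp (z u) (z t) (slope z t u)) (𝓝[S \ {t}] t)
        (𝓝 (expInterp (z t) (z t) z')) := hcont.expInterp tendsto_const_nhds hz
    exact h6.mul_const _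
  have h5 : ∀ u, expInterp (z u) (z t) (slope z t u) * exp (z t) =
      slope (fun t => exp (z t)) t u := by
    intro u
    rw [slope_def_module, slope_def_module, smul_expInterp, exp_sub_exp, smul_mul_assoc]
  exact h2.congr h5

end ExpDerivative

section Adjoint

variable {A : Type*} [NormedRing A] [NormedAlgebra ℂ A]
  {G : Type*} [NormedAddCommGroup G] [NormedSpace ℂ G] {ι : G →ₗᵢ[ℂ] A}

/-- The commutator of two elements of `G`, computed in the ambient algebra. -/
noncomputable def adFun (hι : ∀ x y : G, ∃ z, ι z = ι x * ι y - ι y * ι x) (x y : G) : G :=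
  (hι x y).choose

theorem map_adFun (hι : ∀ x y : G, ∃ z, ι z = ι x * ι y - ι y * ι x) (x y : G) :
    ι (adFun hι x y) = ι x * ι y - ι y * ι x := (hι x y).choose_spec

/-- The adjoint representation of a Lie algebra `G` embedded in a normed algebra. -/
noncomputable def adRep (hι : ∀ x y : G, ∃ z, ι z = ι x * ι y - ι y * ι x) :
    G →L[ℂ] G →L[ℂ] G :=
  LinearMap.mkContinuous₂
    (LinearMap.mk₂ ℂ (adFun hι)
      (fun x x' y => ι.injective (by
        simp only [map_add, map_adFun]; noncomm_ring))
      (fun c x y => ι.injective (by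
        simp only [map_smul, map_adFun, smul_mul_assoc, mul_smul_comm, smul_sub]))
      (fun x y y' => ι.injective (by
        simp only [map_add, map_adFun]; noncomm_ring))
      (fun c x y => ι.injective (by
        simp only [map_smul, map_adFun, smul_mul_assoc, mul_smul_comm, smul_sub])))
    2 (fun x y => by
      rw [LinearMap.mk₂_apply, ← ι.norm_map, map_adFun, ← ι.norm_map x, ← ι.norm_map y]
      refine (norm_sub_le _ _).trans ?_
      have h1 := norm_mul_le (ι x) (ι y)
      have h2 := norm_mul_le (ι y) (ι x)
      nlinarith)

variable (hι : ∀ x y : G, ∃ z, ι z = ι x * ι y - ι y * ι x)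

theorem map_adRep (x y : G) : ι (adRep hι x y) = ι x * ι y - ι y * ι x := map_adFun hι x y

variable [CompleteSpace A] [CompleteSpace G]

omit [CompleteSpace A] in
theorem hasDerivAt_exp_adRep (z h : G) (s : ℝ) :
    HasDerivAt (fun s : ℝ => exp (s • adRep hι z) h)
      (adRep hι z (exp (s • adRep hι z) h)) s :=
  ((ContinuousLinearMap.apply ℂ G h).restrictScalars ℝ).hasFDerivAt.comp_hasDerivAt s
    (hasDerivAt_exp_real_smul' (adRep hι z) s)

omit [CompleteSpace A] in
theorem hasDerivAt_map_exp_adRep (z h : G) (s : ℝ) :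
    HasDerivAt (fun s : ℝ => ι (exp (s • adRep hι z) h))
      (ι (adRep hι z (exp (s • adRep hι z) h))) s :=
  (ι.toContinuousLinearMap.restrictScalars ℝ).hasFDerivAt.comp_hasDerivAt s
    (hasDerivAt_exp_adRep hι z h s)

theorem map_exp_adRep (z h : G) (s : ℝ) :
    ι (exp (s • adRep hι z) h) = exp (s • ι z) * ι h * exp (-(s • ι z)) := by
  let φ : ℝ → A := fun s => exp (-(s • ι z)) * ι (exp (s • adRep hι z) h) * exp (s • ι z)
  have hd : ∀ s, HasDerivAt φ 0 s := by
    intro s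
    refine (((hasDerivAt_exp_neg_real_smul' (ι z) s).fun_mul
      (hasDerivAt_map_exp_adRep hι z h s)).fun_mul
      (hasDerivAt_exp_real_smul' (ι z) s)).congr_deriv ?_
    rw [map_adRep]
    noncomm_ring
  have hconst := is_const_of_deriv_eq_zero (𝕜 := ℝ) (fun s => (hd s).differentiableAt)
    (fun s => (hd s).deriv) s 0
  simp only [φ, zero_smul, neg_zero, exp_zero, one_mul, mul_one,
    one_apply_eq_self] at hconst
  rw [← hconst]
  calc ι (exp (s • adRep hι z) h) = (exp (s • ι z) * exp (-(s • ι z))) *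
        ι (exp (s • adRep hι z) h) * (exp (s • ι z) * exp (-(s • ι z))) := by
        rw [exp_mul_exp_neg_of_complex, one_mul, mul_one]
    _ = _ := by simp only [mul_assoc]

theorem map_expMean_adRep (z h : G) :
    ι (expMean (adRep hι z) h) = expInterp (ι z) (ι z) (ι h) := by
  have h1 : expMean (adRep hι z) h = ∫ s in (0 : ℝ)..1, exp (s • adRep hι z) h :=
    ((ContinuousLinearMap.apply ℂ G h).intervalIntegral_comp_comm
      ((continuous_exp_real_smul (adRep hι z)).intervalIntegrable 0 1)).symm
  have hc : Continuous fun s : ℝ => exp (s • adRep hι z) h :=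
    (ContinuousLinearMap.apply ℂ G h).continuous.comp (continuous_exp_real_smul (adRep hι z))
  rw [h1, expInterp]
  refine (ι.toContinuousLinearMap.intervalIntegral_comp_comm
    (hc.intervalIntegrable 0 1)).symm.trans ?_
  simp only [LinearIsometry.coe_toContinuousLinearMap, map_exp_adRep]

variable {V : Submodule ℂ A} (hV : IsClosed (V : Set A))
  (hιV : ∀ x y : G, ι x * ι y - ι y * ι x ∈ V)

include hV hιV in
omit [CompleteSpace A] in
theorem exp_adRep_sub_mem (z h : G) {s : ℝ} (hs : 0 ≤ s) :
    ι (exp (s • adRep hι z) h) - ι h ∈ V := by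
  have := V.sub_mem_of_hasDerivWithinAt hV (a := 0) (b := s)
    (fun t _ => (hasDerivAt_map_exp_adRep hι z h t).hasDerivWithinAt)
    (fun t _ => by rw [map_adRep]; exact hιV _ _) s ⟨hs, le_rfl⟩
  simpa using this

include hV hιV in
theorem expMean_adRep_sub_mem (z h : G) : ι (expMean (adRep hι z) h) - ι h ∈ V := by
  have hc : Continuous fun s : ℝ => ι (exp (s • adRep hι z) h) :=
    ι.continuous.comp
    ((ContinuousLinearMap.apply ℂ G h).continuous.comp (continuous_exp_real_smul (adRep hι z)))
  have hd : ∀ t ∈ Set.Icc (0 : ℝ) 1, HasDerivWithinAt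
      (fun t : ℝ => (∫ s in (0 : ℝ)..t, ι (exp (s • adRep hι z) h)) - t • ι h)
      (ι (exp (t • adRep hι z) h) - (1 : ℝ) • ι h) (Set.Icc 0 1) t := fun t _ =>
    ((intervalIntegral.integral_hasDerivAt_right (hc.intervalIntegrable _ _)
      (hc.stronglyMeasurableAtFilter _ _) hc.continuousAt).sub
      ((hasDerivAt_id t).smul_const (ι h))).hasDerivWithinAt
  have := V.sub_mem_of_hasDerivWithinAt hV hd (fun t ht => by
    rw [one_smul]
    exact exp_adRep_sub_mem hι hV hιV z h ht.1) 1 ⟨zero_le_one, le_rfl⟩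
  rw [map_expMean_adRep, expInterp]
  simpa only [map_exp_adRep, intervalIntegral.integral_same, zero_smul, sub_zero, one_smul] using
    this

end Adjoint

theorem IsPicardLindelof.exists_hasDerivWithinAt_mem_closedBall {E : Type*} [NormedAddCommGroup E]
    [NormedSpace ℝ E] [CompleteSpace E] {f : ℝ → E → E} {tmin tmax : ℝ} {t₀ : Set.Icc tmin tmax}
    {x₀ : E} {a L K : NNReal} (hf : IsPicardLindelof f t₀ x₀ a 0 L K) :
    ∃ α : ℝ → E, α t₀ = x₀ ∧ ∀ t ∈ Set.Icc tmin tmax,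
      α t ∈ Metric.closedBall x₀ a ∧ HasDerivWithinAt α (f t (α t)) (Set.Icc tmin tmax) t := by
  have hx : x₀ ∈ Metric.closedBall x₀ ((0 : NNReal) : ℝ) := by simp
  obtain ⟨α, hα⟩ := ODE.FunSpace.exists_isFixedPt_next hf hx
  rw [ODE.FunSpace.isFixedPt_next_iff] at hα
  have hmem : ∀ t, α.compProj t ∈ Metric.closedBall x₀ a := fun t =>
    α.compProj_mem_closedBall hf.mul_max_le
  refine ⟨α.compProj, ?_, fun t ht => ⟨hmem t, ?_⟩⟩
  · rw [ODE.FunSpace.compProj_val, hα, ODE.picard_apply₀]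
  · have h1 := ODE.hasDerivWithinAt_picard_Icc t₀.2 hf.continuousOn_uncurry
      α.continuous_compProj.continuousOn (fun t _ => hmem t) x₀ ht
    refine h1.congr (fun s hs => ?_) ?_
    · rw [ODE.FunSpace.compProj_of_mem hs, hα]
    · rw [ODE.FunSpace.compProj_of_mem ht, hα]

section ProdExp

variable {A : Type*} [NormedRing A] [NormedAlgebra ℂ A] [CompleteSpace A]
  {G : Type*} [NormedAddCommGroup G] [NormedSpace ℂ G] [CompleteSpace G] {ι : G →ₗᵢ[ℂ] A}

/-- The product of the exponentials of the members of a list. -/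
noncomputable def prodExp (l : List A) : A := (l.map exp).prod

omit [NormedAlgebra ℂ A] [CompleteSpace A] in
@[simp]
theorem prodExp_nil : prodExp ([] : List A) = 1 := rfl

omit [NormedAlgebra ℂ A] [CompleteSpace A] in
@[simp]
theorem prodExp_cons (a : A) (l : List A) : prodExp (a :: l) = exp a * prodExp l := by
  simp [prodExp]

variable (hι : ∀ x y : G, ∃ z, ι z = ι x * ι y - ι y * ι x)

/-- The left logarithmic derivative of `t ↦ ∏ exp (t ζ x)`, as an element of the Lie algebra. -/
noncomputable def leftLogDeriv : List G → ℂ → ℝ → G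
  | [], _, _ => 0
  | x :: l, ζ, t => ζ • x + exp (t • adRep hι (ζ • x)) (leftLogDeriv l ζ t)

omit [CompleteSpace A] in
theorem continuous_leftLogDeriv (l : List G) :
    Continuous fun p : ℂ × ℝ => leftLogDeriv hι l p.1 p.2 := by
  induction l with
  | nil => exact continuous_const
  | cons x l ih =>
    have hc := continuous_exp_of_complex (E := G →L[ℂ] G)
    have h1 : Continuous fun p : ℂ × ℝ => exp (p.2 • adRep hι (p.1 • x)) := by fun_prop
    exact (continuous_fst.smul continuous_const).add (h1.clm_apply ih)

theorem hasDerivAt_prodExp (l : List G) (ζ : ℂ) (t : ℝ) :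
    HasDerivAt (fun t : ℝ => prodExp (l.map fun x => t • ι (ζ • x)))
      (ι (leftLogDeriv hι l ζ t) * prodExp (l.map fun x => t • ι (ζ • x))) t := by
  induction l with
  | nil => simpa [leftLogDeriv] using hasDerivAt_const t (1 : A)
  | cons x l ih =>
    simp only [List.map_cons, prodExp_cons, leftLogDeriv, map_add]
    refine ((hasDerivAt_exp_real_smul' (ι (ζ • x)) t).fun_mul ih).congr_deriv ?_
    rw [map_exp_adRep, add_mul, mul_assoc, mul_assoc, ← mul_assoc (exp (-(t • ι (ζ • x)))),
      exp_neg_mul_exp_of_complex, one_mul, mul_assoc]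

variable {V : Submodule ℂ A} (hV : IsClosed (V : Set A))
  (hιV : ∀ x y : G, ι x * ι y - ι y * ι x ∈ V)

include hV hιV in
omit [CompleteSpace A] in
theorem leftLogDeriv_sub_mem (l : List G) (ζ : ℂ) {t : ℝ} (ht : 0 ≤ t) :
    ι (leftLogDeriv hι l ζ t) - ι (ζ • l.sum) ∈ V := by
  induction l with
  | nil => simp [leftLogDeriv]
  | cons x l ih =>
    have h1 := V.add_mem (exp_adRep_sub_mem hι hV hιV (ζ • x) (leftLogDeriv hι l ζ t) ht) ih
    convert h1 using 1
    simp only [leftLogDeriv, List.sum_cons, smul_add, map_add]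
    abel

include hι hV hιV in
/-- A weak form of the Baker–Campbell–Hausdorff formula: near the origin, a product of exponentials
is the exponential of an element of the Lie algebra, which is the sum of the exponents modulo a
closed subspace containing all commutators. -/
theorem exists_prodExp_eq_exp (l : List G) :
    ∃ δ : ℝ, 0 < δ ∧ ∀ t : ℂ, ‖t‖ ≤ δ → ∃ z : G,
      prodExp (l.map fun x => t • ι x) = exp (ι z) ∧ ι z - t • ι l.sum ∈ V := by
  obtain ⟨ρ, hρ, K, hK, hK'⟩ := exists_lipschitzOnWith_inverse_expMean (E := G →L[ℂ] G)
  obtain ⟨M, hM⟩ := ((isCompact_sphere (0 : ℂ) 1).prod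
    (isCompact_Icc (a := (0 : ℝ)) (b := 1))).exists_bound_of_continuousOn
    (continuous_leftLogDeriv hι l).continuousOn
  have hM0 : 0 ≤ M := (norm_nonneg _).trans (hM (1, 0) (by simp))
  lift M to NNReal using hM0
  let N : NNReal := ‖adRep hι‖₊
  let a : NNReal := ⟨ρ / (2 * (N + 1)), by positivity⟩
  have ha : 0 < (a : ℝ) := by change 0 < ρ / (2 * (N + 1)); positivity
  have had : ∀ z : G, z ∈ Metric.closedBall 0 (a : ℝ) → adRep hι z ∈ Metric.ball 0 ρ := by
    intro z hz
    rw [mem_closedBall_zero_iff] at hz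
    rw [mem_ball_zero_iff]
    calc ‖adRep hι z‖ ≤ N * ‖z‖ := (adRep hι).le_opNorm z
      _ ≤ N * (ρ / (2 * (N + 1))) := by gcongr; exact hz
      _ < ρ := by
        rw [mul_div_assoc', div_lt_iff₀ (by positivity)]
        nlinarith [N.2, mul_nonneg hρ.le N.2]
  let δ : ℝ := min 1 (a / (K * M + 1))
  have hδ : 0 < δ := by positivity
  refine ⟨δ, hδ, fun t ht => ?_⟩
  obtain ⟨ζ, hζ, htζ⟩ : ∃ ζ : ℂ, ‖ζ‖ = 1 ∧ t = ‖t‖ • ζ := by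
    rcases eq_or_ne t 0 with rfl | h0
    · exact ⟨1, by simp, by simp⟩
    · refine ⟨t / ‖t‖, by simp [h0], ?_⟩
      rw [Complex.real_smul, mul_div_cancel₀]
      simpa using h0
  have hYM : ∀ s ∈ Set.Icc 0 δ, ‖leftLogDeriv hι l ζ s‖ ≤ M := fun s hs =>
    hM (ζ, s) ⟨by simpa using hζ, hs.1, hs.2.trans (min_le_left _ _)⟩
  let F : ℝ → G → G := fun s z => Ring.inverse (expMean (adRep hι z)) (leftLogDeriv hι l ζ s)
  have hYc : Continuous (leftLogDeriv hι l ζ) :=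
    (continuous_leftLogDeriv hι l).comp (Continuous.prodMk_right ζ)
  have hPL : IsPicardLindelof F (⟨0, le_rfl, hδ.le⟩ : Set.Icc 0 δ) 0 a 0 (K * M) (K * N * M) := by
    refine ⟨fun s hs => LipschitzOnWith.of_dist_le_mul fun z hz z' hz' => ?_,
      fun z _ => ?_, fun s hs z hz => ?_, ?_⟩
    · rw [dist_eq_norm, dist_eq_norm]
      have h1 := hK.dist_le_mul _ (had z hz) _ (had z' hz')
      rw [dist_eq_norm, dist_eq_norm, ← map_sub] at h1
      calc ‖F s z - F s z'‖ = ‖(Ring.inverse (expMean (adRep hι z)) -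
            Ring.inverse (expMean (adRep hι z'))) (leftLogDeriv hι l ζ s)‖ := rfl
        _ ≤ K * (N * ‖z - z'‖) * M := by
          refine (ContinuousLinearMap.le_opNorm _ _).trans ?_
          refine mul_le_mul (h1.trans ?_) (hYM s hs) (norm_nonneg _) (by positivity)
          gcongr
          exact (adRep hι).le_opNorm _
        _ = _ := by push_cast; ring
    · exact ((Ring.inverse (expMean (adRep hι z))).continuous.comp hYc).continuousOn
    · refine (ContinuousLinearMap.le_opNorm _ _).trans ?_
      push_cast
      exact mul_le_mul (hK' _ (had z hz)).2 (hYM s hs) (norm_nonneg _) K.2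
    · simp only [sub_zero, NNReal.coe_zero, sub_self, max_eq_left hδ.le, NNReal.coe_mul]
      calc (K * M : ℝ) * δ ≤ (K * M + 1) * (a / (K * M + 1)) := by
            gcongr
            · linarith
            · exact min_le_right _ _
        _ = a := by field_simp
  obtain ⟨α, hα0, hα⟩ := hPL.exists_hasDerivWithinAt_mem_closedBall
  have hmean : ∀ s ∈ Set.Icc 0 δ,
      expMean (adRep hι (α s)) (F s (α s)) = leftLogDeriv hι l ζ s := by
    intro s hs
    have h1 := Ring.mul_inverse_cancel _ (hK' _ (had _ (hα s hs).1)).1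
    exact congrArg (fun T : G →L[ℂ] G => T (leftLogDeriv hι l ζ s)) h1
  have hιd : ∀ s ∈ Set.Icc 0 δ,
      HasDerivWithinAt (fun s => ι (α s)) (ι (F s (α s))) (Set.Icc 0 δ) s := fun s hs =>
    (ι.toContinuousLinearMap.restrictScalars ℝ).hasFDerivAt.comp_hasDerivWithinAt s (hα s hs).2
  have hexp : ∀ s ∈ Set.Icc 0 δ, HasDerivWithinAt (fun s => exp (ι (α s)))
      (ι (leftLogDeriv hι l ζ s) * exp (ι (α s))) (Set.Icc 0 δ) s := by
    intro s hs
    refine (hasDerivWithinAt_exp_curve (hιd s hs)).congr_deriv ?_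
    rw [← map_expMean_adRep hι, hmean s hs]
  have hα0' : α 0 = 0 := hα0
  have huniq : Set.EqOn (fun s => exp (ι (α s)))
      (fun s : ℝ => prodExp (l.map fun x => s • ι (ζ • x))) (Set.Icc 0 δ) := by
    refine ODE_solution_unique_of_mem_Icc_right (K := M)
      (v := fun s u => ι (leftLogDeriv hι l ζ s) * u) (s := fun _ => Set.univ)
      (fun s hs => LipschitzOnWith.of_dist_le_mul fun u _ u' _ => ?_)
      (fun s hs => (hexp s hs).continuousWithinAt)
      (fun s hs => ?_) (fun _ _ => trivial)
      (fun s _ => (hasDerivAt_prodExp hι l ζ s).continuousAt.continuousWithinAt)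
      (fun s _ => (hasDerivAt_prodExp hι l ζ s).hasDerivWithinAt) (fun _ _ => trivial) ?_
    · rw [dist_eq_norm, dist_eq_norm, ← mul_sub]
      refine (norm_mul_le _ _).trans ?_
      gcongr
      rw [ι.norm_map]
      exact hYM s ⟨hs.1, hs.2.le⟩
    · exact (hexp s ⟨hs.1, hs.2.le⟩).mono_of_mem_nhdsWithin (Icc_mem_nhdsGE_of_mem hs)
    · simp [hα0', prodExp]
  have hsub : ∀ s ∈ Set.Icc 0 δ, ι (α s) - s • ι (ζ • l.sum) ∈ V := by
    intro s hs
    have h1 := V.sub_mem_of_hasDerivWithinAt hV (a := 0) (b := δ)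
      (f := fun s => ι (α s) - s • ι (ζ • l.sum))
      (f' := fun s => ι (F s (α s)) - (1 : ℝ) • ι (ζ • l.sum))
      (fun s hs => (hιd s hs).sub ((hasDerivAt_id s).smul_const _).hasDerivWithinAt)
      (fun s hs => ?_) s hs
    · simpa [hα0'] using h1
    · have h2 := expMean_adRep_sub_mem hι hV hιV (α s) (F s (α s))
      rw [hmean s hs] at h2
      have h3 := V.sub_mem (leftLogDeriv_sub_mem hι hV hιV l ζ hs.1) h2
      convert h3 using 1
      rw [one_smul]
      abel
  have htδ : ‖t‖ ∈ Set.Icc 0 δ := ⟨norm_nonneg _, ht⟩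
  refine ⟨α ‖t‖, ?_, ?_⟩
  · have h1 := huniq htδ
    simp only at h1
    rw [h1]
    congr 1
    refine List.map_congr_left fun x _ => ?_
    rw [map_smul, ← smul_assoc, ← htζ]
  · have h1 := hsub _ htδ
    rwa [map_smul, ← smul_assoc, ← htζ] at h1

end ProdExp

section

theorem exists_map_eq_exp_conj {A : Type*} [NormedRing A] [NormedAlgebra ℂ A] [CompleteSpace A]
    {G : Type*} [NormedAddCommGroup G] [NormedSpace ℂ G] [CompleteSpace G] {ι : G →ₗᵢ[ℂ] A}
    (hι : ∀ x y : G, ∃ z, ι z = ι x * ι y - ι y * ι x) (z h : G) :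
    ∃ g, ι g = exp (ι z) * ι h * exp (-(ι z)) :=
  ⟨_, by simpa using map_exp_adRep hι z h 1⟩

section SpectrumLimits

variable {A : Type*} [NormedRing A] [NormedAlgebra ℂ A] [CompleteSpace A]

theorem spectrum.mem_of_tendsto {a : ℕ → A} {b : A} {z : ℕ → ℂ} {w : ℂ}
    (ha : Tendsto a atTop (𝓝 b)) (hz : Tendsto z atTop (𝓝 w))
    (h : ∀ᶠ n in atTop, z n ∈ spectrum ℂ (a n)) : w ∈ spectrum ℂ b := by
  have hc : IsClosed {c : A | ¬ IsUnit c} := Units.isOpen.isClosed_compl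
  have h1 : Tendsto (fun n => algebraMap ℂ A (z n) - a n) atTop (𝓝 (algebraMap ℂ A w - b)) :=
    (((algebraMapCLM ℂ A).continuous.tendsto w).comp hz).sub ha
  exact hc.mem_of_tendsto h1 (h.mono fun n hn => hn)

omit [CompleteSpace A] in
theorem spectrum.smul_mem_of_mem_smul {a : A} {c z : ℂ} (hc : c ≠ 0)
    (hz : z ∈ spectrum ℂ (c • a)) : ∃ w ∈ spectrum ℂ a, z = c * w := by
  have h1 := spectrum.unit_smul_eq_smul a (Units.mk0 c hc)
  rw [Units.smul_mk0] at h1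
  rw [h1] at hz
  obtain ⟨w, hw, rfl⟩ := hz
  exact ⟨w, hw, rfl⟩

end SpectrumLimits

variable {X : Type*} [NormedAddCommGroup X] [NormedSpace ℂ X] [CompleteSpace X]

theorem norm_le_of_mem_spectrum_clm {T : X →L[ℂ] X} {z : ℂ} (hz : z ∈ spectrum ℂ T) :
    ‖z‖ ≤ ‖T‖ :=
  (spectrum.norm_le_norm_mul_of_mem hz).trans
    (mul_le_of_le_one_right (norm_nonneg _) ContinuousLinearMap.norm_id_le)

/-- A closed Lie algebra of compact operators whose nonzero spectrum is subadditive. -/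
structure IsSublinearLie (L : Submodule ℂ (X →L[ℂ] X)) : Prop where
  isClosed : IsClosed (L : Set (X →L[ℂ] X))
  lie : ∀ A ∈ L, ∀ B ∈ L, A * B - B * A ∈ L
  compact : ∀ A ∈ L, IsCompactOperator A
  subadd : ∀ A ∈ L, ∀ B ∈ L, ∀ μ ∈ spectrum ℂ (A + B), μ ≠ 0 →
    ∃ α ∈ spectrum ℂ A, ∃ β ∈ spectrum ℂ B, μ = α + β

theorem isSublinearLie_topologicalClosure {L : Submodule ℂ (X →L[ℂ] X)}
    (hLie : ∀ A ∈ L, ∀ B ∈ L, A * B - B * A ∈ L) (hcompact : ∀ A ∈ L, IsCompactOperator A)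
    (hsub : ∀ A ∈ L, ∀ B ∈ L, ∀ μ ∈ spectrum ℂ (A + B),
      ∃ α ∈ spectrum ℂ A, ∃ β ∈ spectrum ℂ B, μ = α + β) :
    IsSublinearLie L.topologicalClosure := by
  have hcomp : ∀ A ∈ L.topologicalClosure, IsCompactOperator A := fun A hA =>
    closure_minimal (fun A hA => hcompact A hA) isClosed_setOfPred_isCompactOperator hA
  refine ⟨L.isClosed_topologicalClosure, fun A hA B hB => ?_, hcomp, fun A hA B hB μ hμ hμ0 => ?_⟩
  · exact map_mem_closure₂ (f := fun A B : X →L[ℂ] X => A * B - B * A) (by fun_prop) hA hB hLie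
  · have hAB := hcomp _ (add_mem hA hB)
    obtain ⟨a, ha, haA⟩ := mem_closure_iff_seq_limit.mp hA
    obtain ⟨b, hb, hbB⟩ := mem_closure_iff_seq_limit.mp hB
    have hab := haA.add hbB
    have hpair : ∀ k : ℕ, ∀ᶠ n in atTop, ∃ p : ℂ × ℂ, p.1 ∈ spectrum ℂ (a n) ∧
        p.2 ∈ spectrum ℂ (b n) ∧ ‖p.1 + p.2 - μ‖ < 1 / ((k : ℝ) + 1) := by
      intro k
      filter_upwards [hAB.exists_mem_spectrum_near hμ0 hμ hab
        (Nat.one_div_pos_of_nat (n := k) (α := ℝ))] with n hn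
      obtain ⟨z, hz, hzμ⟩ := hn
      obtain ⟨α, hα, β, hβ, rfl⟩ := hsub _ (ha n) _ (hb n) z hz
      exact ⟨(α, β), hα, hβ, hzμ⟩
    choose N hN using fun k => eventually_atTop.mp (hpair k)
    choose p hp1 hp2 hpμ using fun k => hN k (max k (N k)) (le_max_right _ _)
    have hn : Tendsto (fun k => max k (N k)) atTop atTop :=
      tendsto_atTop_mono (fun k => le_max_left k (N k)) tendsto_id
    obtain ⟨RA, hRA⟩ := haA.norm.bddAbove_range
    obtain ⟨RB, hRB⟩ := hbB.norm.bddAbove_range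
    have hpmem : ∀ k, p k ∈ Metric.closedBall (0 : ℂ) RA ×ˢ Metric.closedBall (0 : ℂ) RB :=
      fun k => ⟨mem_closedBall_zero_iff.mpr ((norm_le_of_mem_spectrum_clm (hp1 k)).trans
          (hRA ⟨_, rfl⟩)),
        mem_closedBall_zero_iff.mpr ((norm_le_of_mem_spectrum_clm (hp2 k)).trans (hRB ⟨_, rfl⟩))⟩
    obtain ⟨q, -, φ, hφ, hq⟩ := ((isCompact_closedBall (0 : ℂ) RA).prod
      (isCompact_closedBall (0 : ℂ) RB)).tendsto_subseq hpmem
    have hnφ := hn.comp hφ.tendsto_atTop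
    refine ⟨q.1, spectrum.mem_of_tendsto (haA.comp hnφ) ((continuous_fst.tendsto q).comp hq)
      (Eventually.of_forall fun k => hp1 _), q.2, spectrum.mem_of_tendsto (hbB.comp hnφ)
      ((continuous_snd.tendsto q).comp hq) (Eventually.of_forall fun k => hp2 _), ?_⟩
    have h1 : Tendsto (fun k => (p (φ k)).1 + (p (φ k)).2 - μ) atTop (𝓝 (q.1 + q.2 - μ)) :=
      (((continuous_fst.add continuous_snd).tendsto q).comp hq).sub_const μ
    have h2 : Tendsto (fun k => (p (φ k)).1 + (p (φ k)).2 - μ) atTop (𝓝 0) :=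
      squeeze_zero_norm (fun k => (hpμ (φ k)).le)
        (tendsto_one_div_add_atTop_nhds_zero_nat.comp hφ.tendsto_atTop)
    exact (sub_eq_zero.mp (tendsto_nhds_unique h1 h2)).symm

namespace IsSublinearLie

variable {L : Submodule ℂ (X →L[ℂ] X)} (hL : IsSublinearLie L)

/-- The subspace of quasinilpotent elements. -/
def quasinilpotents : Submodule ℂ (X →L[ℂ] X) where
  carrier := {A | A ∈ L ∧ ∀ z ∈ spectrum ℂ A, z = 0}
  add_mem' := fun {A B} hA hB => ⟨L.add_mem hA.1 hB.1, fun z hz => by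
    by_contra h0
    obtain ⟨α, hα, β, hβ, rfl⟩ := hL.subadd A hA.1 B hB.1 z hz h0
    exact h0 (by rw [hA.2 α hα, hB.2 β hβ, add_zero])⟩
  zero_mem' := ⟨L.zero_mem, fun z hz => by
    have := norm_le_of_mem_spectrum_clm hz
    simpa using this⟩
  smul_mem' := fun c A hA => ⟨L.smul_mem c hA.1, fun z hz => by
    rcases eq_or_ne c 0 with rfl | hc
    · have := norm_le_of_mem_spectrum_clm hz
      simpa using this
    · obtain ⟨w, hw, rfl⟩ := spectrum.smul_mem_of_mem_smul hc hz
      rw [hA.2 w hw, mul_zero]⟩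

theorem isClosed_quasinilpotents : IsClosed (hL.quasinilpotents : Set (X →L[ℂ] X)) := by
  refine IsSeqClosed.isClosed fun a A ha haA => ?_
  have hA : A ∈ L := hL.isClosed.mem_of_tendsto haA (Eventually.of_forall fun n => (ha n).1)
  refine ⟨hA, fun μ hμ => ?_⟩
  by_contra h0
  obtain ⟨n, z, hz, hzμ⟩ := ((hL.compact A hA).exists_mem_spectrum_near h0 hμ haA
    (norm_pos_iff.mpr h0)).exists
  rw [(ha n).2 z hz, zero_sub, norm_neg] at hzμ
  exact lt_irrefl _ hzμ

theorem mem_spectrum_of_add_quasinilpotent {A B : X →L[ℂ] X} (hA : A ∈ L)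
    (hB : B ∈ hL.quasinilpotents) {z : ℂ} (hz : z ∈ spectrum ℂ (A + B)) (h0 : z ≠ 0) :
    z ∈ spectrum ℂ A := by
  obtain ⟨α, hα, β, hβ, rfl⟩ := hL.subadd A hA B hB.1 z hz h0
  rwa [hB.2 β hβ, add_zero]

include hL in
theorem exp_conj_mem {A B : X →L[ℂ] X} (hA : A ∈ L) (hB : B ∈ L) : exp A * B * exp (-A) ∈ L := by
  have : CompleteSpace L := hL.isClosed.completeSpace_coe
  obtain ⟨g, hg⟩ := exists_map_eq_exp_conj (G := L) (ι := L.subtypeₗᵢ)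
    (fun x y : L => ⟨⟨_, hL.lie x x.2 y y.2⟩, rfl⟩) (⟨A, hA⟩ : L) (⟨B, hB⟩ : L)
  exact hg ▸ g.2

theorem commutator_mem_quasinilpotents {A B : X →L[ℂ] X} (hA : A ∈ L) (hB : B ∈ L) :
    A * B - B * A ∈ hL.quasinilpotents := by
  refine ⟨hL.lie A hA B hB, fun z hz => ?_⟩
  let f : ℂ → X →L[ℂ] X := fun t => exp (t • A) * B * exp (-(t • A))
  have hexp : ∀ t : ℂ, HasDerivAt (fun t : ℂ => exp (t • A)) (exp (t • A) * A) t := fun t =>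
    hasDerivAt_exp_smul_const (𝕂 := ℂ) A t
  have hexp' : ∀ t : ℂ, HasDerivAt (fun t : ℂ => exp (-(t • A))) (-(exp (-(t • A)) * A)) t := by
    intro t
    have := hasDerivAt_exp_smul_const (𝕂 := ℂ) (-A) t
    simpa only [smul_neg, mul_neg] using this
  have hf : ∀ t, HasDerivAt f (exp (t • A) * A * B * exp (-(t • A)) +
      exp (t • A) * B * -(exp (-(t • A)) * A)) t := fun t =>
    ((hexp t).mul_const B).fun_mul (hexp' t)
  have hF : Differentiable ℂ (dslope f 0) := by
    rw [← differentiableOn_univ, Complex.differentiableOn_dslope univ_mem]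
    exact fun t _ => (hf t).differentiableAt.differentiableWithinAt
  have hF0 : dslope f 0 0 = A * B - B * A := by
    rw [dslope_same, (hf 0).deriv]
    simp [sub_eq_add_neg]
  have hbound : ∀ R : ℝ, 0 < R → ‖z‖ ≤ (2 * ‖B‖ + 1) / R := by
    intro R hR
    refine norm_le_of_mem_spectrum_of_sphere ContinuousLinearMap.norm_id_le hF hR (by positivity)
      (fun t ht w hw => ?_) (hF0 ▸ hz)
    have ht0 : t ≠ 0 := norm_pos_iff.mp (ht ▸ hR)
    rcases eq_or_ne w 0 with rfl | hw0
    · rw [norm_zero]; positivity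
    rw [dslope_of_ne _ ht0, slope_def_module, sub_zero, smul_sub, sub_eq_add_neg] at hw
    have hft : f t ∈ L := hL.exp_conj_mem (L.smul_mem t hA) hB
    have hf0 : f 0 = B := by simp [f]
    rw [hf0] at hw
    obtain ⟨α, hα, β, hβ, rfl⟩ := hL.subadd _ (L.smul_mem _ hft) _
      (L.neg_mem (L.smul_mem _ hB)) w hw hw0
    let u : (X →L[ℂ] X)ˣ := ⟨exp (t • A), exp (-(t • A)), exp_mul_exp_neg_of_complex _,
      exp_neg_mul_exp_of_complex _⟩
    have hconj : t⁻¹ • f t = u * (t⁻¹ • B) * (u⁻¹ : (X →L[ℂ] X)ˣ) := by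
      rw [mul_smul_comm, smul_mul_assoc]; rfl
    rw [hconj, spectrum.units_conjugate] at hα
    have h1 := norm_le_of_mem_spectrum_clm hα
    have h2 := norm_le_of_mem_spectrum_clm hβ
    rw [norm_neg] at h2
    rw [norm_smul, norm_inv, ht] at h1 h2
    calc ‖α + β‖ ≤ R⁻¹ * ‖B‖ + R⁻¹ * ‖B‖ := (norm_add_le _ _).trans (add_le_add h1 h2)
      _ = 2 * ‖B‖ / R := by ring
      _ < (2 * ‖B‖ + 1) / R := by gcongr; linarith
  have hlim : Tendsto (fun R : ℝ => (2 * ‖B‖ + 1) / R) atTop (𝓝 0) :=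
    tendsto_const_nhds.div_atTop tendsto_id
  have := ge_of_tendsto hlim ((eventually_gt_atTop 0).mono hbound)
  exact norm_le_zero_iff.mp this

end IsSublinearLie

end

section

section ShiftProd

/-- The product `∏ (w - c)` over a list of scalars `c`. -/
def shiftProd {A : Type*} [Ring A] [Algebra ℂ A] (cs : List ℂ) (w : A) : A :=
  (cs.map fun c => w - algebraMap ℂ A c).prod

theorem shiftProd_cons {A : Type*} [Ring A] [Algebra ℂ A] (c : ℂ) (cs : List ℂ) (w : A) :
    shiftProd (c :: cs) w = (w - algebraMap ℂ A c) * shiftProd cs w := by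
  simp [shiftProd]

theorem shiftProd_append {A : Type*} [Ring A] [Algebra ℂ A] (cs cs' : List ℂ) (w : A) :
    shiftProd (cs ++ cs') w = shiftProd cs w * shiftProd cs' w := by
  simp [shiftProd]

theorem shiftProd_eq_aeval {A : Type*} [Ring A] [Algebra ℂ A] (cs : List ℂ) (w : A) :
    shiftProd cs w = Polynomial.aeval w (cs.map fun c => Polynomial.X - Polynomial.C c).prod := by
  induction cs with
  | nil => simp [shiftProd]
  | cons c cs ih => simp [shiftProd_cons, ih]

theorem spectrum_shiftProd {A : Type*} [Ring A] [Algebra ℂ A] (cs : List ℂ) (w : A)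
    (hw : (spectrum ℂ w).Nonempty) :
    spectrum ℂ (shiftProd cs w) = shiftProd cs '' spectrum ℂ w := by
  rw [shiftProd_eq_aeval, spectrum.map_polynomial_aeval_of_nonempty _ _ hw]
  refine Set.image_congr fun y _ => ?_
  rw [shiftProd_eq_aeval, Polynomial.coe_aeval_eq_eval]

theorem shiftProd_eq_zero {cs : List ℂ} {y : ℂ} (h : y ∈ cs) : shiftProd cs y = 0 := by
  rw [shiftProd, List.prod_eq_zero_iff]
  exact List.mem_map.mpr ⟨y, h, by simp⟩

theorem pow_le_norm_shiftProd {cs : List ℂ} {y : ℂ} {r : ℝ} (hr : 0 ≤ r)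
    (h : ∀ c ∈ cs, r ≤ ‖y - c‖) : r ^ cs.length ≤ ‖shiftProd cs y‖ := by
  induction cs with
  | nil => simp [shiftProd]
  | cons c cs ih =>
    rw [shiftProd_cons, norm_mul, List.length_cons, pow_succ']
    exact mul_le_mul (h c (by simp)) (ih fun c hc => h c (by simp [hc])) (by positivity)
      (norm_nonneg _)

variable {A : Type*} [NormedRing A] [NormedAlgebra ℂ A]

theorem norm_shiftProd_le (h1 : ‖(1 : A)‖ ≤ 1) {cs : List ℂ} {w : A} {K : ℝ} (hK : 0 ≤ K)
    (h : ∀ c ∈ cs, ‖w - algebraMap ℂ A c‖ ≤ K) : ‖shiftProd cs w‖ ≤ K ^ cs.length := by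
  induction cs with
  | nil => simpa [shiftProd] using h1
  | cons c cs ih =>
    rw [shiftProd_cons, List.length_cons, pow_succ']
    refine (norm_mul_le _ _).trans ?_
    exact mul_le_mul (h c (by simp)) (ih fun c hc => h c (by simp [hc])) (norm_nonneg _) hK

theorem differentiable_shiftProd {w : ℂ → A} (hw : Differentiable ℂ w) (F : List ℂ) :
    Differentiable ℂ fun t => shiftProd (F.map fun α => Complex.exp (t * α)) (w t) := by
  induction F with
  | nil => exact differentiable_const _
  | cons α F ih =>
    simp only [List.map_cons, shiftProd_cons]
    refine Differentiable.fun_mul (hw.sub ?_) ih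
    have h1 : Differentiable ℂ fun t : ℂ => Complex.exp (t * α) := by fun_prop
    exact (algebraMapCLM ℂ A).differentiable.comp h1

end ShiftProd

theorem differentiable_prodExp_smul {A : Type*} [NormedRing A] [NormedAlgebra ℂ A]
    [CompleteSpace A] (l : List A) :
    Differentiable ℂ fun t : ℂ => prodExp (l.map fun x => t • x) := by
  induction l with
  | nil => exact differentiable_const _
  | cons x l ih =>
    simp only [List.map_cons, prodExp_cons]
    exact Differentiable.fun_mul
      (fun t => (hasDerivAt_exp_smul_const (𝕂 := ℂ) x t).differentiableAt) ih

variable {X : Type*} [NormedAddCommGroup X] [NormedSpace ℂ X] [CompleteSpace X]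

namespace IsSublinearLie

variable {L : Submodule ℂ (X →L[ℂ] X)} (hL : IsSublinearLie L)

include hL in
theorem exists_mem_spectrum_prodExp_smul {l : List (X →L[ℂ] X)} (hl : ∀ x ∈ l, x ∈ L) :
    ∃ δ : ℝ, 0 < δ ∧ ∀ t : ℂ, ‖t‖ ≤ δ → t ≠ 0 →
      ∀ y ∈ spectrum ℂ (prodExp (l.map fun x => t • x)),
        ∃ α, (α = 0 ∨ α ∈ spectrum ℂ l.sum) ∧ y = Complex.exp (t * α) := by
  have : CompleteSpace L := hL.isClosed.completeSpace_coe
  lift l to List L using hl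
  obtain ⟨δ, hδ, h⟩ := exists_prodExp_eq_exp (G := L) (ι := L.subtypeₗᵢ)
    (fun x y : L => ⟨⟨_, hL.lie x x.2 y y.2⟩, rfl⟩) hL.isClosed_quasinilpotents
    (fun x y => hL.commutator_mem_quasinilpotents x.2 y.2) l
  refine ⟨δ, hδ, fun t ht ht0 y hy => ?_⟩
  obtain ⟨z, hz, hzV⟩ := h t ht
  have hlist : (l.map (fun x : L => (x : X →L[ℂ] X))).map (fun x => t • x) =
      l.map fun x => t • L.subtypeₗᵢ x := by
    simp
  have hsum : (l.map (fun x : L => (x : X →L[ℂ] X))).sum = L.subtypeₗᵢ l.sum :=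
    (map_list_sum L.subtype l).symm
  rw [hlist, hz] at hy
  rw [hsum]
  obtain ⟨β, hβ, rfl⟩ := exists_mem_spectrum_of_mem_spectrum_exp hy
  rcases eq_or_ne β 0 with rfl | h0
  · exact ⟨0, Or.inl rfl, by simp⟩
  · have hβ' := hL.mem_spectrum_of_add_quasinilpotent (L.smul_mem t l.sum.2) hzV
      (z := β) (by rwa [show t • (l.sum : X →L[ℂ] X) + (L.subtypeₗᵢ z - t • L.subtypeₗᵢ l.sum) =
        L.subtypeₗᵢ z from add_sub_cancel _ _]) h0
    obtain ⟨α, hα, rfl⟩ := spectrum.smul_mem_of_mem_smul ht0 hβ'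
    exact ⟨α, Or.inr hα, rfl⟩

include hL in
theorem norm_le_of_mem_spectrum_prodExp {l : List (X →L[ℂ] X)} (hl : ∀ x ∈ l, x ∈ L) {s : ℝ}
    (hs : 0 ≤ s) (hls : ∀ α ∈ spectrum ℂ l.sum, ‖α‖ ≤ s) {y : ℂ}
    (hy : y ∈ spectrum ℂ (prodExp l)) : ‖y‖ ≤ Real.exp s := by
  rcases subsingleton_or_nontrivial X with hX | hX
  · rw [spectrum.of_subsingleton] at hy
    exact absurd hy (Set.notMem_empty _)
  by_contra! hlt
  set a := l.sum with ha_def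
  have haL : a ∈ L := L.list_sum_mem hl
  let w : ℂ → X →L[ℂ] X := fun t => prodExp (l.map fun x => t • x)
  have hw : Differentiable ℂ w := differentiable_prodExp_smul l
  have hw1 : w 1 = prodExp l := by simp [w]
  obtain ⟨δ₀, hδ₀, hloc⟩ := hL.exists_mem_spectrum_prodExp_smul hl
  let δ := min δ₀ (1 / 2)
  have hδ : 0 < δ := lt_min hδ₀ (by norm_num)
  have hδ1 : δ < 1 := (min_le_right _ _).trans_lt (by norm_num)
  obtain ⟨D₁, hD₁⟩ := (isCompact_closedBall (0 : ℂ) 2).exists_bound_of_continuousOn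
    hw.continuous.continuousOn
  let D := max D₁ (Real.exp (2 * ‖a‖))
  have hD1 : 1 ≤ D := le_max_of_le_right (Real.one_le_exp (by positivity))
  have hwD : ∀ t : ℂ, ‖t‖ ≤ 2 → ‖w t‖ ≤ D := fun t ht =>
    (hD₁ t (mem_closedBall_zero_iff.mpr ht)).trans (le_max_left _ _)
  have hcD : ∀ t : ℂ, ‖t‖ ≤ 2 → ∀ α : ℂ, (α = 0 ∨ α ∈ spectrum ℂ a) →
      ‖Complex.exp (t * α)‖ ≤ D := by
    intro t ht α hα
    have h1 : ‖α‖ ≤ ‖a‖ := by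
      rcases hα with rfl | hα
      · simp
      · exact norm_le_of_mem_spectrum_clm hα
    refine (Complex.norm_exp_le_exp_norm _).trans (le_max_of_le_right (Real.exp_le_exp.mpr ?_))
    rw [norm_mul]
    gcongr
  let θ := Real.log δ⁻¹ / Real.log (2 / δ)
  have hlog1 : 0 < Real.log δ⁻¹ := Real.log_pos (one_lt_inv₀ hδ |>.mpr hδ1)
  have hlog2 : Real.log δ⁻¹ < Real.log (2 / δ) :=
    Real.log_lt_log (by positivity) (by rw [div_eq_mul_inv]; linarith [inv_pos.mpr hδ])
  have hθ0 : 0 ≤ θ := div_nonneg hlog1.le (hlog1.trans hlog2).le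
  have hθ1 : θ < 1 := (div_lt_one (hlog1.trans hlog2)).mpr hlog2
  let h := min 1 (‖y‖ - Real.exp s)
  have hh : 0 < h := lt_min one_pos (sub_pos.mpr hlt)
  have hh1 : h ≤ 1 := min_le_left _ _
  obtain ⟨ε, hε, hε1, hεh⟩ : ∃ ε : ℝ, 0 < ε ∧ ε ≤ 1 / 2 ∧
      (8 * D * ε) ^ (1 - θ) * (2 * D) ^ 2 < h ^ 2 := by
    have hc : ContinuousAt (fun ε : ℝ => (8 * D * ε) ^ (1 - θ) * (2 * D) ^ 2) 0 :=
      ((Real.continuousAt_rpow_const _ _ (Or.inr (sub_pos.mpr hθ1).le)).comp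
        (f := fun ε : ℝ => 8 * D * ε) (by fun_prop)).mul continuousAt_const
    have h0 : (8 * D * 0) ^ (1 - θ) * (2 * D) ^ 2 < h ^ 2 := by
      rw [mul_zero, Real.zero_rpow (sub_pos.mpr hθ1).ne', zero_mul]
      positivity
    have h1 := (hc.eventually_lt continuousAt_const h0).filter_mono
      (nhdsWithin_le_nhds (s := Set.Ioi 0))
    obtain ⟨ε, h2, h3⟩ := (h1.and (Ioc_mem_nhdsGT (show (0 : ℝ) < 1 / 2 by norm_num))).exists
    exact ⟨ε, h3.1, h3.2, h2⟩
  have hfin := (hL.compact a haL).finite_spectrum hε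
  let F₀ := hfin.toFinset.toList
  let m := F₀.length
  let F := List.replicate (m + 1) (0 : ℂ) ++ F₀
  have hF₀ : ∀ α, α ∈ F₀ ↔ α ∈ spectrum ℂ a ∧ ε ≤ ‖α‖ := by
    intro α
    simp [F₀]
  have hFmem : ∀ α ∈ F, α = 0 ∨ α ∈ spectrum ℂ a := by
    intro α hα
    rcases List.mem_append.mp hα with h | h
    · exact Or.inl (List.eq_of_mem_replicate h)
    · exact Or.inr ((hF₀ α).mp h).1
  have hFlen : F.length = 2 * m + 1 := by
    simp only [F, List.length_append, List.length_replicate, m]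
    ring
  let Q : ℂ → X →L[ℂ] X := fun t => shiftProd (F.map fun α => Complex.exp (t * α)) (w t)
  have hQ : Differentiable ℂ Q := differentiable_shiftProd hw F
  have h8 : 0 < 8 * D * ε := by positivity
  have hQδ : ∀ t : ℂ, ‖t‖ = δ → ∀ z ∈ spectrum ℂ (Q t), ‖z‖ < (8 * D * ε) ^ (m + 1) := by
    intro t ht z hz
    have ht0 : t ≠ 0 := norm_pos_iff.mp (ht ▸ hδ)
    have ht2 : ‖t‖ ≤ 2 := by rw [ht]; linarith
    rw [spectrum_shiftProd _ _ (spectrum.nonempty _)] at hz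
    obtain ⟨x, hx, rfl⟩ := hz
    obtain ⟨α, hα, rfl⟩ := hloc t (ht.le.trans (min_le_left _ _)) ht0 x hx
    by_cases hαF : α ∈ F
    · rw [shiftProd_eq_zero (List.mem_map.mpr ⟨α, hαF, rfl⟩), norm_zero]
      positivity
    have hα0 : α ≠ 0 := fun h => hαF (List.mem_append_left _ (by simp [h]))
    have hαε : ‖α‖ < ε := by
      by_contra! hle
      exact hαF (List.mem_append_right _ ((hF₀ α).mpr ⟨hα.resolve_left hα0, hle⟩))
    have htα : ‖t * α‖ ≤ ε := by
      rw [norm_mul, ht]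
      nlinarith [norm_nonneg α]
    have h1 : ‖Complex.exp (t * α) - 1‖ ≤ 2 * ε :=
      (Complex.norm_exp_sub_one_le (htα.trans (by linarith))).trans (by linarith)
    have h2 := norm_shiftProd_le (A := ℂ) (cs := (List.replicate (m + 1) (0 : ℂ)).map
      fun α => Complex.exp (t * α)) (w := Complex.exp (t * α)) norm_one.le (K := 2 * ε)
      (by positivity) (by simpa using h1)
    have h3 := norm_shiftProd_le (A := ℂ) (cs := F₀.map fun α => Complex.exp (t * α))
      (w := Complex.exp (t * α)) norm_one.le (K := 2 * D) (by positivity) (by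
        intro c hc
        obtain ⟨β, hβ, rfl⟩ := List.mem_map.mp hc
        refine (norm_sub_le _ _).trans ?_
        have h4 := hcD t ht2 α hα
        have h5 := hcD t ht2 β (Or.inr ((hF₀ β).mp hβ).1)
        simp only [Algebra.algebraMap_self, RingHom.id_apply]
        linarith)
    rw [List.map_append, shiftProd_append, norm_mul]
    simp only [List.length_map, List.length_replicate] at h2 h3
    calc _ ≤ (2 * ε) ^ (m + 1) * (2 * D) ^ m := by gcongr
      _ ≤ (2 * ε) ^ (m + 1) * (2 * D) ^ (m + 1) := by
        gcongr
        · linarith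
        · omega
      _ = (2 * ε * (2 * D)) ^ (m + 1) := (mul_pow _ _ _).symm
      _ < (8 * D * ε) ^ (m + 1) := by
        gcongr ?_ ^ (m + 1)
        nlinarith
  have hQ2 : ∀ t : ℂ, ‖t‖ = 2 → ‖Q t‖ ≤ (2 * D) ^ (2 * m + 1) := by
    intro t ht
    rw [← hFlen, ← List.length_map (as := F) (fun α => Complex.exp (t * α))]
    refine norm_shiftProd_le ContinuousLinearMap.norm_id_le (by positivity) fun c hc => ?_
    obtain ⟨α, hα, rfl⟩ := List.mem_map.mp hc
    refine (norm_sub_le _ _).trans ?_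
    have h4 := hwD t ht.le
    have h5 := hcD t ht.le α (hFmem α hα)
    rw [norm_algebraMap']
    linarith
  have hz : shiftProd (F.map fun α => Complex.exp (1 * α)) y ∈ spectrum ℂ (Q 1) := by
    rw [spectrum_shiftProd _ _ (spectrum.nonempty _)]
    exact ⟨y, hw1 ▸ hy, rfl⟩
  have hupper := norm_le_of_mem_spectrum_of_circles ContinuousLinearMap.norm_id_le hQ hδ hδ1
    (by norm_num : (1 : ℝ) < 2) (by positivity) (by positivity) hQδ hQ2 hz
  have hlower := pow_le_norm_shiftProd (cs := F.map fun α => Complex.exp (1 * α)) (y := y) hh.le (by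
    intro c hc
    obtain ⟨α, hα, rfl⟩ := List.mem_map.mp hc
    have h1 : ‖Complex.exp (1 * α)‖ ≤ Real.exp s := by
      refine (Complex.norm_exp_le_exp_norm _).trans (Real.exp_le_exp.mpr ?_)
      rw [one_mul]
      rcases hFmem α hα with rfl | h
      · simpa using hs
      · exact hls α h
    have h2 := norm_sub_norm_le y (Complex.exp (1 * α))
    have h3 : h ≤ ‖y‖ - Real.exp s := min_le_right _ _
    linarith)
  rw [List.length_map, hFlen] at hlower
  have hfinal : (h ^ 2) ^ (m + 1) ≤ ((8 * D * ε) ^ (1 - θ) * (2 * D) ^ 2) ^ (m + 1) := by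
    calc (h ^ 2) ^ (m + 1) = h ^ (2 * m + 2) := by rw [← pow_mul]; ring_nf
      _ ≤ h ^ (2 * m + 1) := pow_le_pow_of_le_one hh.le hh1 (by omega)
      _ ≤ _ := hlower.trans hupper
      _ ≤ ((8 * D * ε) ^ (1 - θ)) ^ (m + 1) * ((2 * D) ^ (2 * m + 1)) := by
        rw [Real.rpow_pow_comm h8.le]
        gcongr
        refine (Real.rpow_le_rpow_of_exponent_le (one_le_pow₀ (by linarith)) hθ1.le).trans ?_
        rw [Real.rpow_one]
      _ ≤ ((8 * D * ε) ^ (1 - θ)) ^ (m + 1) * ((2 * D) ^ (2 * m + 2)) := by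
        gcongr
        · linarith
        · omega
      _ = _ := by
        rw [mul_pow ((8 * D * ε) ^ (1 - θ)), ← pow_mul (2 * D), mul_add, mul_one]
  have := (pow_le_pow_iff_left₀ (by positivity) (by positivity) (Nat.succ_ne_zero m)).mp hfinal
  linarith

end IsSublinearLie

end

theorem totallyBounded_of_forall_exists_near {E : Type*} [PseudoMetricSpace E] {s : Set E}
    (h : ∀ ε > 0, ∃ t : Set E, TotallyBounded t ∧ ∀ x ∈ s, ∃ y ∈ t, dist x y < ε) :
    TotallyBounded s := by
  refine Metric.totallyBounded_iff.mpr fun ε hε => ?_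
  obtain ⟨t, ht, hst⟩ := h (ε / 2) (half_pos hε)
  obtain ⟨u, hu, htu⟩ := Metric.totallyBounded_iff.mp ht (ε / 2) (half_pos hε)
  refine ⟨u, hu, fun x hx => ?_⟩
  obtain ⟨y, hy, hxy⟩ := hst x hx
  obtain ⟨z, hz, hyz⟩ := Set.mem_iUnion₂.mp (htu hy)
  exact Set.mem_iUnion₂.mpr ⟨z, hz, Metric.mem_ball.mpr (by
    linarith [dist_triangle x y z, Metric.mem_ball.mp hyz])⟩

theorem isCompact_closure_of_totallyBounded {E : Type*} [PseudoMetricSpace E] [CompleteSpace E]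
    {s : Set E} (h : TotallyBounded s) : IsCompact (closure s) :=
  h.closure.isCompact_of_isClosed _root_.isClosed_closure

/-- A compact set of compact operators is collectively compact. -/
theorem exists_isCompact_forall_apply_mem {E F : Type*} [NormedAddCommGroup E] [NormedSpace ℂ E]
    [NormedAddCommGroup F] [NormedSpace ℂ F] [CompleteSpace F] {S : Set (E →L[ℂ] F)}
    (hS : IsCompact S) (hcomp : ∀ T ∈ S, IsCompactOperator T) (R : ℝ) :
    ∃ K : Set F, IsCompact K ∧ ∀ T ∈ S, ∀ x, ‖x‖ ≤ R → T x ∈ K := by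
  have : TotallyBounded {y | ∃ T ∈ S, ∃ x : E, ‖x‖ ≤ R ∧ T x = y} := by
    refine totallyBounded_of_forall_exists_near fun ε hε => ?_
    obtain ⟨t, htS, ht, hcov⟩ := hS.finite_cover_balls (e := ε / (|R| + 1)) (by positivity)
    refine ⟨⋃ T ∈ t, closure (T '' Metric.closedBall 0 R),
      (_root_.totallyBounded_biUnion ht).mpr fun T hT =>
        ((hcomp T (htS hT)).isCompact_closure_image_closedBall R).totallyBounded, ?_⟩
    rintro _ ⟨T, hT, x, hx, rfl⟩
    obtain ⟨T', hT', hTT'⟩ := Set.mem_iUnion₂.mp (hcov hT)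
    refine ⟨T' x, Set.mem_iUnion₂.mpr ⟨T', hT', subset_closure ⟨x, by simpa using hx, rfl⟩⟩, ?_⟩
    rw [Metric.mem_ball, dist_eq_norm, lt_div_iff₀ (by positivity)] at hTT'
    rw [dist_eq_norm, ← sub_apply]
    calc ‖(T - T') x‖ ≤ ‖T - T'‖ * ‖x‖ := (T - T').le_opNorm x
      _ ≤ ‖T - T'‖ * (|R| + 1) := by gcongr; linarith [le_abs_self R]
      _ < ε := hTT'
  exact ⟨_, isCompact_closure_of_totallyBounded this, fun T hT x hx =>
    subset_closure ⟨T, hT, x, hx, rfl⟩⟩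

section

variable {X : Type*} [NormedAddCommGroup X] [NormedSpace ℂ X] [CompleteSpace X]

/-- Two-sided multiplication by compact operators is a compact operator. -/
theorem IsCompactOperator.mulLeftRight {A B : X →L[ℂ] X} (hA : IsCompactOperator A)
    (hB : IsCompactOperator B) :
    IsCompactOperator (ContinuousLinearMap.mulLeftRight ℂ (X →L[ℂ] X) A B) := by
  rw [← ContinuousLinearMap.coe_coe]
  refine (isCompactOperator_iff_isCompact_closure_image_closedBall _ one_pos).mpr
    (isCompact_closure_of_totallyBounded (Metric.totallyBounded_of_finite_discretization
      fun ε hε => ?_))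
  have hKB := hB.isCompact_closure_image_closedBall 1
  obtain ⟨R, hR⟩ := hKB.isBounded.exists_norm_le
  have hKA := hA.isCompact_closure_image_closedBall R
  let δ := ε / (4 * (‖A‖ + 1))
  have hδ : 0 < δ := by positivity
  have hAδ : ‖A‖ * δ ≤ ε / 4 := by
    have : δ * (4 * (‖A‖ + 1)) = ε := div_mul_cancel₀ _ (by positivity)
    nlinarith
  obtain ⟨t, htK, ht, htcov⟩ := hKB.finite_cover_balls hδ
  obtain ⟨u, -, hu, hucov⟩ := hKA.finite_cover_balls (e := ε / 8) (by positivity)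
  have := ht.fintype
  have := hu.fintype
  choose f hf using fun S : ((ContinuousLinearMap.mulLeftRight ℂ (X →L[ℂ] X) A B).toLinearMap ''
    Metric.closedBall 0 1) => S.2
  have hball : ∀ S, ∀ y ∈ t, ∃ z : u, dist (A (f S y)) z < ε / 8 := by
    intro S y hy
    have h1 : ‖f S y‖ ≤ R := by
      refine ((f S).le_of_opNorm_le (by simpa using (hf S).1) y).trans ?_
      rw [one_mul]
      exact hR y (htK hy)
    have h2 : A (f S y) ∈ closure (A '' Metric.closedBall 0 R) :=
      subset_closure ⟨f S y, by simpa using h1, rfl⟩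
    obtain ⟨z, hz, hz'⟩ := Set.mem_iUnion₂.mp (hucov h2)
    exact ⟨⟨z, hz⟩, hz'⟩
  choose g hg using hball
  refine ⟨(t → u), Fintype.ofFinite _, fun S y => g S y y.2, fun S S' hSS' => ?_⟩
  have hval : ∀ S, Subtype.val S = A * f S * B := fun S => (hf S).2.symm
  rw [dist_eq_norm, hval, hval]
  refine lt_of_le_of_lt (ContinuousLinearMap.opNorm_le_of_unit_norm (C := 3 * ε / 4)
    (by positivity) fun x hx => ?_) (by linarith)
  have hBx : B x ∈ closure (B '' Metric.closedBall 0 1) :=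
    subset_closure ⟨x, by simp [hx], rfl⟩
  obtain ⟨y, hy, hxy⟩ := Set.mem_iUnion₂.mp (htcov hBx)
  rw [Metric.mem_ball, dist_eq_norm] at hxy
  have h1 : ∀ S, ‖A (f S (B x - y))‖ ≤ ε / 4 := fun S => by
    calc ‖A (f S (B x - y))‖ ≤ ‖A‖ * (1 * ‖B x - y‖) :=
          A.le_opNorm_of_le ((f S).le_of_opNorm_le (by simpa using (hf S).1) _)
      _ ≤ ‖A‖ * δ := by rw [one_mul]; gcongr
      _ ≤ ε / 4 := hAδ
  have h2 := hg S y hy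
  have h3 := hg S' y hy
  have h4 : (g S y hy : X) = g S' y hy := congrArg Subtype.val (congrFun hSS' ⟨y, hy⟩)
  rw [dist_eq_norm] at h2 h3
  have h5 : (A * f S * B - A * f S' * B) x = A (f S (B x - y)) - A (f S' (B x - y)) +
      ((A (f S y) - g S y hy) - (A (f S' y) - g S' y hy)) := by
    simp only [sub_apply, mul_apply_eq_comp, map_sub, h4]
    abel
  rw [h5]
  refine (norm_add_le _ _).trans ?_
  linarith [norm_sub_le (A (f S (B x - y))) (A (f S' (B x - y))), h1 S, h1 S',
    norm_sub_le (A (f S y) - g S y hy) (A (f S' y) - g S' y hy)]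

theorem exists_isCompact_forall_mul_mul_mem {S : Set (X →L[ℂ] X)} (hS : IsCompact S)
    (hcomp : ∀ T ∈ S, IsCompactOperator T) :
    ∃ K : Set (X →L[ℂ] X), IsCompact K ∧
      ∀ A ∈ S, ∀ B ∈ S, ∀ T : X →L[ℂ] X, ‖T‖ ≤ 1 → A * T * B ∈ K := by
  obtain ⟨K, hK, h⟩ := exists_isCompact_forall_apply_mem
    (S := (fun p : (X →L[ℂ] X) × (X →L[ℂ] X) =>
      ContinuousLinearMap.mulLeftRight ℂ (X →L[ℂ] X) p.1 p.2) '' S ×ˢ S)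
    ((hS.prod hS).image (by fun_prop)) (by
      rintro _ ⟨p, hp, rfl⟩
      exact (hcomp _ hp.1).mulLeftRight (hcomp _ hp.2)) 1
  exact ⟨K, hK, fun A hA B hB T hT => h _ ⟨(A, B), ⟨hA, hB⟩, rfl⟩ T hT⟩

/-- The operators leaving two given subspaces invariant. -/
def stabilizerSubalgebra (M N : Submodule ℂ X) : Subalgebra ℂ (X →L[ℂ] X) where
  carrier := {T | (∀ x ∈ M, T x ∈ M) ∧ ∀ x ∈ N, T x ∈ N}
  mul_mem' hS hT := ⟨fun x hx => hS.1 _ (hT.1 x hx), fun x hx => hS.2 _ (hT.2 x hx)⟩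
  add_mem' hS hT := ⟨fun x hx => M.add_mem (hS.1 x hx) (hT.1 x hx),
    fun x hx => N.add_mem (hS.2 x hx) (hT.2 x hx)⟩
  algebraMap_mem' c := ⟨fun x hx => by simpa [Algebra.algebraMap_eq_smul_one] using M.smul_mem c hx,
    fun x hx => by simpa [Algebra.algebraMap_eq_smul_one] using N.smul_mem c hx⟩

omit [CompleteSpace X] in
theorem isClosed_stabilizerSubalgebra {M N : Submodule ℂ X} (hM : IsClosed (M : Set X))
    (hN : IsClosed (N : Set X)) :
    IsClosed (stabilizerSubalgebra M N : Set (X →L[ℂ] X)) := by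
  have : (stabilizerSubalgebra M N : Set (X →L[ℂ] X)) =
      (⋂ x ∈ M, (fun T : X →L[ℂ] X => T x) ⁻¹' M) ∩ ⋂ x ∈ N, (fun T : X →L[ℂ] X => T x) ⁻¹' N := by
    ext T
    simp [stabilizerSubalgebra]
  rw [this]
  exact (isClosed_biInter fun x _ => hM.preimage (by fun_prop)).inter
    (isClosed_biInter fun x _ => hN.preimage (by fun_prop))

/-- The compression of operators to the quotient of two invariant subspaces. -/
theorem exists_compression {X : Type u} [NormedAddCommGroup X] [NormedSpace ℂ X] [CompleteSpace X]
    {M N : Submodule ℂ X} (hM : IsClosed (M : Set X))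
    (hN : IsClosed (N : Set X)) (hNM : N ≤ M) :
    ∃ (Z : Type u) (_ : NormedAddCommGroup Z) (_ : NormedSpace ℂ Z) (_ : CompleteSpace Z)
      (q : M →L[ℂ] Z) (φ : stabilizerSubalgebra M N →ₐ[ℂ] (Z →L[ℂ] Z)),
      IsOpenQuotientMap q ∧ (∀ x, ‖q x‖ = ‖N.mkQ (x : X)‖) ∧ (∀ T, ‖φ T‖ ≤ ‖T‖) ∧
      ∀ T x, φ T (q x) = q ⟨T.1 x, T.2.1 x x.2⟩ := by
  have hMc : CompleteSpace M := hM.completeSpace_coe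
  have hcl : IsClosed (N.submoduleOf M : Set M) := hN.preimage continuous_subtype_val
  let q : M →L[ℂ] (M ⧸ N.submoduleOf M) := (N.submoduleOf M).mkQL
  have hq : ∀ x, ‖q x‖ = ‖N.mkQ (x : X)‖ := fun x => by
    have himage : ((↑) : M → X) '' (N.submoduleOf M : Set M) = N := by
      ext y
      simpa [Submodule.submoduleOf] using fun hy => hNM hy
    calc ‖q x‖ = Metric.infDist x (N.submoduleOf M : Set M) :=
          QuotientAddGroup.norm_mk (S := (N.submoduleOf M).toAddSubgroup) x
      _ = Metric.infDist (x : X) N := by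
          rw [← himage, Metric.infDist_image isometry_subtype_coe]
      _ = ‖N.mkQ (x : X)‖ := (QuotientAddGroup.norm_mk (S := N.toAddSubgroup) (x : X)).symm
  have hq1 : ∀ x, ‖q x‖ ≤ ‖x‖ := fun x => Submodule.Quotient.norm_mk_le _ x
  have hlift : ∀ z : M ⧸ N.submoduleOf M, ∀ ε > 0, ∃ x, q x = z ∧ ‖x‖ < ‖z‖ + ε := fun z ε hε =>
    Submodule.Quotient.norm_mk_lt z hε
  let ψ : stabilizerSubalgebra M N → ((M ⧸ N.submoduleOf M) →ₗ[ℂ] (M ⧸ N.submoduleOf M)) :=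
    fun T => (N.submoduleOf M).mapQ (N.submoduleOf M) (T.1.toLinearMap.restrict T.2.1)
      fun x hx => T.2.2 _ hx
  have hψ : ∀ T x, ψ T (q x) = q ⟨T.1 x, T.2.1 x x.2⟩ := fun T x => rfl
  have hψb : ∀ T z, ‖ψ T z‖ ≤ ‖T‖ * ‖z‖ := fun T z => by
    refine le_of_forall_pos_le_add fun ε hε => ?_
    obtain ⟨x, rfl, hx⟩ := hlift z (ε / (‖T‖ + 1)) (by positivity)
    have h1 : ‖T‖ * (ε / (‖T‖ + 1)) ≤ ε := by
      rw [mul_div_left_comm]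
      exact mul_le_of_le_one_right hε.le ((div_le_one (by positivity)).mpr (by linarith))
    calc ‖ψ T (q x)‖ ≤ ‖T.1 x‖ := hq1 ⟨T.1 x, T.2.1 x x.2⟩
      _ ≤ ‖T‖ * ‖x‖ := T.1.le_opNorm x
      _ ≤ ‖T‖ * (‖q x‖ + ε / (‖T‖ + 1)) := by gcongr
      _ ≤ ‖T‖ * ‖q x‖ + ε := by rw [mul_add]; linarith
  have hsurj : Function.Surjective q := (N.submoduleOf M).mkQ_surjective
  let φ : stabilizerSubalgebra M N →ₐ[ℂ]
      ((M ⧸ N.submoduleOf M) →L[ℂ] (M ⧸ N.submoduleOf M)) :=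
    AlgHom.ofLinearMap
      { toFun := fun T => (ψ T).mkContinuous ‖T‖ (hψb T)
        map_add' := fun S T => ContinuousLinearMap.ext (hsurj.forall.mpr fun x => rfl)
        map_smul' := fun c T => ContinuousLinearMap.ext (hsurj.forall.mpr fun x => rfl) }
      (ContinuousLinearMap.ext (hsurj.forall.mpr fun x => rfl))
      (fun S T => ContinuousLinearMap.ext (hsurj.forall.mpr fun x => rfl))
  exact ⟨M ⧸ N.submoduleOf M, inferInstance, inferInstance, inferInstance, q, φ,
    (N.submoduleOf M).isOpenQuotientMap_mkQL, hq, fun T =>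
      LinearMap.mkContinuous_norm_le (ψ T) (norm_nonneg _) (hψb T), fun T x => rfl⟩

end

/-- The product of a family of ring elements along a list of indices. -/
def wordProd {ι A : Type*} [Monoid A] (n : ι → A) (l : List ι) : A := (l.map n).prod

section

variable {ι A : Type*} [Monoid A] (n : ι → A)

@[simp] theorem wordProd_nil : wordProd n [] = 1 := rfl

@[simp] theorem wordProd_cons (i : ι) (l : List ι) :
    wordProd n (i :: l) = n i * wordProd n l := by simp [wordProd]

@[simp] theorem wordProd_append (l l' : List ι) :
    wordProd n (l ++ l') = wordProd n l * wordProd n l' := by simp [wordProd]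

theorem map_wordProd {B F : Type*} [Monoid B] [FunLike F A B] [MonoidHomClass F A B] (f : F)
    (l : List ι) : f (wordProd n l) = wordProd (fun i => f (n i)) l := by
  simp [wordProd, map_list_prod, Function.comp_def]

theorem wordProd_apply_mem {ι Z : Type*} [NormedAddCommGroup Z] [NormedSpace ℂ Z]
    {n : ι → Z →L[ℂ] Z} {W : Submodule ℂ Z} (hW : ∀ i, ∀ x ∈ W, n i x ∈ W) (l : List ι) :
    ∀ x ∈ W, wordProd n l x ∈ W := by
  induction l with
  | nil => exact fun x hx => hx
  | cons i l ih => exact fun x hx => by simpa using hW i _ (ih x hx)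

end

theorem exists_subseq_tendsto_of_forall_near {E : Type*} [PseudoMetricSpace E] [CompleteSpace E]
    {a : ℕ → E} (h : ∀ ε > 0, ∃ K : Set E, IsCompact K ∧ ∀ᶠ k in atTop, ∃ T ∈ K, dist (a k) T < ε) :
    ∃ T, ∃ φ : ℕ → ℕ, StrictMono φ ∧ Tendsto (a ∘ φ) atTop (𝓝 T) := by
  have : TotallyBounded (Set.range a) := by
    refine totallyBounded_of_forall_exists_near fun ε hε => ?_
    obtain ⟨K, hK, hev⟩ := h ε hε
    obtain ⟨k₀, hk₀⟩ := eventually_atTop.mp hev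
    refine ⟨K ∪ a '' Set.Iio k₀,
      (hK.union ((Set.finite_Iio k₀).image a).isCompact).totallyBounded, ?_⟩
    rintro _ ⟨k, rfl⟩
    rcases le_or_gt k₀ k with hk | hk
    · obtain ⟨T, hT, hd⟩ := hk₀ k hk
      exact ⟨T, Or.inl hT, hd⟩
    · exact ⟨a k, Or.inr ⟨k, hk, rfl⟩, by simpa using hε⟩
  obtain ⟨T, -, φ, hφ, hT⟩ := (isCompact_closure_of_totallyBounded this).tendsto_subseq
    (fun k => subset_closure ⟨k, rfl⟩ : ∀ k, a k ∈ closure (Set.range a))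
  exact ⟨T, φ, hφ, hT⟩

section

variable {ι Z : Type*} [NormedAddCommGroup Z] [NormedSpace ℂ Z] [CompleteSpace Z]
  {n : ι → Z →L[ℂ] Z} {θ : ℂ} {K : Set (Z →L[ℂ] Z)}

omit [CompleteSpace Z] in
theorem isCompactOperator_wordProd_sub (hn : ∀ i, IsCompactOperator (n i - θ • 1 : Z →L[ℂ] Z))
    (l : List ι) : IsCompactOperator (wordProd n l - θ ^ l.length • 1 : Z →L[ℂ] Z) := by
  induction l with
  | nil => simpa using isCompactOperator_zero
  | cons i l ih =>
    have h : wordProd n (i :: l) - θ ^ (i :: l).length • 1 =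
        (n i - θ • 1) * wordProd n l + θ • (wordProd n l - θ ^ l.length • 1) := by
      simp only [wordProd_cons, List.length_cons, pow_succ', sub_mul, smul_sub, smul_mul_assoc,
        one_mul, mul_smul]
      abel
    rw [h]
    exact ((hn i).comp_clm _).add (ih.smul θ)

omit [CompleteSpace Z] in
theorem exists_isCompact_wordProd_mem (hK : IsCompact K) (hnK : ∀ i, n i ∈ K) (p : ℕ) :
    ∃ K' : Set (Z →L[ℂ] Z), IsCompact K' ∧ ∀ l : List ι, l.length = p → wordProd n l ∈ K' := by
  induction p with
  | zero =>
    refine ⟨{1}, isCompact_singleton, fun l hl => ?_⟩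
    rw [List.length_eq_zero_iff.mp hl]
    rfl
  | succ p ih =>
    obtain ⟨K', hK', h⟩ := ih
    refine ⟨_, (hK.prod hK').image (f := fun x => x.1 * x.2) (by fun_prop), fun l hl => ?_⟩
    obtain ⟨i, l, rfl⟩ := List.exists_cons_of_length_eq_add_one hl
    exact ⟨(n i, wordProd n l), ⟨hnK i, h l (by simpa using hl)⟩, by simp⟩

theorem exists_isCompact_wordProd_sub_mem
    (hn : ∀ i, IsCompactOperator (n i - θ • 1 : Z →L[ℂ] Z))
    (hK : IsCompact K) (hnK : ∀ i, n i ∈ K) (p : ℕ) :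
    ∃ S : Set (Z →L[ℂ] Z), IsCompact S ∧ (∀ T ∈ S, IsCompactOperator T) ∧
      ∀ l : List ι, l.length = p → wordProd n l - θ ^ p • 1 ∈ S := by
  obtain ⟨K', hK', h⟩ := exists_isCompact_wordProd_mem hK hnK p
  refine ⟨(fun T => T - θ ^ p • 1) '' K' ∩ {T | IsCompactOperator T},
    (hK'.image (by fun_prop)).inter_right isClosed_setOfPred_isCompactOperator,
    fun T hT => hT.2, fun l hl => ⟨⟨_, h l hl, rfl⟩, ?_⟩⟩
  have := isCompactOperator_wordProd_sub hn l
  rwa [hl] at this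

/-- Long words, normalised by a bound for all shorter words, are nearly in a compact set. -/
theorem exists_isCompact_forall_wordProd_near (hθ : ‖θ‖ < 1)
    (hn : ∀ i, IsCompactOperator (n i - θ • 1 : Z →L[ℂ] Z))
    (hK : IsCompact K) (hnK : ∀ i, n i ∈ K) {ε : ℝ} (hε : 0 < ε) :
    ∃ m : ℕ, ∃ K' : Set (Z →L[ℂ] Z), IsCompact K' ∧ ∀ c > 0, ∀ l : List ι, m ≤ l.length →
      (∀ s : List ι, s.length ≤ l.length → ‖wordProd n s‖ ≤ c) →
      ∃ T ∈ K', dist ((c⁻¹ : ℂ) • wordProd n l) T < ε := by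
  obtain ⟨p, hp⟩ := exists_pow_lt_of_lt_one (show 0 < ε / 3 by positivity) hθ
  obtain ⟨S, hS, hScomp, hSmem⟩ := exists_isCompact_wordProd_sub_mem hn hK hnK p
  obtain ⟨K', hK', h⟩ := exists_isCompact_forall_mul_mul_mem hS hScomp
  refine ⟨2 * p, K', hK', fun c hc l hl hsub => ?_⟩
  let u := l.take p
  let s := (l.drop p).take (l.length - 2 * p)
  let v := (l.drop p).drop (l.length - 2 * p)
  have hl' : l = u ++ (s ++ v) := by simp [u, s, v]
  have hu : u.length = p := by simp [u]; omega
  have hv : v.length = p := by simp [v]; omega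
  have hs : s.length ≤ l.length := by simp [s]
  have hc' : ‖(c⁻¹ : ℂ)‖ * c = 1 := by
    simp [abs_of_pos hc, hc.ne']
  refine ⟨_, h _ (hSmem u hu) _ (hSmem v hv) ((c⁻¹ : ℂ) • wordProd n s) ?_, ?_⟩
  · rw [norm_smul, ← hc']
    gcongr
    exact hsub s hs
  have heq : (c⁻¹ : ℂ) • wordProd n l - (wordProd n u - θ ^ p • 1) * ((c⁻¹ : ℂ) • wordProd n s) *
      (wordProd n v - θ ^ p • 1) = (c⁻¹ : ℂ) • θ ^ p •
        (wordProd n (u ++ s) + wordProd n (s ++ v) - θ ^ p • wordProd n s) := by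
    rw [hl']
    simp only [wordProd_append, sub_mul, mul_sub, smul_mul_assoc, mul_smul_comm, one_mul, mul_one,
      smul_sub, smul_add, mul_assoc]
    module
  rw [dist_eq_norm, heq, norm_smul, norm_smul, norm_pow]
  have h1 := hsub (u ++ s) (by rw [hl']; simp)
  have h2 := hsub (s ++ v) (by rw [hl']; simp)
  have h3 := hsub s hs
  have hθp : ‖θ‖ ^ p ≤ 1 := pow_le_one₀ (norm_nonneg _) hθ.le
  calc ‖(c⁻¹ : ℂ)‖ * (‖θ‖ ^ p *
        ‖wordProd n (u ++ s) + wordProd n (s ++ v) - θ ^ p • wordProd n s‖)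
      ≤ ‖(c⁻¹ : ℂ)‖ * (‖θ‖ ^ p * (c + c + 1 * c)) := by
        gcongr
        refine (norm_sub_le _ _).trans (add_le_add ((norm_add_le _ _).trans (add_le_add h1 h2)) ?_)
        rw [norm_smul, norm_pow]
        gcongr
    _ = 3 * ‖θ‖ ^ p * (‖(c⁻¹ : ℂ)‖ * c) := by ring
    _ < ε := by rw [hc', mul_one]; linarith

omit [CompleteSpace Z] in
/-- In an irreducible family no nonzero operator is annihilated two-sidedly by all words. -/
theorem eq_zero_of_forall_mul_wordProd_mul_eq_zero
    (hirr : ∀ W : Submodule ℂ Z, IsClosed (W : Set Z) → (∀ i, ∀ x ∈ W, n i x ∈ W) →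
      W = ⊥ ∨ W = ⊤) {T : Z →L[ℂ] Z} (hT : ∀ s, T * wordProd n s * T = 0) : T = 0 := by
  by_contra hne
  obtain ⟨x, hx⟩ : ∃ x, T x ≠ 0 := by
    by_contra! h
    exact hne (ContinuousLinearMap.ext h)
  let W := (Submodule.span ℂ (Set.range fun s => wordProd n s (T x))).topologicalClosure
  have hxW : T x ∈ W := Submodule.le_topologicalClosure _ (Submodule.subset_span ⟨[], rfl⟩)
  have hker : W ≤ LinearMap.ker T.toLinearMap := by
    refine Submodule.topologicalClosure_minimal _ (Submodule.span_le.mpr ?_) T.isClosed_ker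
    rintro _ ⟨s, rfl⟩
    exact DFunLike.congr_fun (hT s) x
  have hinv : ∀ i, ∀ y ∈ W, n i y ∈ W := by
    intro i
    have h : Submodule.span ℂ (Set.range fun s => wordProd n s (T x)) ≤
        W.comap (n i).toLinearMap := by
      rw [Submodule.span_le]
      rintro _ ⟨s, rfl⟩
      exact Submodule.le_topologicalClosure _
        (Submodule.subset_span ⟨i :: s, by simp⟩)
    exact fun y hy => Submodule.topologicalClosure_minimal _ h
      ((Submodule.isClosed_topologicalClosure _).preimage (n i).continuous) hy
  rcases hirr W (Submodule.isClosed_topologicalClosure _) hinv with h | h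
  · exact hx (by simpa [h] using hxW)
  · exact hx (hker (h ▸ Submodule.mem_top : x ∈ W))

end

theorem exists_forall_le_two_mul {α : Type*} [Nonempty α] {f : α → ℝ} (hf : BddAbove (Set.range f))
    {a₀ : α} (h : 0 < f a₀) : ∃ a, 0 < f a ∧ ∀ b, f b ≤ 2 * f a := by
  have hpos : 0 < ⨆ a, f a := h.trans_le (le_ciSup hf a₀)
  obtain ⟨a, ha⟩ := exists_lt_of_lt_ciSup (half_lt_self hpos)
  exact ⟨a, (half_pos hpos).trans ha, fun b => (le_ciSup hf b).trans (by linarith)⟩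

section

variable {ι Z : Type*} [NormedAddCommGroup Z] [NormedSpace ℂ Z] [CompleteSpace Z]
  {n : ι → Z →L[ℂ] Z} {θ : ℂ} {K : Set (Z →L[ℂ] Z)}

omit [CompleteSpace Z] in
/-- Near-maximisers of the growth of words: subexponential but unbounded growth. -/
theorem exists_wordProd_near_max (hbd : ∀ η : ℝ, 1 < η → ∃ C, ∀ l : List ι,
      ‖wordProd n l‖ ≤ C * η ^ l.length)
    (hunb : ∀ C, ∃ l : List ι, C < ‖wordProd n l‖) :
    ∃ (L : ℕ → List ι) (η σ : ℕ → ℝ), (∀ k, 0 < σ k) ∧ Tendsto σ atTop atTop ∧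
      Tendsto (fun k => (L k).length) atTop atTop ∧ (∀ k, 1 ≤ η k) ∧ (∀ k, η k ≤ 2) ∧
      (∀ k, ‖wordProd n (L k)‖ = σ k * η k ^ (L k).length) ∧
      ∀ k l, ‖wordProd n l‖ ≤ 2 * σ k * η k ^ l.length := by
  let η : ℕ → ℝ := fun k => 1 + 1 / ((k : ℝ) + 1)
  have hη1 : ∀ k, 1 < η k := fun k => by
    have : (0 : ℝ) < 1 / ((k : ℝ) + 1) := by positivity
    linarith
  have hη2 : ∀ k, η k ≤ 2 := fun k => by
    have : 1 / ((k : ℝ) + 1) ≤ 1 :=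
      (div_le_one (by positivity)).mpr (by linarith [k.cast_nonneg (α := ℝ)])
    linarith
  have hηlim : Tendsto η atTop (𝓝 1) := by
    simpa [η] using tendsto_one_div_add_atTop_nhds_zero_nat.const_add (1 : ℝ)
  have hη0 : ∀ k, 0 < η k := fun k => one_pos.trans (hη1 k)
  obtain ⟨l₀, hl₀⟩ := hunb 0
  have hmax : ∀ k, ∃ l : List ι, 0 < ‖wordProd n l‖ / η k ^ l.length ∧
      ∀ l', ‖wordProd n l'‖ / η k ^ l'.length ≤ 2 * (‖wordProd n l‖ / η k ^ l.length) := by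
    intro k
    obtain ⟨C, hC⟩ := hbd _ (hη1 k)
    exact exists_forall_le_two_mul ⟨C, by
      rintro _ ⟨l, rfl⟩
      exact (div_le_iff₀ (pow_pos (hη0 k) _)).mpr (hC l)⟩ (a₀ := l₀)
      (div_pos hl₀ (pow_pos (hη0 k) _))
  choose L hLpos hLmax using hmax
  have hσ : Tendsto (fun k => ‖wordProd n (L k)‖ / η k ^ (L k).length) atTop atTop := by
    refine tendsto_atTop.mpr fun C => ?_
    obtain ⟨s, hs⟩ := hunb (2 * C)
    have hlim : Tendsto (fun k => ‖wordProd n s‖ / η k ^ s.length) atTop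
        (𝓝 (‖wordProd n s‖ / 1 ^ s.length)) :=
      tendsto_const_nhds.div (hηlim.pow _) (by simp)
    rw [one_pow, div_one] at hlim
    filter_upwards [hlim.eventually_const_lt hs] with k hk
    linarith [hLmax k s]
  refine ⟨L, η, fun k => ‖wordProd n (L k)‖ / η k ^ (L k).length, hLpos, hσ, ?_,
    fun k => (hη1 k).le, hη2, fun k => (div_mul_cancel₀ _ (pow_pos (hη0 k) _).ne').symm,
    fun k l => (div_le_iff₀ (pow_pos (hη0 k) _)).mp (hLmax k l)⟩
  obtain ⟨C, hC⟩ := hbd 2 one_lt_two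
  refine tendsto_atTop.mpr fun m => ?_
  filter_upwards [hσ.eventually_gt_atTop (|C| * 2 ^ m)] with k hk
  by_contra! hlt
  have h1 : ‖wordProd n (L k)‖ / η k ^ (L k).length ≤ ‖wordProd n (L k)‖ :=
    div_le_self (norm_nonneg _) (one_le_pow₀ (hη1 k).le)
  have h2 : C * 2 ^ (L k).length ≤ |C| * 2 ^ m := by
    gcongr
    · exact le_abs_self C
    · exact one_le_two
  linarith [hC (L k)]

/-- An irreducible family of subexponential growth is bounded. -/
theorem exists_forall_norm_wordProd_le_of_irreducible (hθ : ‖θ‖ < 1)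
    (hn : ∀ i, IsCompactOperator (n i - θ • 1 : Z →L[ℂ] Z))
    (hK : IsCompact K) (hnK : ∀ i, n i ∈ K)
    (hbd : ∀ η : ℝ, 1 < η → ∃ C, ∀ l : List ι, ‖wordProd n l‖ ≤ C * η ^ l.length)
    (hirr : ∀ W : Submodule ℂ Z, IsClosed (W : Set Z) → (∀ i, ∀ x ∈ W, n i x ∈ W) →
      W = ⊥ ∨ W = ⊤) : ∃ C, ∀ l : List ι, ‖wordProd n l‖ ≤ C := by
  by_contra! hunb
  obtain ⟨L, η, σ, hσpos, hσ, hLlen, hη1, hη2, hLnorm, hLmax⟩ := exists_wordProd_near_max hbd hunb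
  let c : ℕ → ℝ := fun k => 2 * ‖wordProd n (L k)‖
  have hη0 : ∀ k, 0 < η k := fun k => one_pos.trans_le (hη1 k)
  have hc : ∀ k, 0 < c k := fun k => by
    have := hσpos k
    have := hη0 k
    simp only [c, hLnorm]
    positivity
  let a : ℕ → Z →L[ℂ] Z := fun k => ((c k : ℂ)⁻¹) • wordProd n (L k)
  have hnear : ∀ ε > 0, ∃ K' : Set (Z →L[ℂ] Z), IsCompact K' ∧
      ∀ᶠ k in atTop, ∃ T ∈ K', dist (a k) T < ε := by
    intro ε hε
    obtain ⟨m, K', hK', h⟩ := exists_isCompact_forall_wordProd_near hθ hn hK hnK hε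
    refine ⟨K', hK', ?_⟩
    filter_upwards [hLlen.eventually_ge_atTop m] with k hk
    refine h (c k) (hc k) (L k) hk fun s hs => (hLmax k s).trans ?_
    simp only [c, hLnorm, ← mul_assoc]
    have := hσpos k
    gcongr
    exact hη1 k
  obtain ⟨T, φ, hφ, hT⟩ := exists_subseq_tendsto_of_forall_near hnear
  have hanorm : ∀ k, ‖a k‖ = 1 / 2 := fun k => by
    have h0 : ‖wordProd n (L k)‖ ≠ 0 := fun h => (hc k).ne' (by simp [c, h])
    simp only [a, norm_smul, norm_inv, Complex.norm_real, Real.norm_eq_abs, abs_of_pos (hc k)]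
    simp only [c]
    field_simp
  have hTnorm : ‖T‖ = 1 / 2 :=
    tendsto_nhds_unique hT.norm (by simp [hanorm])
  have hT0 : T = 0 := by
    refine eq_zero_of_forall_mul_wordProd_mul_eq_zero hirr fun s => ?_
    have h1 : Tendsto (fun k => a (φ k) * wordProd n s * a (φ k)) atTop
        (𝓝 (T * wordProd n s * T)) := (hT.mul_const _).mul hT
    refine tendsto_nhds_unique h1 (squeeze_zero_norm (a := fun k => 2 ^ s.length / (2 * σ (φ k)))
      (fun k => ?_) ?_)
    · generalize φ k = k
      have hw : a k * wordProd n s * a k =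
          ((c k : ℂ)⁻¹) • ((c k : ℂ)⁻¹) • wordProd n (L k ++ (s ++ L k)) := by
        simp only [a, smul_mul_assoc, mul_smul_comm, wordProd_append, mul_assoc]
      have h3 : η k ^ s.length ≤ 2 ^ s.length := pow_le_pow_left₀ (hη0 k).le (hη2 k) _
      have h4 := hσpos k
      have h5 := pow_pos (hη0 k) (L k).length
      rw [hw, norm_smul, norm_smul, norm_inv, Complex.norm_real, Real.norm_eq_abs,
        abs_of_pos (hc k)]
      calc (c k)⁻¹ * ((c k)⁻¹ * ‖wordProd n (L k ++ (s ++ L k))‖)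
          ≤ (c k)⁻¹ * ((c k)⁻¹ * (2 * σ k * η k ^ (L k ++ (s ++ L k)).length)) := by
            have := hc k
            gcongr
            exact hLmax k _
        _ = η k ^ s.length / (2 * σ k) := by
            simp only [c, hLnorm, List.length_append, pow_add]
            field_simp
        _ ≤ 2 ^ s.length / (2 * σ k) := by gcongr
    · exact (tendsto_const_nhds.div_atTop (hσ.const_mul_atTop two_pos)).comp hφ.tendsto_atTop
  rw [hT0, norm_zero] at hTnorm
  norm_num at hTnorm

/-- Bounded words: the set of all words is precompact. -/
theorem totallyBounded_range_wordProd (hθ : ‖θ‖ < 1)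
    (hn : ∀ i, IsCompactOperator (n i - θ • 1 : Z →L[ℂ] Z))
    (hK : IsCompact K) (hnK : ∀ i, n i ∈ K) {c : ℝ} (hc : 0 < c)
    (hb : ∀ l : List ι, ‖wordProd n l‖ ≤ c) : TotallyBounded (Set.range (wordProd n)) := by
  refine totallyBounded_of_forall_exists_near fun ε hε => ?_
  obtain ⟨m, K', hK', h⟩ := exists_isCompact_forall_wordProd_near hθ hn hK hnK
    (show 0 < ε / c by positivity)
  choose S hS hSmem using fun p => exists_isCompact_wordProd_mem hK hnK p
  have hcompact : IsCompact (((c : ℂ) • ·) '' K' ∪ ⋃ p ∈ Set.Iio m, S p) :=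
    (hK'.image (by fun_prop)).union ((Set.finite_Iio m).isCompact_biUnion fun p _ => hS p)
  refine ⟨_, hcompact.totallyBounded, ?_⟩
  rintro _ ⟨l, rfl⟩
  rcases le_or_gt m l.length with hl | hl
  · obtain ⟨T, hT, hd⟩ := h c hc l hl fun s _ => hb s
    refine ⟨(c : ℂ) • T, Or.inl ⟨T, hT, rfl⟩, ?_⟩
    have hc' : (c : ℂ) ≠ 0 := by exact_mod_cast hc.ne'
    rw [← smul_inv_smul₀ hc' (wordProd n l), dist_eq_norm, ← smul_sub, norm_smul,
      Complex.norm_real, Real.norm_eq_abs,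
      abs_of_pos hc]
    rwa [lt_div_iff₀' hc, dist_eq_norm] at hd
  · exact ⟨_, Or.inr (Set.mem_iUnion₂.mpr ⟨l.length, hl, hSmem _ l rfl⟩), by simpa using hε⟩

/-- The compact case of the Berger-Wang argument for irreducible families. -/
theorem exists_forall_norm_wordProd_le_half (hθ : ‖θ‖ < 1)
    (hn : ∀ i, IsCompactOperator (n i - θ • 1 : Z →L[ℂ] Z))
    (hK : IsCompact K) (hnK : ∀ i, n i ∈ K)
    (hbd : ∀ η : ℝ, 1 < η → ∃ C, ∀ l : List ι, ‖wordProd n l‖ ≤ C * η ^ l.length)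
    (hsr : ∃ m, ∀ l : List ι, m ≤ l.length → ∃ k, 1 ≤ k ∧ ‖wordProd n l ^ k‖ ≤ (1 / 4 : ℝ) ^ k)
    (hirr : ∀ W : Submodule ℂ Z, IsClosed (W : Set Z) → (∀ i, ∀ x ∈ W, n i x ∈ W) →
      W = ⊥ ∨ W = ⊤) :
    ∃ p, 1 ≤ p ∧ ∀ l : List ι, l.length = p → ‖wordProd n l‖ ≤ 1 / 2 := by
  by_contra! hlong
  obtain ⟨c', hc'⟩ := exists_forall_norm_wordProd_le_of_irreducible hθ hn hK hnK hbd hirr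
  obtain ⟨c, hc, hb⟩ : ∃ c : ℝ, 0 < c ∧ ∀ l : List ι, ‖wordProd n l‖ ≤ c :=
    ⟨|c'| + 1, by positivity, fun l => (hc' l).trans (by linarith [le_abs_self c'])⟩
  have htb := totallyBounded_range_wordProd hθ hn hK hnK hc hb
  have hpair : ∀ k : ℕ, ∃ p q : List ι, k ≤ q.length ∧ 1 / (2 * c) ≤ ‖wordProd n p‖ ∧
      ‖wordProd n p - wordProd n p * wordProd n q‖ ≤ 1 / ((k : ℝ) + 1) := by
    intro k
    have hε : (0 : ℝ) < 1 / ((k : ℝ) + 1) := by positivity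
    obtain ⟨t, ht, hcov⟩ := Metric.totallyBounded_iff.mp htb _ (half_pos hε)
    have := ht.fintype
    obtain ⟨l, hl, hl2⟩ := hlong ((Fintype.card t + 1) * (k + 1)) (Nat.mul_pos (by simp) (by simp))
    have hcov' : ∀ s : List ι, ∃ y : t, dist (wordProd n s) y < 1 / ((k : ℝ) + 1) / 2 := by
      intro s
      obtain ⟨y, hy, hd⟩ := Set.mem_iUnion₂.mp (hcov ⟨s, rfl⟩)
      exact ⟨⟨y, hy⟩, hd⟩
    choose y hy using hcov'
    obtain ⟨i, j, hij, hyij⟩ : ∃ i j : Fin (Fintype.card t + 1), i < j ∧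
        y (l.take (i * (k + 1))) = y (l.take (j * (k + 1))) := by
      obtain ⟨i, j, hij, h⟩ := Fintype.exists_ne_map_eq_of_card_lt
        (fun i : Fin (Fintype.card t + 1) => y (l.take (i * (k + 1)))) (by simp)
      rcases lt_or_gt_of_ne hij with h' | h'
      · exact ⟨i, j, h', h⟩
      · exact ⟨j, i, h', h.symm⟩
    have hle : (i : ℕ) * (k + 1) + (k + 1) ≤ j * (k + 1) := by
      rw [← Nat.succ_mul]
      exact Nat.mul_le_mul_right _ hij
    have hjl : (j : ℕ) * (k + 1) ≤ l.length := by
      rw [hl]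
      exact Nat.mul_le_mul_right _ j.2.le
    have hsplit : l.take (j * (k + 1)) =
        l.take (i * (k + 1)) ++ (l.take (j * (k + 1))).drop (i * (k + 1)) := by
      conv_lhs => rw [← List.take_append_drop (i * (k + 1)) (l.take (j * (k + 1)))]
      rw [List.take_take, min_eq_left (by omega)]
    refine ⟨l.take (i * (k + 1)), (l.take (j * (k + 1))).drop (i * (k + 1)), ?_, ?_, ?_⟩
    · simp
      omega
    · have h1 : wordProd n l = wordProd n (l.take (i * (k + 1))) *
          wordProd n (l.drop (i * (k + 1))) := by
        rw [← wordProd_append, List.take_append_drop]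
      rw [div_le_iff₀ (by positivity)]
      have h2 := norm_mul_le (wordProd n (l.take (i * (k + 1)))) (wordProd n (l.drop (i * (k + 1))))
      rw [← h1] at h2
      nlinarith [hb (l.drop (i * (k + 1))), norm_nonneg (wordProd n (l.take (i * (k + 1))))]
    · rw [← wordProd_append, ← hsplit, ← dist_eq_norm]
      have h1 := hy (l.take (i * (k + 1)))
      have h2 := hy (l.take (j * (k + 1)))
      rw [← hyij] at h2
      linarith [dist_triangle_right (wordProd n (l.take (i * (k + 1))))
        (wordProd n (l.take (j * (k + 1)))) (y (l.take (i * (k + 1))) : Z →L[ℂ] Z)]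
  choose p q hq hp hpq using hpair
  have hcl := isCompact_closure_of_totallyBounded htb
  obtain ⟨⟨P, Q⟩, -, φ, hφ, hPQ⟩ := (hcl.prod hcl).tendsto_subseq
    (x := fun k => (wordProd n (p k), wordProd n (q k)))
    fun k => ⟨subset_closure ⟨_, rfl⟩, subset_closure ⟨_, rfl⟩⟩
  have hP : Tendsto (fun k => wordProd n (p (φ k))) atTop (𝓝 P) :=
    (continuous_fst.tendsto _).comp hPQ
  have hQ : Tendsto (fun k => wordProd n (q (φ k))) atTop (𝓝 Q) :=
    (continuous_snd.tendsto _).comp hPQ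
  have hqlen : Tendsto (fun k => (q (φ k)).length) atTop atTop :=
    tendsto_atTop_mono (fun k => (hφ.le_apply).trans (hq (φ k))) tendsto_id
  have hPeq : P - P * Q = 0 := by
    refine tendsto_nhds_unique (hP.sub (hP.mul hQ)) (squeeze_zero_norm (fun k => hpq (φ k)) ?_)
    exact tendsto_one_div_add_atTop_nhds_zero_nat.comp hφ.tendsto_atTop
  have hP0 : P ≠ 0 := by
    rintro rfl
    have : 1 / (2 * c) ≤ ‖(0 : Z →L[ℂ] Z)‖ := ge_of_tendsto' hP.norm fun k => hp (φ k)
    rw [norm_zero] at this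
    exact absurd this (not_le_of_gt (by positivity))
  have hQcomp : IsCompactOperator Q := by
    have h1 : Tendsto (fun k => wordProd n (q (φ k)) - θ ^ (q (φ k)).length • 1) atTop
        (𝓝 (Q - (0 : ℂ) • 1)) :=
      hQ.sub (((tendsto_pow_atTop_nhds_zero_of_norm_lt_one hθ).comp hqlen).smul_const _)
    rw [zero_smul, sub_zero] at h1
    exact isCompactOperator_of_tendsto h1
      (Eventually.of_forall fun k => isCompactOperator_wordProd_sub hn _)
  have h1Q : (1 : ℂ) ∈ spectrum ℂ Q := by
    refine fun hu => hP0 ?_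
    rw [spectrum.mem_resolventSet_iff, map_one] at hu
    exact (hu.mul_left_eq_zero).mp (by rw [mul_sub, mul_one, hPeq])
  obtain ⟨m, hm⟩ := hsr
  obtain ⟨k, ⟨z, hz, hz1⟩, hk⟩ := ((hQcomp.exists_mem_spectrum_near one_ne_zero h1Q hQ
    (show (0 : ℝ) < 1 / 2 by norm_num)).and (hqlen.eventually_ge_atTop m)).exists
  obtain ⟨r, hr, hpow⟩ := hm _ hk
  have h2 := norm_le_of_mem_spectrum_of_norm_pow_le ContinuousLinearMap.norm_id_le (by norm_num)
    hr hpow hz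
  have h3 := norm_sub_norm_le (1 : ℂ) z
  rw [norm_one, norm_sub_rev] at h3
  linarith

end

section

variable {ι : Type*} {X : Type*} [NormedAddCommGroup X] [NormedSpace ℂ X] {n : ι → X →L[ℂ] X}

/-- A closed subspace invariant under a family of operators. -/
structure IsClosedInvariant (n : ι → X →L[ℂ] X) (W : Submodule ℂ X) : Prop where
  isClosed : IsClosed (W : Set X)
  apply_mem : ∀ i, ∀ x ∈ W, n i x ∈ W

/-- A maximal chain of closed invariant subspaces. -/
structure IsMaxInvariantChain (n : ι → X →L[ℂ] X) (C : Set (Submodule ℂ X)) : Prop where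
  invariant : ∀ W ∈ C, IsClosedInvariant n W
  total : ∀ V ∈ C, ∀ W ∈ C, V ≤ W ∨ W ≤ V
  mem : ∀ W, IsClosedInvariant n W → (∀ V ∈ C, V ≤ W ∨ W ≤ V) → W ∈ C

theorem exists_isMaxInvariantChain (n : ι → X →L[ℂ] X) : ∃ C, IsMaxInvariantChain n C := by
  let C : Set {W : Submodule ℂ X // IsClosedInvariant n W} := maxChain (· ≤ ·)
  have hC : IsMaxChain (· ≤ ·) C := maxChain_spec
  refine ⟨Subtype.val '' C, ?_, ?_, fun W hW h => ?_⟩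
  · rintro _ ⟨W, -, rfl⟩
    exact W.2
  · rintro _ ⟨V, hV, rfl⟩ _ ⟨W, hW, rfl⟩
    exact hC.1.total hV hW
  · have : insert ⟨W, hW⟩ C = C := (hC.2 (hC.1.insert fun V hV _ => by
      rcases h V.1 ⟨V, hV, rfl⟩ with h | h
      · exact Or.inr h
      · exact Or.inl h) (Set.subset_insert _ _)).symm
    exact ⟨⟨W, hW⟩, this ▸ Set.mem_insert _ _, rfl⟩

theorem IsClosedInvariant.sInf {C : Set (Submodule ℂ X)} (h : ∀ W ∈ C, IsClosedInvariant n W) :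
    IsClosedInvariant n (sInf C) := by
  refine ⟨?_, fun i x hx => ?_⟩
  · rw [Submodule.coe_sInf]
    exact isClosed_biInter fun W hW => (h W hW).isClosed
  · rw [Submodule.mem_sInf] at hx ⊢
    exact fun W hW => (h W hW).apply_mem i x (hx W hW)

theorem IsClosedInvariant.topologicalClosure_sSup {C : Set (Submodule ℂ X)}
    (h : ∀ W ∈ C, IsClosedInvariant n W) :
    IsClosedInvariant n (sSup C).topologicalClosure := by
  refine ⟨Submodule.isClosed_topologicalClosure _, fun i => ?_⟩
  have h1 : sSup C ≤ (sSup C).topologicalClosure.comap (n i).toLinearMap :=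
    sSup_le fun W hW x hx => Submodule.le_topologicalClosure _
      (le_sSup hW ((h W hW).apply_mem i x hx))
  exact fun x hx => Submodule.topologicalClosure_minimal _ h1
    ((Submodule.isClosed_topologicalClosure _).preimage (n i).continuous) hx

/-- Cutting a maximal chain of closed invariant subspaces in two parts. -/
theorem IsMaxInvariantChain.cut {C : Set (Submodule ℂ X)} (hC : IsMaxInvariantChain n C)
    {p : Submodule ℂ X → Prop} (hp : ∀ V ∈ C, ∀ W ∈ C, p V → ¬p W → V ≤ W) :
    let N := (sSup {W ∈ C | p W}).topologicalClosure
    let M := sInf {W ∈ C | ¬p W}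
    N ∈ C ∧ M ∈ C ∧ N ≤ M ∧ ∀ W, IsClosedInvariant n W → N ≤ W → W ≤ M → W = N ∨ W = M := by
  intro N M
  have hleN : ∀ V ∈ C, p V → V ≤ N := fun V hV hpV =>
    (le_sSup (show V ∈ {W ∈ C | p W} from ⟨hV, hpV⟩)).trans (Submodule.le_topologicalClosure _)
  have hMle : ∀ V ∈ C, ¬p V → M ≤ V := fun V hV hpV =>
    sInf_le (show V ∈ {W ∈ C | ¬p W} from ⟨hV, hpV⟩)
  have hNM : N ≤ M := le_sInf fun U hU =>
    Submodule.topologicalClosure_minimal _ (sSup_le fun D hD => hp D hD.1 U hU.1 hD.2 hU.2)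
      (hC.invariant U hU.1).isClosed
  have hmem : ∀ W, IsClosedInvariant n W → N ≤ W → W ≤ M → W ∈ C := fun W hW hNW hWM =>
    hC.mem W hW fun V hV => by
      by_cases hpV : p V
      · exact Or.inl ((hleN V hV hpV).trans hNW)
      · exact Or.inr (hWM.trans (hMle V hV hpV))
  refine ⟨hmem N (.topologicalClosure_sSup fun W hW => hC.invariant W hW.1) le_rfl hNM,
    hmem M (.sInf fun W hW => hC.invariant W hW.1) hNM le_rfl, hNM, fun W hW hNW hWM => ?_⟩
  by_cases hpW : p W
  · exact Or.inl ((hleN W (hmem W hW hNW hWM) hpW).antisymm hNW)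
  · exact Or.inr (hWM.antisymm (hMle W (hmem W hW hNW hWM) hpW))

theorem norm_mkQ_eq_infDist (N : Submodule ℂ X) (x : X) : ‖N.mkQ x‖ = Metric.infDist x N :=
  QuotientAddGroup.norm_mk (S := N.toAddSubgroup) x

theorem norm_mkQ_le (N : Submodule ℂ X) (x : X) : ‖N.mkQ x‖ ≤ ‖x‖ :=
  Submodule.Quotient.norm_mk_le N x

theorem norm_mkQ_anti {N N' : Submodule ℂ X} (h : N ≤ N') (x : X) : ‖N'.mkQ x‖ ≤ ‖N.mkQ x‖ := by
  rw [norm_mkQ_eq_infDist, norm_mkQ_eq_infDist]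
  exact Metric.infDist_le_infDist_of_subset h ⟨0, N.zero_mem⟩

theorem norm_mkQ_bot (x : X) : ‖(⊥ : Submodule ℂ X).mkQ x‖ = ‖x‖ := by
  rw [norm_mkQ_eq_infDist]
  simp

theorem mkQ_eq_of_sub_mem {N : Submodule ℂ X} {x y : X} (h : x - y ∈ N) : N.mkQ x = N.mkQ y :=
  (Submodule.Quotient.eq N).mpr h

theorem exists_sub_mem_norm_lt (N : Submodule ℂ X) (x : X) {ε : ℝ} (hε : 0 < ε) :
    ∃ y, x - y ∈ N ∧ ‖y‖ < ‖N.mkQ x‖ + ε := by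
  obtain ⟨y, hy, hlt⟩ := Submodule.Quotient.norm_mk_lt (N.mkQ x) hε
  exact ⟨y, (Submodule.Quotient.eq N).mp hy.symm, hlt⟩

/-- Words of some fixed length are strict contractions on the quotient seminorm. -/
def IsContractive (n : ι → X →L[ℂ] X) (M N : Submodule ℂ X) : Prop :=
  ∃ p : ℕ, 1 ≤ p ∧ ∃ c : ℝ, 0 ≤ c ∧ c < 1 ∧ ∀ l : List ι, l.length = p →
    ∀ x ∈ M, ‖N.mkQ (wordProd n l x)‖ ≤ c * ‖N.mkQ x‖

theorem IsContractive.mono {M M' N : Submodule ℂ X} (h : IsContractive n M N) (hM : M' ≤ M) :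
    IsContractive n M' N := by
  obtain ⟨p, hp, c, hc0, hc, h⟩ := h
  exact ⟨p, hp, c, hc0, hc, fun l hl x hx => h l hl x (hM hx)⟩

theorem apply_wordProd_le_pow_mul {M : Submodule ℂ X} (hM : ∀ i, ∀ x ∈ M, n i x ∈ M) {p : ℕ}
    {c : ℝ} (hc : 0 ≤ c) {f : X → ℝ}
    (hf : ∀ l : List ι, l.length = p → ∀ x ∈ M, f (wordProd n l x) ≤ c * f x) (k : ℕ) :
    ∀ l : List ι, l.length = k * p → ∀ x ∈ M, f (wordProd n l x) ≤ c ^ k * f x := by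
  induction k with
  | zero =>
    intro l hl x hx
    simp [List.length_eq_zero_iff.mp (by simpa using hl : l.length = 0)]
  | succ k ih =>
    intro l hl x hx
    rw [Nat.succ_mul] at hl
    have h1 : (l.take p).length = p := by simp; omega
    have h2 : (l.drop p).length = k * p := by simp; omega
    rw [← List.take_append_drop p l, wordProd_append, pow_succ', mul_assoc]
    exact (hf _ h1 _ (wordProd_apply_mem hM _ x hx)).trans
      (mul_le_mul_of_nonneg_left (ih _ h2 x hx) hc)

theorem IsContractive.pow {M N : Submodule ℂ X} (hM : ∀ i, ∀ x ∈ M, n i x ∈ M) {p : ℕ}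
    {c : ℝ} (hc : 0 ≤ c) (hc1 : c < 1)
    (h : ∀ l : List ι, l.length = p → ∀ x ∈ M, ‖N.mkQ (wordProd n l x)‖ ≤ c * ‖N.mkQ x‖)
    {k : ℕ} (hk : 1 ≤ k) (l : List ι) (hl : l.length = k * p) (x : X) (hx : x ∈ M) :
    ‖N.mkQ (wordProd n l x)‖ ≤ c * ‖N.mkQ x‖ :=
  (apply_wordProd_le_pow_mul (f := fun x => ‖N.mkQ x‖) hM hc h k l hl x hx).trans
    (mul_le_mul_of_nonneg_right (pow_le_of_le_one hc hc1.le (by omega)) (norm_nonneg _))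

theorem IsContractive.trans {M N : Submodule ℂ X} {B : ℝ} (hB : ∀ i, ‖n i‖ ≤ B)
    (hM : ∀ i, ∀ x ∈ M, n i x ∈ M) (hN : ∀ i, ∀ x ∈ N, n i x ∈ N)
    (h1 : IsContractive n N ⊥) (h2 : IsContractive n M N) : IsContractive n M ⊥ := by
  obtain ⟨p₁, hp₁, c₁, hc₁, hc₁', h1⟩ := h1
  obtain ⟨p₂, hp₂, c₂, hc₂, hc₂', h2⟩ := h2
  let p := p₂ * p₁
  let c := max c₁ c₂
  have hc0 : 0 ≤ c := hc₁.trans (le_max_left _ _)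
  have hc1 : c < 1 := max_lt hc₁' hc₂'
  have hp : 1 ≤ p := Nat.mul_pos hp₂ hp₁
  have hN' : ∀ l : List ι, l.length = p → ∀ x ∈ N, ‖wordProd n l x‖ ≤ c * ‖x‖ := by
    intro l hl x hx
    have := IsContractive.pow hN hc₁ hc₁' h1 hp₂ l hl x hx
    rw [norm_mkQ_bot, norm_mkQ_bot] at this
    exact this.trans (mul_le_mul_of_nonneg_right (le_max_left _ _) (norm_nonneg _))
  have hM' : ∀ l : List ι, l.length = p → ∀ x ∈ M,
      ‖N.mkQ (wordProd n l x)‖ ≤ c * ‖N.mkQ x‖ := by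
    intro l hl x hx
    exact (IsContractive.pow hM hc₂ hc₂' h2 hp₁ l (hl.trans (mul_comm _ _)) x hx).trans
      (mul_le_mul_of_nonneg_right (le_max_right _ _) (norm_nonneg _))
  have hBword : ∀ l : List ι, ‖wordProd n l‖ ≤ |B| ^ l.length := by
    intro l
    induction l with
    | nil =>
      simp only [wordProd_nil, List.length_nil, pow_zero]
      exact ContinuousLinearMap.norm_id_le
    | cons i l ih =>
      rw [wordProd_cons, List.length_cons, pow_succ']
      exact (norm_mul_le _ _).trans (mul_le_mul ((hB i).trans (le_abs_self B)) ih
        (norm_nonneg _) (abs_nonneg _))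
  let D := |B| ^ p
  have hD : 0 ≤ D := by positivity
  have hstep : ∀ l : List ι, l.length = p → ∀ x ∈ M,
      ‖wordProd n l x‖ ≤ c * ‖x‖ + (c + D) * ‖N.mkQ x‖ := by
    intro l hl x hx
    refine le_of_forall_pos_le_add fun ε hε => ?_
    obtain ⟨y, hy, hylt⟩ := exists_sub_mem_norm_lt N x (show 0 < ε / (c + D + 1) by positivity)
    have h3 : wordProd n l x = wordProd n l (x - y) + wordProd n l y := by
      rw [← map_add, sub_add_cancel]
    have h4 : ‖wordProd n l y‖ ≤ D * ‖y‖ :=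
      (wordProd n l).le_of_opNorm_le (by simpa [D, hl] using hBword l) y
    have h5 : (c + D) * (ε / (c + D + 1)) ≤ ε := by
      rw [mul_div_left_comm]
      exact mul_le_of_le_one_right hε.le ((div_le_one (by positivity)).mpr (by linarith))
    calc ‖wordProd n l x‖ ≤ ‖wordProd n l (x - y)‖ + ‖wordProd n l y‖ := h3 ▸ norm_add_le _ _
      _ ≤ c * ‖x - y‖ + D * ‖y‖ := add_le_add (hN' l hl _ hy) h4
      _ ≤ c * (‖x‖ + ‖y‖) + D * ‖y‖ := by gcongr; exact norm_sub_le x y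
      _ = c * ‖x‖ + (c + D) * ‖y‖ := by ring
      _ ≤ c * ‖x‖ + (c + D) * (‖N.mkQ x‖ + ε / (c + D + 1)) := by gcongr
      _ ≤ _ := by rw [mul_add]; linarith
  let A := 2 * (c + D) / (1 - c)
  have hA : 0 ≤ A := div_nonneg (by positivity) (by linarith)
  have hA' : A * (1 - c) = 2 * (c + D) := div_mul_cancel₀ _ (by linarith)
  let d := (1 + c) / 2
  have hv : ∀ l : List ι, l.length = p → ∀ x ∈ M,
      ‖wordProd n l x‖ + A * ‖N.mkQ (wordProd n l x)‖ ≤ d * (‖x‖ + A * ‖N.mkQ x‖) := by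
    intro l hl x hx
    have h3 := hstep l hl x hx
    have h4 := mul_le_mul_of_nonneg_left (hM' l hl x hx) hA
    have h5 : d * (A * ‖N.mkQ x‖) - A * (c * ‖N.mkQ x‖) = (c + D) * ‖N.mkQ x‖ := by
      have : d * A - A * c = c + D := by
        simp only [d]
        linarith
      rw [← this]
      ring
    have h6 : c * ‖x‖ ≤ d * ‖x‖ := by
      have : c ≤ d := by simp only [d]; linarith
      gcongr
    rw [mul_add]
    linarith
  have hd0 : 0 ≤ d := by positivity
  have hd1 : d < 1 := by simp only [d]; linarith
  obtain ⟨k, hk⟩ := exists_pow_lt_of_lt_one (show 0 < 1 / (2 * (1 + A)) by positivity) hd1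
  have hk1 : d ^ (k + 1) * (1 + A) ≤ 1 / 2 := by
    have h3 : d ^ (k + 1) ≤ 1 / (2 * (1 + A)) :=
      (pow_le_pow_of_le_one hd0 hd1.le (Nat.le_succ k)).trans hk.le
    calc d ^ (k + 1) * (1 + A) ≤ 1 / (2 * (1 + A)) * (1 + A) := by gcongr
      _ = 1 / 2 := by field_simp
  refine ⟨(k + 1) * p, Nat.mul_pos (by simp) hp, 1 / 2, by norm_num, by norm_num,
    fun l hl x hx => ?_⟩
  rw [norm_mkQ_bot, norm_mkQ_bot]
  have h3 := apply_wordProd_le_pow_mul (f := fun x => ‖x‖ + A * ‖N.mkQ x‖) hM hd0 hv (k + 1) l hl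
    x hx
  calc ‖wordProd n l x‖ ≤ ‖wordProd n l x‖ + A * ‖N.mkQ (wordProd n l x)‖ := by
        linarith [mul_nonneg hA (norm_nonneg (N.mkQ (wordProd n l x)))]
    _ ≤ d ^ (k + 1) * (‖x‖ + A * ‖N.mkQ x‖) := h3
    _ ≤ d ^ (k + 1) * (‖x‖ + A * ‖x‖) := by gcongr; exact norm_mkQ_le N x
    _ = d ^ (k + 1) * (1 + A) * ‖x‖ := by ring
    _ ≤ 1 / 2 * ‖x‖ := by gcongr

end

section

variable {ι X : Type*} [NormedAddCommGroup X] [NormedSpace ℂ X] {n : ι → X →L[ℂ] X} {θ : ℂ}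

theorem norm_mkQ_eq_zero_iff {N : Submodule ℂ X} (hN : IsClosed (N : Set X)) {x : X} :
    ‖N.mkQ x‖ = 0 ↔ x ∈ N := by
  rw [norm_mkQ_eq_infDist]
  exact (hN.mem_iff_infDist_zero ⟨0, N.zero_mem⟩).symm

theorem exists_norm_mkQ_ge_of_not_isContractive {U D : Submodule ℂ X}
    (hU : IsClosedInvariant n U) (hD : IsClosedInvariant n D) (hDU : D ≤ U)
    (hcontr : ¬IsContractive n U D) {p : ℕ} (hp : 1 ≤ p) (hθ : ‖θ‖ ^ p ≤ 1 / 4) {K' : Set X}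
    (hK' : ∀ l : List ι, l.length = p → ∀ x, ‖x‖ ≤ 2 → (wordProd n l - θ ^ p • 1) x ∈ K') :
    ∃ y ∈ K', y ∈ U ∧ 1 / 4 ≤ ‖D.mkQ y‖ := by
  obtain ⟨l, hl, x, hx, hlt⟩ : ∃ l : List ι, l.length = p ∧ ∃ x ∈ U,
      1 / 2 * ‖D.mkQ x‖ < ‖D.mkQ (wordProd n l x)‖ := by
    by_contra! h
    exact hcontr ⟨p, hp, 1 / 2, by norm_num, by norm_num, h⟩
  have hDw := wordProd_apply_mem hD.apply_mem l
  set t := ‖D.mkQ x‖ with ht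
  have ht0 : 0 < t := by
    refine (norm_nonneg _).lt_of_ne fun h => ?_
    rw [ht, ← h, (norm_mkQ_eq_zero_iff hD.isClosed).mpr
      (hDw x ((norm_mkQ_eq_zero_iff hD.isClosed).mp h.symm))] at hlt
    simp at hlt
  obtain ⟨y, hxy, hy⟩ := exists_sub_mem_norm_lt D x ht0
  have hyU : y ∈ U := by simpa using U.sub_mem hx (hDU hxy)
  have htc : ‖(t : ℂ)⁻¹‖ = t⁻¹ := by rw [norm_inv, Complex.norm_real, Real.norm_of_nonneg ht0.le]
  refine ⟨_, hK' l hl ((t : ℂ)⁻¹ • y) ?_, ?_, ?_⟩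
  · rw [norm_smul, htc, inv_mul_le_iff₀ ht0]
    linarith
  · exact U.sub_mem (wordProd_apply_mem hU.apply_mem l _ (U.smul_mem _ hyU))
      (U.smul_mem _ (U.smul_mem _ hyU))
  · have h1 : (wordProd n l - θ ^ p • 1) ((t : ℂ)⁻¹ • y) =
        (t : ℂ)⁻¹ • (wordProd n l y - θ ^ p • y) := by
      rw [map_smul]
      rfl
    have h2 : D.mkQ (wordProd n l y) = D.mkQ (wordProd n l x) :=
      (mkQ_eq_of_sub_mem (by rw [← map_sub]; exact hDw _ hxy)).symm
    have h3 : ‖θ ^ p • D.mkQ y‖ ≤ 1 / 4 * t := by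
      rw [norm_smul, norm_pow, ← mkQ_eq_of_sub_mem hxy]
      gcongr
    rw [h1, map_smul, norm_smul, htc, map_sub, map_smul, h2, le_inv_mul_iff₀ ht0]
    have := norm_sub_norm_le (D.mkQ (wordProd n l x)) (θ ^ p • D.mkQ y)
    linarith

theorem IsMaxInvariantChain.exists_not_isContractive {C : Set (Submodule ℂ X)} {K : Set (X →L[ℂ] X)}
    [CompleteSpace X]
    (hC : IsMaxInvariantChain n C) (hθ : ‖θ‖ < 1)
    (hn : ∀ i, IsCompactOperator (n i - θ • 1 : X →L[ℂ] X))
    (hK : IsCompact K) (hnK : ∀ i, n i ∈ K) (hnc : ¬IsContractive n ⊤ ⊥) :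
    ∃ N M, IsClosedInvariant n N ∧ IsClosedInvariant n M ∧ N ≤ M ∧
      (∀ W, IsClosedInvariant n W → N ≤ W → W ≤ M → W = N ∨ W = M) ∧ ¬IsContractive n M N := by
  obtain ⟨p, hp⟩ := exists_pow_lt_of_lt_one (show (0 : ℝ) < 1 / 4 by norm_num) hθ
  have hp1 : 1 ≤ p := by
    by_contra! h
    obtain rfl : p = 0 := by omega
    norm_num at hp
  obtain ⟨S, hS, hScomp, hSmem⟩ := exists_isCompact_wordProd_sub_mem hn hK hnK p
  obtain ⟨K', hK', hK'mem⟩ := exists_isCompact_forall_apply_mem hS hScomp 2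
  obtain ⟨B, hB⟩ := hK.isBounded.exists_norm_le
  have hbot : ⊥ ∈ C := hC.mem _ ⟨by simp, by simp⟩ fun V _ => Or.inr bot_le
  have htop : ⊤ ∈ C := hC.mem _ ⟨by simp, by simp⟩ fun V _ => Or.inl le_top
  have hcbot : IsContractive n ⊥ ⊥ := ⟨1, le_rfl, 0, le_rfl, zero_lt_one, fun l _ x hx => by
    simp [(Submodule.mem_bot ℂ).mp hx]⟩
  have hle : ∀ V ∈ C, ∀ W ∈ C, IsContractive n V ⊥ → ¬IsContractive n W ⊥ → V ≤ W :=
    fun V hV W hW hpV hpW => (hC.total V hV W hW).resolve_right fun h => hpW (hpV.mono h)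
  obtain ⟨hN, hM, hNM, hgap⟩ := hC.cut hle
  set N := (sSup {W ∈ C | IsContractive n W ⊥}).topologicalClosure
  set M := sInf {W ∈ C | ¬IsContractive n W ⊥}
  obtain ⟨y, hyM, hyN⟩ : ∃ y ∈ M, y ∉ N := by
    let E : {W ∈ C | IsContractive n W ⊥} × {W ∈ C | ¬IsContractive n W ⊥} → Set X :=
      fun P => K' ∩ (P.2.1 ∩ {y | 1 / 4 ≤ ‖P.1.1.mkQ y‖})
    have hcl : ∀ P : {W ∈ C | IsContractive n W ⊥} × {W ∈ C | ¬IsContractive n W ⊥},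
        IsClosed ((P.2.1 : Set X) ∩ {y | 1 / 4 ≤ ‖P.1.1.mkQ y‖}) := fun P =>
      (hC.invariant _ P.2.2.1).isClosed.inter (isClosed_le continuous_const
        (P.1.1.mkQL.continuous.norm))
    have hcomp : ∀ P, IsCompact (E P) := fun P => hK'.inter_right (hcl P)
    have : Nonempty ({W ∈ C | IsContractive n W ⊥} × {W ∈ C | ¬IsContractive n W ⊥}) :=
      ⟨⟨⊥, hbot, hcbot⟩, ⟨⊤, htop, hnc⟩⟩
    obtain ⟨y, hy⟩ := IsCompact.nonempty_iInter_of_directed_nonempty_isCompact_isClosed E (by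
        rintro ⟨D₁, U₁⟩ ⟨D₂, U₂⟩
        have hD : ∃ D : {W ∈ C | IsContractive n W ⊥}, D₁.1 ≤ D.1 ∧ D₂.1 ≤ D.1 := by
          rcases hC.total _ D₁.2.1 _ D₂.2.1 with h | h
          · exact ⟨D₂, h, le_rfl⟩
          · exact ⟨D₁, le_rfl, h⟩
        have hU : ∃ U : {W ∈ C | ¬IsContractive n W ⊥}, U.1 ≤ U₁.1 ∧ U.1 ≤ U₂.1 := by
          rcases hC.total _ U₁.2.1 _ U₂.2.1 with h | h
          · exact ⟨U₁, le_rfl, h⟩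
          · exact ⟨U₂, h, le_rfl⟩
        obtain ⟨D, hD₁, hD₂⟩ := hD
        obtain ⟨U, hU₁, hU₂⟩ := hU
        exact ⟨⟨D, U⟩, fun y hy => ⟨hy.1, hU₁ hy.2.1, hy.2.2.trans (norm_mkQ_anti hD₁ y)⟩,
          fun y hy => ⟨hy.1, hU₂ hy.2.1, hy.2.2.trans (norm_mkQ_anti hD₂ y)⟩⟩)
      (fun P => by
        have hD := hC.invariant _ P.1.2.1
        have hU := hC.invariant _ P.2.2.1
        obtain ⟨y, hy, hyU, hy4⟩ := exists_norm_mkQ_ge_of_not_isContractive hU hD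
          (hle _ P.1.2.1 _ P.2.2.1 P.1.2.2 P.2.2.2)
          (fun h => P.2.2.2 (P.1.2.2.trans (fun i => hB _ (hnK i)) hU.apply_mem hD.apply_mem h))
          hp1 hp.le (fun l hl x hx => hK'mem _ (hSmem l hl) x hx)
        exact ⟨y, hy, hyU, hy4⟩) hcomp (fun P => (hcomp P).isClosed)
    rw [Set.mem_iInter] at hy
    refine ⟨y, (Submodule.mem_sInf).mpr fun U hU => (hy ⟨⟨⊥, hbot, hcbot⟩, ⟨U, hU⟩⟩).2.1,
      fun hyN => ?_⟩
    obtain ⟨y', hy', hd⟩ := Metric.mem_closure_iff.mp hyN (1 / 4) (by norm_num)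
    obtain ⟨D, hD, hyD⟩ := (Submodule.mem_sSup_of_directed
      (s := {W ∈ C | IsContractive n W ⊥}) ⟨⊥, hbot, hcbot⟩
      (fun V hV W hW => (hC.total V hV.1 W hW.1).elim (fun h => ⟨W, hW, h, le_rfl⟩)
        fun h => ⟨V, hV, le_rfl, h⟩)).mp hy'
    have h1 := (hy ⟨⟨D, hD⟩, ⟨⊤, htop, hnc⟩⟩).2.2
    have h2 : D.mkQ y = D.mkQ (y - y') := mkQ_eq_of_sub_mem (by simpa using hyD)
    rw [Set.mem_ofPred_eq, h2] at h1
    rw [dist_eq_norm] at hd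
    linarith [norm_mkQ_le D (y - y')]
  have hpN : IsContractive n N ⊥ := by
    by_contra h
    exact hyN ((Submodule.mem_sInf.mp hyM) N ⟨hN, h⟩)
  have hpM : ¬IsContractive n M ⊥ := fun h =>
    hyN (Submodule.le_topologicalClosure _ (le_sSup (show M ∈ {W ∈ C | IsContractive n W ⊥} from
      ⟨hM, h⟩) hyM))
  have hNi := hC.invariant N hN
  have hMi := hC.invariant M hM
  exact ⟨N, M, hNi, hMi, hNM, hgap, fun h =>
    hpM (hpN.trans (fun i => hB _ (hnK i)) hMi.apply_mem hNi.apply_mem h)⟩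

end

section

variable {ι X Z : Type*} [NormedAddCommGroup X] [NormedSpace ℂ X]
  [NormedAddCommGroup Z] [NormedSpace ℂ Z] {n : ι → X →L[ℂ] X} {θ : ℂ}

/-- The members of a family leaving `M` and `N` invariant, as elements of the stabilizer. -/
def stabilizerLift {M N : Submodule ℂ X} (hM : IsClosedInvariant n M) (hN : IsClosedInvariant n N)
    (i : ι) : stabilizerSubalgebra M N :=
  ⟨n i, hM.apply_mem i, hN.apply_mem i⟩

theorem coe_wordProd_stabilizerLift {M N : Submodule ℂ X} (hM : IsClosedInvariant n M)
    (hN : IsClosedInvariant n N) (l : List ι) :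
    ((wordProd (stabilizerLift hM hN) l :) : X →L[ℂ] X) = wordProd n l :=
  map_wordProd _ (stabilizerSubalgebra M N).val l

theorem eq_bot_or_eq_top_of_compression {M N : Submodule ℂ X} (hM : IsClosedInvariant n M)
    (hN : IsClosedInvariant n N) (hNM : N ≤ M)
    (hgap : ∀ W, IsClosedInvariant n W → N ≤ W → W ≤ M → W = N ∨ W = M) {q : M →L[ℂ] Z}
    (hsurj : Function.Surjective q) (hq : ∀ x, ‖q x‖ = ‖N.mkQ (x : X)‖) {ψ : ι → Z →L[ℂ] Z}
    (hψ : ∀ i x, ψ i (q x) = q ⟨n i x, hM.apply_mem i x x.2⟩) {W : Submodule ℂ Z}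
    (hW : IsClosed (W : Set Z)) (hinv : ∀ i, ∀ z ∈ W, ψ i z ∈ W) : W = ⊥ ∨ W = ⊤ := by
  have hker : ∀ x, q x = 0 ↔ (x : X) ∈ N := fun x => by
    rw [← norm_eq_zero, hq, norm_mkQ_eq_zero_iff hN.isClosed]
  let W' : Submodule ℂ X := (W.comap q.toLinearMap).map M.subtype
  have hmem : ∀ x : M, (x : X) ∈ W' ↔ q x ∈ W := fun x => by
    simp [W']
  have hle : W' ≤ M := Submodule.map_subtype_le _ _
  have hW' : IsClosedInvariant n W' := by
    refine ⟨?_, fun i x hx => ?_⟩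
    · rw [Submodule.map_coe]
      exact hM.isClosed.isClosedEmbedding_subtypeVal.isClosedMap _ (hW.preimage q.continuous)
    · have h1 := (hmem ⟨n i x, hM.apply_mem i x (hle hx)⟩).mpr
      rw [← hψ i ⟨x, hle hx⟩] at h1
      exact h1 (hinv i _ ((hmem ⟨x, hle hx⟩).mp hx))
  rcases hgap W' hW' (fun x hx => (hmem ⟨x, hNM hx⟩).mpr
    (by rw [(hker ⟨x, hNM hx⟩).mpr hx]; exact W.zero_mem)) hle with h | h
  · refine Or.inl ((Submodule.eq_bot_iff W).mpr (hsurj.forall.mpr fun x hx => ?_))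
    rw [hker, ← h]
    exact (hmem x).mpr hx
  · refine Or.inr ((Submodule.eq_top_iff').mpr (hsurj.forall.mpr fun x => ?_))
    rw [← hmem, h]
    exact x.2

theorem IsCompactOperator.of_compression {M N : Submodule ℂ X} (hM : IsClosed (M : Set X))
    {q : M →L[ℂ] Z} (hq : IsOpenQuotientMap q) {T : stabilizerSubalgebra M N}
    (hT : IsCompactOperator T.1) {S : Z →L[ℂ] Z}
    (hS : ∀ x, S (q x) = q ⟨T.1 x, T.2.1 x x.2⟩) : IsCompactOperator S := by
  obtain ⟨K, hK, hnhds⟩ := hT.restrict T.2.1 hM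
  refine ⟨q '' K, hK.image q.continuous, mem_of_superset
    (by simpa using hq.isOpenMap.image_mem_nhds hnhds) ?_⟩
  rintro _ ⟨x, hx, rfl⟩
  exact ⟨_, hx, (hS x).symm⟩

end

section

variable {ι : Type*} {X : Type*} [NormedAddCommGroup X] [NormedSpace ℂ X] [CompleteSpace X]
  {n : ι → X →L[ℂ] X} {θ : ℂ} {K : Set (X →L[ℂ] X)}

theorem isContractive_of_gap (hθ : ‖θ‖ < 1)
    (hn : ∀ i, IsCompactOperator (n i - θ • 1 : X →L[ℂ] X))
    (hK : IsCompact K) (hnK : ∀ i, n i ∈ K)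
    (hbd : ∀ η : ℝ, 1 < η → ∃ C, ∀ l : List ι, ‖wordProd n l‖ ≤ C * η ^ l.length)
    (hsr : ∃ m, ∀ l : List ι, m ≤ l.length → ∃ k, 1 ≤ k ∧ ‖wordProd n l ^ k‖ ≤ (1 / 4 : ℝ) ^ k)
    {M N : Submodule ℂ X} (hM : IsClosedInvariant n M) (hN : IsClosedInvariant n N) (hNM : N ≤ M)
    (hgap : ∀ W, IsClosedInvariant n W → N ≤ W → W ≤ M → W = N ∨ W = M) :
    IsContractive n M N := by
  obtain ⟨Z, _, _, _, q, φ, hqo, hq, hφ, hφq⟩ := exists_compression hM.isClosed hN.isClosed hNM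
  let s := stabilizerLift hM hN
  have hs : ∀ l, ((wordProd s l :) : X →L[ℂ] X) = wordProd n l := coe_wordProd_stabilizerLift hM hN
  have hw : ∀ l, φ (wordProd s l) = wordProd (fun i => φ (s i)) l := map_wordProd s φ
  have hφc : Continuous φ := AddMonoidHomClass.continuous_of_bound φ 1 fun T =>
    (hφ T).trans_eq (one_mul _).symm
  have hpow : ∀ l k, ‖wordProd (fun i => φ (s i)) l ^ k‖ ≤ ‖wordProd n l ^ k‖ := fun l k => by
    rw [← hw, ← map_pow, ← hs, ← SubmonoidClass.coe_pow]
    exact hφ _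
  have hcomp : ∀ i, IsCompactOperator (φ (s i) - θ • 1 : Z →L[ℂ] Z) := fun i => by
    have h1 : ((s i - θ • 1 : stabilizerSubalgebra M N) : X →L[ℂ] X) = n i - θ • 1 := rfl
    refine IsCompactOperator.of_compression hM.isClosed hqo (T := s i - θ • 1) (h1 ▸ hn i)
      fun x => ?_
    rw [← hφq, map_sub, map_smul, map_one]
  have hKc : IsCompact (φ '' (Subtype.val ⁻¹' K)) :=
    ((isClosed_stabilizerSubalgebra hM.isClosed
      hN.isClosed).isClosedEmbedding_subtypeVal.isCompact_preimage hK).image hφc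
  obtain ⟨p, hp, hhalf⟩ := exists_forall_norm_wordProd_le_half (n := fun i => φ (s i)) hθ
    hcomp hKc (fun i => ⟨s i, hnK i, rfl⟩)
    (fun η hη => (hbd η hη).imp fun C hC l => by simpa using (hpow l 1).trans (by simpa using hC l))
    (hsr.imp fun m hm l hl => (hm l hl).imp fun k hk => ⟨hk.1, (hpow l k).trans hk.2⟩)
    (fun W hW hinv => eq_bot_or_eq_top_of_compression hM hN hNM hgap hqo.surjective hq
      (fun i x => hφq (s i) x) hW hinv)
  refine ⟨p, hp, 1 / 2, by norm_num, by norm_num, fun l hl x hx => ?_⟩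
  have h1 := hq ⟨wordProd n l x, wordProd_apply_mem hM.apply_mem l x hx⟩
  have h2 := hφq (wordProd s l) ⟨x, hx⟩
  simp only [hs] at h2
  rw [← h1, ← hq ⟨x, hx⟩, ← h2, hw]
  exact ContinuousLinearMap.le_of_opNorm_le _ (hhalf l hl) _

theorem isContractive_top_bot (hθ : ‖θ‖ < 1)
    (hn : ∀ i, IsCompactOperator (n i - θ • 1 : X →L[ℂ] X))
    (hK : IsCompact K) (hnK : ∀ i, n i ∈ K)
    (hbd : ∀ η : ℝ, 1 < η → ∃ C, ∀ l : List ι, ‖wordProd n l‖ ≤ C * η ^ l.length)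
    (hsr : ∃ m, ∀ l : List ι, m ≤ l.length → ∃ k, 1 ≤ k ∧ ‖wordProd n l ^ k‖ ≤ (1 / 4 : ℝ) ^ k) :
    IsContractive n ⊤ ⊥ := by
  by_contra hnc
  obtain ⟨C, hC⟩ := exists_isMaxInvariantChain n
  obtain ⟨N, M, hN, hM, hNM, hgap, h⟩ := hC.exists_not_isContractive hθ hn hK hnK hnc
  exact h (isContractive_of_gap hθ hn hK hnK hbd hsr hM hN hNM hgap)

/-- The **Berger–Wang formula** for compact perturbations of the identity: spectral bounds for all
words imply norm bounds for all words. -/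
theorem exists_forall_norm_wordProd_le (hn : ∀ i, IsCompactOperator (n i - 1 : X →L[ℂ] X))
    (hK : IsCompact K) (hnK : ∀ i, n i ∈ K) {κ : ℝ} (hκ : 1 ≤ κ)
    (hsp : ∀ l, ∀ z ∈ spectrum ℂ (wordProd n l), ‖z‖ ≤ κ ^ l.length) {η : ℝ} (hη : κ < η) :
    ∃ C, ∀ l : List ι, ‖wordProd n l‖ ≤ C * η ^ l.length := by
  obtain ⟨B, hB⟩ := hK.isBounded.exists_norm_le
  have hBword : ∀ (B' : ℝ), 0 ≤ B' → (∀ i, ‖n i‖ ≤ B') → ∀ l : List ι,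
      ‖wordProd n l‖ ≤ B' ^ l.length := by
    intro B' hB' h l
    induction l with
    | nil =>
      simp only [wordProd_nil, List.length_nil, pow_zero]
      exact ContinuousLinearMap.norm_id_le
    | cons i l ih =>
      rw [wordProd_cons, List.length_cons, pow_succ']
      exact (norm_mul_le _ _).trans (mul_le_mul (h i) ih (norm_nonneg _) hB')
  let A : Set ℝ := {η | 0 < η ∧ ∃ C, ∀ l : List ι, ‖wordProd n l‖ ≤ C * η ^ l.length}
  have hAup : ∀ a ∈ A, ∀ b, a ≤ b → b ∈ A := by
    rintro a ⟨ha, C, hC⟩ b hab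
    have hC0 : 0 ≤ C := (norm_nonneg _).trans (by simpa using hC [])
    exact ⟨ha.trans_le hab, C, fun l => (hC l).trans (by gcongr)⟩
  by_contra hnot
  have hlow : ∀ a ∈ A, η ≤ a := fun a ha => by
    by_contra! h
    exact hnot (hAup a ha η h.le).2
  have hAne : A.Nonempty := ⟨max B 1, by positivity, 1, fun l => by
    rw [one_mul]
    exact hBword _ (by positivity) (fun i => (hB _ (hnK i)).trans (le_max_left _ _)) l⟩
  let r := sInf A
  have hrη : η ≤ r := le_csInf hAne hlow
  have hr0 : 0 < r := by linarith
  have hrc : ‖(r : ℂ)⁻¹‖ = r⁻¹ := by rw [norm_inv, Complex.norm_real, Real.norm_of_nonneg hr0.le]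
  have hw : ∀ l, wordProd (fun i => (r : ℂ)⁻¹ • n i) l = (r : ℂ)⁻¹ ^ l.length • wordProd n l := by
    intro l
    induction l with
    | nil => simp
    | cons i l ih =>
      rw [wordProd_cons, ih, wordProd_cons, List.length_cons, pow_succ', smul_mul_smul_comm]
  have hwn : ∀ l, ‖wordProd (fun i => (r : ℂ)⁻¹ • n i) l‖ = (r ^ l.length)⁻¹ * ‖wordProd n l‖ :=
    fun l => by rw [hw, norm_smul, norm_pow, hrc, inv_pow]
  obtain ⟨p, hp, c, hc0, hc1, hcontr⟩ := isContractive_top_bot (θ := (r : ℂ)⁻¹)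
    (n := fun i => (r : ℂ)⁻¹ • n i) (K := (fun T => (r : ℂ)⁻¹ • T) '' K)
    (by rw [hrc]; exact inv_lt_one_of_one_lt₀ (by linarith))
    (fun i => by rw [← smul_sub]; exact (hn i).smul _)
    (hK.image (continuous_const_smul _)) (fun i => ⟨_, hnK i, rfl⟩)
    (fun t ht => by
      obtain ⟨a, ha, hat⟩ := exists_lt_of_csInf_lt hAne
        (show sInf A < r * t from lt_mul_of_one_lt_right hr0 ht)
      obtain ⟨-, C, hC⟩ := hAup a ha _ hat.le
      refine ⟨C, fun l => ?_⟩
      rw [hwn, inv_mul_le_iff₀ (by positivity)]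
      calc _ ≤ _ := hC l
        _ = _ := by ring)
    (by
      obtain ⟨m, hm⟩ := exists_pow_lt_of_lt_one (show (0 : ℝ) < 1 / 4 by norm_num)
        (show κ / r < 1 by rw [div_lt_one hr0]; linarith)
      refine ⟨m, fun l hl => ?_⟩
      obtain ⟨k, hk, hlt⟩ := exists_norm_pow_lt (wordProd (fun i => (r : ℂ)⁻¹ • n i) l)
        (show (0 : ℝ) < 1 / 4 by norm_num) (fun z hz => by
          have hc : (r : ℂ)⁻¹ ^ l.length ≠ 0 :=
            pow_ne_zero _ (inv_ne_zero (by exact_mod_cast hr0.ne'))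
          rw [hw, ← Units.smul_mk0 hc, spectrum.unit_smul_eq_smul] at hz
          obtain ⟨y, hy, rfl⟩ := hz
          have h1 : κ ^ l.length * (r ^ l.length)⁻¹ = (κ / r) ^ l.length := by
            rw [div_pow]; rfl
          calc _ = ‖y‖ * (r ^ l.length)⁻¹ := by
                change ‖(r : ℂ)⁻¹ ^ l.length * y‖ = _
                rw [norm_mul, norm_pow, hrc, inv_pow, mul_comm]
            _ ≤ κ ^ l.length * (r ^ l.length)⁻¹ := by gcongr; exact hsp l y hy
            _ = (κ / r) ^ l.length := h1
            _ ≤ (κ / r) ^ m := pow_le_pow_of_le_one (by positivity)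
              (by rw [div_le_one hr0]; linarith) hl
            _ < _ := hm)
      exact ⟨k, hk, hlt.le⟩)
  have hcp : ∀ l : List ι, l.length = p → ‖wordProd n l‖ ≤ c * r ^ p := fun l hl => by
    have h1 : ‖wordProd (fun i => (r : ℂ)⁻¹ • n i) l‖ ≤ c :=
      ContinuousLinearMap.opNorm_le_bound _ hc0 fun x => by
        simpa only [norm_mkQ_bot] using hcontr l hl x trivial
    rwa [hwn, inv_mul_le_iff₀ (by positivity), hl, mul_comm] at h1
  have hp0 : (1 : ℝ) ≤ p := by exact_mod_cast hp
  let d := max c (1 / 2)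
  have hd1 : d < 1 := max_lt hc1 (by norm_num)
  have hd2 : 1 / 2 ≤ d := le_max_right _ _
  have hδ : (1 - d) / p ≤ 1 / 2 := (div_le_self (by linarith) hp0).trans (by linarith)
  have hδ0 : 0 < (1 - d) / p := div_pos (by linarith) (by linarith)
  let r₁ := r * (1 + -((1 - d) / p))
  have hr₁ : 0 < r₁ := mul_pos hr0 (by linarith)
  have hr₁r : r₁ < r := mul_lt_of_lt_one_right hr0 (by linarith)
  have hpow : c * r ^ p ≤ r₁ ^ p := by
    have h1 := one_add_mul_le_pow (a := -((1 - d) / p)) (by linarith) p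
    have h2 : 1 + p * -((1 - d) / p) = d := by field_simp; ring
    rw [h2] at h1
    rw [mul_pow, mul_comm]
    exact mul_le_mul_of_nonneg_left ((le_max_left c (1 / 2)).trans h1) (by positivity)
  let B₁ := max B r₁
  have hB₁ : 1 ≤ B₁ / r₁ := (one_le_div hr₁).mpr (le_max_right _ _)
  have hB₁0 : 0 ≤ B₁ := hr₁.le.trans (le_max_right _ _)
  have hind : ∀ (k : ℕ) (l : List ι), l.length ≤ k →
      ‖wordProd n l‖ ≤ (B₁ / r₁) ^ p * r₁ ^ l.length := by
    intro k
    induction k with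
    | zero =>
      intro l hl
      rw [List.length_eq_zero_iff.mp (by omega : l.length = 0)]
      simp only [wordProd_nil, List.length_nil, pow_zero, mul_one]
      exact ContinuousLinearMap.norm_id_le.trans (one_le_pow₀ hB₁)
    | succ k ih =>
      intro l hl
      rcases lt_or_ge l.length p with hlp | hlp
      · calc _ ≤ B₁ ^ l.length := hBword _ hB₁0 (fun i => (hB _ (hnK i)).trans (le_max_left _ _)) l
          _ = (B₁ / r₁) ^ l.length * r₁ ^ l.length := by
            rw [← mul_pow, div_mul_cancel₀ _ hr₁.ne']
          _ ≤ (B₁ / r₁) ^ p * r₁ ^ l.length := by gcongr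
      · have h1 : (l.take p).length = p := by simp; omega
        have h2 : (l.drop p).length = l.length - p := by simp
        calc _ = ‖wordProd n (l.take p) * wordProd n (l.drop p)‖ := by
              rw [← wordProd_append, List.take_append_drop]
          _ ≤ r₁ ^ p * ((B₁ / r₁) ^ p * r₁ ^ (l.length - p)) :=
            (norm_mul_le _ _).trans (mul_le_mul ((hcp _ h1).trans hpow)
              (by rw [← h2]; exact ih _ (by omega)) (norm_nonneg _) (by positivity))
          _ = (B₁ / r₁) ^ p * r₁ ^ (p + (l.length - p)) := by rw [pow_add]; ring
          _ = _ := by rw [Nat.add_sub_cancel' hlp]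
  exact (notMem_of_lt_csInf hr₁r ⟨η, hlow⟩) ⟨hr₁, _, fun l => hind _ l le_rfl⟩

end

section

variable {ι Z : Type*} [NormedAddCommGroup Z] [NormedSpace ℂ Z] {a : ι → Z →L[ℂ] Z}

theorem exists_seminorm_bound_of_mem_adjoin {p : Z →L[ℂ] Z}
    (hp : p ∈ Algebra.adjoin ℂ (Set.range a)) :
    ∃ F : Set ι, F.Finite ∧ ∀ K : ℝ, ∃ D : ℝ, 0 ≤ D ∧ ∀ v : Seminorm ℂ Z,
      (∀ i ∈ F, ∀ x, v (a i x) ≤ K * v x) → ∀ x, v (p x) ≤ D * v x := by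
  induction hp using Algebra.adjoin_induction with
  | mem p hp =>
    obtain ⟨i, rfl⟩ := hp
    refine ⟨{i}, Set.finite_singleton i, fun K => ⟨|K|, abs_nonneg K, fun v hv x => ?_⟩⟩
    exact (hv i rfl x).trans (mul_le_mul_of_nonneg_right (le_abs_self K) (apply_nonneg v x))
  | algebraMap c =>
    refine ⟨∅, Set.finite_empty, fun K => ⟨‖c‖, norm_nonneg c, fun v _ x => ?_⟩⟩
    rw [Algebra.algebraMap_eq_smul_one]
    exact (map_smul_eq_mul v c x).le
  | add p q _ _ hp hq =>
    obtain ⟨F, hF, hp⟩ := hp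
    obtain ⟨G, hG, hq⟩ := hq
    refine ⟨F ∪ G, hF.union hG, fun K => ?_⟩
    obtain ⟨D, hD, hp⟩ := hp K
    obtain ⟨E, hE, hq⟩ := hq K
    refine ⟨D + E, add_nonneg hD hE, fun v hv x => ?_⟩
    rw [add_mul]
    exact (map_add_le_add v _ _).trans (add_le_add (hp v (fun i hi => hv i (Or.inl hi)) x)
      (hq v (fun i hi => hv i (Or.inr hi)) x))
  | mul p q _ _ hp hq =>
    obtain ⟨F, hF, hp⟩ := hp
    obtain ⟨G, hG, hq⟩ := hq
    refine ⟨F ∪ G, hF.union hG, fun K => ?_⟩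
    obtain ⟨D, hD, hp⟩ := hp K
    obtain ⟨E, hE, hq⟩ := hq K
    refine ⟨D * E, mul_nonneg hD hE, fun v hv x => ?_⟩
    rw [mul_assoc]
    exact (hp v (fun i hi => hv i (Or.inl hi)) (q x)).trans
      (mul_le_mul_of_nonneg_left (hq v (fun i hi => hv i (Or.inr hi)) x) hD)

theorem exists_mem_adjoin_apply_near
    (hirr : ∀ W : Submodule ℂ Z, IsClosed (W : Set Z) → (∀ i, ∀ x ∈ W, a i x ∈ W) → W = ⊥ ∨ W = ⊤)
    {y : Z} (hy : y ≠ 0) (x : Z) {δ : ℝ} (hδ : 0 < δ) :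
    ∃ p ∈ Algebra.adjoin ℂ (Set.range a), ‖p y - x‖ < δ := by
  let S : Submodule ℂ Z := (Subalgebra.toSubmodule (Algebra.adjoin ℂ (Set.range a))).map
    (ContinuousLinearMap.apply ℂ Z y).toLinearMap
  have hS : ∀ i, S ≤ S.topologicalClosure.comap (a i).toLinearMap := by
    rintro i _ ⟨p, hp, rfl⟩
    exact S.le_topologicalClosure
      ⟨a i * p, Subalgebra.mul_mem _ (Algebra.subset_adjoin ⟨i, rfl⟩) hp, rfl⟩
  rcases hirr S.topologicalClosure S.isClosed_topologicalClosure
    (fun i x hx => S.topologicalClosure_minimal (hS i)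
      (S.isClosed_topologicalClosure.preimage (a i).continuous) hx) with h | h
  · exact absurd ((Submodule.eq_bot_iff _).mp h y
      (S.le_topologicalClosure ⟨1, one_mem (Algebra.adjoin ℂ (Set.range a)), rfl⟩)) hy
  · obtain ⟨_, ⟨p, hp, rfl⟩, hd⟩ := Metric.mem_closure_iff.mp
      (show x ∈ S.topologicalClosure from h ▸ trivial) δ hδ
    rw [dist_comm, dist_eq_norm] at hd
    exact ⟨p, hp, hd⟩

/-- A version of **Lomonosov's theorem**, following Hilden's argument: an irreducible family admits
no nonzero compact operator that is small for seminorms in which the family is bounded. -/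
theorem false_of_irreducible_of_seminorm
    (hirr : ∀ W : Submodule ℂ Z, IsClosed (W : Set Z) → (∀ i, ∀ x ∈ W, a i x ∈ W) → W = ⊥ ∨ W = ⊤)
    {b : Z →L[ℂ] Z} (hb : IsCompactOperator b) (hb0 : b ≠ 0)
    (h : ∀ F : Set ι, F.Finite → ∃ K : ℝ, ∀ ε > 0, ∃ v : Seminorm ℂ Z, (∀ x, ‖x‖ ≤ v x) ∧
      (∀ i ∈ F, ∀ x, v (a i x) ≤ K * v x) ∧ ∀ x, v (b x) ≤ ε * v x) : False := by
  obtain ⟨x₀, hx₀⟩ : ∃ x, b x ≠ 0 := by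
    by_contra! h
    exact hb0 (ContinuousLinearMap.ext h)
  have hγ : 0 < ‖b x₀‖ := norm_pos_iff.mpr hx₀
  let δ := ‖b x₀‖ / (2 * (‖b‖ + 1))
  have hδ : 0 < δ := by positivity
  have hbδ : ‖b‖ * δ ≤ ‖b x₀‖ / 2 := by
    have : δ * (2 * (‖b‖ + 1)) = ‖b x₀‖ := div_mul_cancel₀ _ (by positivity)
    linarith
  have hball : ∀ x ∈ Metric.ball x₀ δ, ‖b x₀‖ / 2 ≤ ‖b x‖ := fun x hx => by
    rw [mem_ball_iff_norm] at hx
    have h1 : ‖b (x - x₀)‖ ≤ ‖b x₀‖ / 2 :=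
      (b.le_opNorm _).trans ((mul_le_mul_of_nonneg_left hx.le (norm_nonneg _)).trans hbδ)
    have h2 := norm_sub_norm_le (b x₀) (b x)
    rw [norm_sub_rev, ← map_sub] at h2
    linarith
  have hKc : IsCompact (closure (b '' Metric.ball x₀ δ)) :=
    IsCompactOperator.isCompact_closure_image_of_isVonNBounded (f := b.toLinearMap) hb
      (NormedSpace.isVonNBounded_of_isBounded ℂ Metric.isBounded_ball)
  have hKc0 : ∀ y ∈ closure (b '' Metric.ball x₀ δ), y ≠ 0 := by
    intro y hy
    have h1 : closure (b '' Metric.ball x₀ δ) ⊆ {y | ‖b x₀‖ / 2 ≤ ‖y‖} :=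
      closure_minimal (by rintro _ ⟨x, hx, rfl⟩; exact hball x hx)
        (isClosed_le continuous_const continuous_norm)
    exact norm_pos_iff.mp ((half_pos hγ).trans_le (h1 hy))
  obtain ⟨t, ht⟩ := hKc.elim_finite_subcover
    (fun p : Algebra.adjoin ℂ (Set.range a) => {y | ‖p.1 y - x₀‖ < δ})
    (fun p => isOpen_lt (by fun_prop) continuous_const) (fun y hy => by
      obtain ⟨p, hp, hlt⟩ := exists_mem_adjoin_apply_near hirr (hKc0 y hy) x₀ hδ
      exact Set.mem_iUnion.mpr ⟨⟨p, hp⟩, hlt⟩)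
  choose F hF hFD using fun p : Algebra.adjoin ℂ (Set.range a) =>
    exists_seminorm_bound_of_mem_adjoin p.2
  obtain ⟨K, hv⟩ := h (⋃ p ∈ t, F p) (t.finite_toSet.biUnion fun p _ => hF p)
  choose D hD0 hD using fun p => hFD p K
  have hD0' : 0 ≤ ∑ p ∈ t, D p := Finset.sum_nonneg fun p _ => hD0 p
  obtain ⟨v, hvnorm, hva, hvb⟩ := hv (1 / (2 * (∑ p ∈ t, D p + 1))) (by positivity)
  have hstep : ∀ x : Metric.ball x₀ δ, ∃ y : Metric.ball x₀ δ, v y ≤ 1 / 2 * v x := by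
    intro x
    obtain ⟨p, hp, hlt⟩ := Set.mem_iUnion₂.mp (ht (subset_closure ⟨x, x.2, rfl⟩))
    refine ⟨⟨p.1 (b x), mem_ball_iff_norm.mpr hlt⟩, ?_⟩
    have h1 : D p ≤ ∑ p ∈ t, D p + 1 :=
      (Finset.single_le_sum (fun p _ => hD0 p) hp).trans (lt_add_one _).le
    calc v (p.1 (b x)) ≤ D p * v (b x) :=
          hD p v (fun i hi => hva i (Set.mem_biUnion hp hi)) (b x)
      _ ≤ D p * (1 / (2 * (∑ p ∈ t, D p + 1)) * v x) := mul_le_mul_of_nonneg_left (hvb x) (hD0 p)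
      _ ≤ (∑ p ∈ t, D p + 1) * (1 / (2 * (∑ p ∈ t, D p + 1)) * v x) :=
          mul_le_mul_of_nonneg_right h1 (mul_nonneg (by positivity) (apply_nonneg v _))
      _ = 1 / 2 * v x := by field_simp
  choose g hg using hstep
  have hiter : ∀ k : ℕ, v (g^[k] ⟨x₀, Metric.mem_ball_self hδ⟩) ≤ (1 / 2) ^ k * v x₀ := by
    intro k
    induction k with
    | zero => simp
    | succ k ih =>
      rw [Function.iterate_succ_apply', pow_succ', mul_assoc]
      exact (hg _).trans (mul_le_mul_of_nonneg_left ih (by norm_num))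
  have hlim : Tendsto (fun k : ℕ => ‖b‖ * ((1 / 2 : ℝ) ^ k * v x₀)) atTop (𝓝 0) := by
    have := ((tendsto_pow_atTop_nhds_zero_of_lt_one (r := (1 / 2 : ℝ)) (by norm_num)
      (by norm_num)).mul_const (v x₀)).const_mul ‖b‖
    simpa using this
  obtain ⟨k, hk⟩ := (hlim.eventually (gt_mem_nhds (half_pos hγ))).exists
  have h1 := hball _ (g^[k] ⟨x₀, Metric.mem_ball_self hδ⟩).2
  have h2 : ‖b (g^[k] ⟨x₀, Metric.mem_ball_self hδ⟩)‖ ≤ ‖b‖ * ((1 / 2) ^ k * v x₀) :=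
    b.le_opNorm_of_le ((hvnorm _).trans (hiter k))
  linarith

end

section

variable {Z : Type*} [NormedAddCommGroup Z] [NormedSpace ℂ Z]

theorem exists_seminorm_le_iff {β : Type*} [Nonempty β] (f : β → Z →L[ℂ] Z) {C : ℝ}
    (hf : ∀ i, ‖f i‖ ≤ C) : ∃ v : Seminorm ℂ Z, ∀ x M, v x ≤ M ↔ ∀ i, ‖f i x‖ ≤ M := by
  have hbdd : ∀ x, BddAbove (Set.range fun i => ‖f i x‖) := fun x =>
    ⟨C * ‖x‖, by rintro _ ⟨i, rfl⟩; exact (f i).le_of_opNorm_le (hf i) x⟩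
  refine ⟨Seminorm.of (fun x => ⨆ i, ‖f i x‖) (fun x y => ciSup_le fun i => ?_) fun c x => ?_,
    fun x M => ciSup_le_iff (hbdd x)⟩
  · rw [map_add]
    exact (norm_add_le _ _).trans (add_le_add (le_ciSup (hbdd x) i) (le_ciSup (hbdd y) i))
  · simp only [map_smul, norm_smul]
    rw [Real.mul_iSup_of_nonneg (norm_nonneg c)]

theorem norm_apply_le_of_forall_exp [CompleteSpace Z] (a : Z →L[ℂ] Z) (T : Z →L[ℂ] Z) (x : Z)
    {M : ℝ}
    (h : ∀ t : ℂ, ‖t‖ = 1 → ‖T (exp (t • a) x)‖ ≤ M) : ‖T (a x)‖ ≤ M := by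
  have hd : ∀ t : ℂ, HasDerivAt (fun t : ℂ => T (exp (t • a) x)) (T ((exp (t • a) * a) x)) t :=
    fun t => T.hasFDerivAt.comp_hasDerivAt t
      (((ContinuousLinearMap.apply ℂ Z x).hasFDerivAt).comp_hasDerivAt t
        (hasDerivAt_exp_smul_const (𝕂 := ℂ) a t))
  have h1 := Complex.norm_deriv_le_of_forall_mem_sphere_norm_le (c := 0) (C := M) one_pos
    (Differentiable.diffContOnCl fun t => (hd t).differentiableAt)
    (fun t ht => h t (by simpa using ht))
  rw [(hd 0).deriv] at h1
  simpa using h1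

theorem exists_seminorm_of_norm_wordProd_exp_le [CompleteSpace Z] {J : Type*} {a : J → Z →L[ℂ] Z}
    {η : ℝ} (hη : 0 < η)
    {C : ℝ} (hC : ∀ l : List (J × Metric.sphere (0 : ℂ) 1),
      ‖wordProd (fun P => exp ((P.2 : ℂ) • a P.1)) l‖ ≤ C * η ^ l.length) :
    ∃ v : Seminorm ℂ Z, (∀ x, ‖x‖ ≤ v x) ∧ ∀ j x, v (a j x) ≤ η * v x := by
  let w : List (J × Metric.sphere (0 : ℂ) 1) → Z →L[ℂ] Z :=
    wordProd (fun P => exp ((P.2 : ℂ) • a P.1))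
  have hηc : ∀ k : ℕ, ‖((η : ℂ) ^ k)⁻¹‖ = (η ^ k)⁻¹ := fun k => by
    rw [norm_inv, norm_pow, Complex.norm_real, Real.norm_of_nonneg hη.le]
  obtain ⟨v, hv⟩ := exists_seminorm_le_iff (fun l => ((η : ℂ) ^ l.length)⁻¹ • w l) (C := C)
    fun l => by
      rw [norm_smul, hηc, inv_mul_le_iff₀ (by positivity), mul_comm]
      exact hC l
  refine ⟨v, fun x => by simpa [w] using (hv x _).mp le_rfl [], fun j x => (hv _ _).mpr fun l => ?_⟩
  refine norm_apply_le_of_forall_exp (a j) _ x fun t ht => ?_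
  have h1 := (hv x _).mp le_rfl (l ++ [(j, ⟨t, by simpa using ht⟩)])
  have h2 : w (l ++ [(j, ⟨t, by simpa using ht⟩)]) x = w l (exp (t • a j) x) := by
    simp [w, wordProd_append, wordProd_cons]
  rw [smul_apply, norm_smul, hηc, h2, List.length_append, List.length_singleton,
    pow_succ, mul_inv, mul_assoc, mul_left_comm, inv_mul_le_iff₀ hη] at h1
  rwa [smul_apply, norm_smul, hηc]

end

section

variable {X : Type*} [NormedAddCommGroup X] [NormedSpace ℂ X] [CompleteSpace X]

theorem IsCompactOperator.exp_sub_one {T : X →L[ℂ] X} (hT : IsCompactOperator T) :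
    IsCompactOperator (exp T - 1 : X →L[ℂ] X) := by
  have h := Submodule.sub_mem_of_hasDerivWithinAt (compactOperator (RingHom.id ℂ) X X)
    isClosed_setOfPred_isCompactOperator (f := fun s : ℝ => exp (s • T))
    (f' := fun s => exp (s • T) * T) (a := 0) (b := 1)
    (fun t _ => (hasDerivAt_exp_real_smul T t).hasDerivWithinAt)
    (fun t _ => hT.clm_comp (exp (t • T))) 1 (by simp)
  simp only [one_smul, zero_smul, exp_zero] at h
  exact h

theorem exists_norm_wordProd_exp_le {J : Type*} [Finite J] {g : J → X →L[ℂ] X}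
    (hg : ∀ j, IsCompactOperator (g j)) {κ : ℝ} (hκ : 1 ≤ κ)
    (hsp : ∀ l : List (J × Metric.sphere (0 : ℂ) 1),
      ∀ z ∈ spectrum ℂ (wordProd (fun P => exp ((P.2 : ℂ) • g P.1)) l), ‖z‖ ≤ κ ^ l.length)
    {η : ℝ} (hη : κ < η) :
    ∃ C, ∀ l : List (J × Metric.sphere (0 : ℂ) 1),
      ‖wordProd (fun P => exp ((P.2 : ℂ) • g P.1)) l‖ ≤ C * η ^ l.length := by
  have hK : IsCompact (⋃ j, (fun t : ℂ => exp (t • g j)) '' Metric.sphere 0 1) :=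
    isCompact_iUnion fun j => (isCompact_sphere _ _).image
      (continuous_exp_of_complex.comp (continuous_id.smul continuous_const))
  have hn : ∀ P : J × Metric.sphere (0 : ℂ) 1,
      IsCompactOperator (exp ((P.2 : ℂ) • g P.1) - 1 : X →L[ℂ] X) :=
    fun P => IsCompactOperator.exp_sub_one ((hg P.1).smul (P.2 : ℂ))
  exact exists_forall_norm_wordProd_le hn hK
    (fun P => Set.mem_iUnion.mpr ⟨P.1, P.2, P.2.2, rfl⟩) hκ hsp hη

end

theorem map_exp_of_complex {A B : Type*} [NormedRing A] [NormedAlgebra ℂ A] [CompleteSpace A]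
    [NormedRing B] [NormedAlgebra ℂ B] (f : A →ₐ[ℂ] B) (hf : Continuous f) (x : A) :
    f (exp x) = exp (f x) := by
  let : NormedAlgebra ℚ A := NormedAlgebra.restrictScalars ℚ ℂ A
  let : NormedAlgebra ℚ B := NormedAlgebra.restrictScalars ℚ ℂ B
  exact map_exp f hf x

namespace IsSublinearLie

variable {X : Type*} [NormedAddCommGroup X] [NormedSpace ℂ X] [CompleteSpace X]
  {L : Submodule ℂ (X →L[ℂ] X)} (hL : IsSublinearLie L)

theorem exists_norm_wordProd_exp_le_of_quasinilpotent {F : Set L} (hF : F.Finite) {m : ℝ}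
    (hm0 : 0 ≤ m) (hm : ∀ a ∈ F, ‖a‖ ≤ m) {b : L}
    (hb : (b : X →L[ℂ] X) ∈ hL.quasinilpotents) {η : ℝ} (hη : Real.exp m < η) :
    ∃ C, ∀ l : List (Option F × Metric.sphere (0 : ℂ) 1),
      ‖wordProd (fun P => exp ((P.2 : ℂ) • ((P.1.elim b Subtype.val : L) : X →L[ℂ] X))) l‖ ≤
        C * η ^ l.length := by
  have : Finite F := hF
  let g : Option F → X →L[ℂ] X := fun j => ((j.elim b Subtype.val : L) : X →L[ℂ] X)
  have hg : ∀ j, g j ∈ L := fun j => Subtype.prop _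
  have hsum : ∀ l : List (Option F × Metric.sphere (0 : ℂ) 1), ∃ A ∈ L, ∃ B ∈ hL.quasinilpotents,
      ‖A‖ ≤ l.length * m ∧ (l.map fun P => (P.2 : ℂ) • g P.1).sum = A + B := by
    intro l
    induction l with
    | nil => exact ⟨0, L.zero_mem, 0, Submodule.zero_mem _, by simp⟩
    | cons P l ih =>
      obtain ⟨A, hA, B, hB, hn, hs⟩ := ih
      obtain ⟨j, t, ht⟩ := P
      rw [List.map_cons, List.sum_cons, hs, List.length_cons]
      cases j with
      | none =>
        refine ⟨A, hA, t • (b : X →L[ℂ] X) + B, add_mem (Submodule.smul_mem _ _ hb) hB,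
          hn.trans (by gcongr; simp), ?_⟩
        exact add_left_comm _ _ _
      | some a =>
        refine ⟨t • ((a : L) : X →L[ℂ] X) + A, L.add_mem (L.smul_mem _ a.1.2) hA, B, hB, ?_,
          (add_assoc _ _ _).symm⟩
        have h1 : ‖t • ((a : L) : X →L[ℂ] X)‖ ≤ m := by
          rw [norm_smul, mem_sphere_zero_iff_norm.mp ht, one_mul]
          exact hm _ a.2
        push_cast
        linarith [norm_add_le (t • ((a : L) : X →L[ℂ] X)) A]
  refine exists_norm_wordProd_exp_le (g := g) (fun j => hL.compact _ (hg j))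
    (Real.one_le_exp hm0) (fun l z hz => ?_) hη
  obtain ⟨A, hA, B, hB, hn, hs⟩ := hsum l
  rw [← Real.exp_nat_mul]
  refine hL.norm_le_of_mem_spectrum_prodExp (l := l.map fun P => (P.2 : ℂ) • g P.1) ?_
    (by positivity) (fun α hα => ?_)
    (by simpa [prodExp, wordProd, List.map_map, Function.comp_def] using hz)
  · intro x hx
    obtain ⟨P, -, rfl⟩ := List.mem_map.mp hx
    exact L.smul_mem _ (hg _)
  · rw [hs] at hα
    rcases eq_or_ne α 0 with rfl | h0
    · rw [norm_zero]
      positivity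
    · exact (norm_le_of_mem_spectrum_clm
        (hL.mem_spectrum_of_add_quasinilpotent hA hB hα h0)).trans hn

theorem apply_mem_of_mem_quasinilpotents {M N : Submodule ℂ X}
    (hM : IsClosedInvariant (fun a : L => (a : X →L[ℂ] X)) M)
    (hN : IsClosedInvariant (fun a : L => (a : X →L[ℂ] X)) N) (hNM : N ≤ M)
    (hgap : ∀ W, IsClosedInvariant (fun a : L => (a : X →L[ℂ] X)) W → N ≤ W → W ≤ M →
      W = N ∨ W = M)
    {b : X →L[ℂ] X} (hb : b ∈ hL.quasinilpotents) {x : X} (hx : x ∈ M) : b x ∈ N := by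
  obtain ⟨Z, _, _, _, q, φ, hqo, hq, hφ, hφq⟩ := exists_compression hM.isClosed hN.isClosed hNM
  let s := stabilizerLift hM hN
  have hφc : Continuous φ := AddMonoidHomClass.continuous_of_bound φ 1 fun T =>
    (hφ T).trans_eq (one_mul _).symm
  let b₀ : L := ⟨b, hb.1⟩
  suffices hz : φ (s b₀) = 0 by
    have h1 := hφq (s b₀) ⟨x, hx⟩
    rw [hz, zero_apply, eq_comm, ← norm_eq_zero, hq, norm_mkQ_eq_zero_iff hN.isClosed] at h1
    exact h1
  by_contra hne
  refine false_of_irreducible_of_seminorm (a := fun a : L => φ (s a))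
    (fun W hW hinv => eq_bot_or_eq_top_of_compression hM hN hNM hgap hqo.surjective hq
      (fun i x => hφq (s i) x) hW hinv)
    (IsCompactOperator.of_compression hM.isClosed hqo (T := s b₀) (hL.compact _ hb.1)
      fun x => hφq _ x) hne fun F hF => ?_
  obtain ⟨m', hm'⟩ := (hF.image (fun a : L => ‖a‖)).bddAbove
  let m := max m' 0
  have hm : ∀ a ∈ F, ‖a‖ ≤ m := fun a ha => (hm' ⟨a, ha, rfl⟩).trans (le_max_left _ _)
  refine ⟨2 * Real.exp m, fun ε hε => ?_⟩
  set η := 2 * Real.exp m with hη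
  have hη0 : 0 < η := by positivity
  let R : ℂ := ((η / ε : ℝ) : ℂ)
  obtain ⟨C, hC⟩ := hL.exists_norm_wordProd_exp_le_of_quasinilpotent hF (le_max_right _ _) hm
    (b := R • b₀) (Submodule.smul_mem _ R hb) (η := η) (by linarith [Real.exp_pos m])
  let g : Option F → L := fun j => j.elim (R • b₀) Subtype.val
  have : CompleteSpace (stabilizerSubalgebra M N) :=
    (isClosed_stabilizerSubalgebra hM.isClosed hN.isClosed).completeSpace_coe
  have hword : ∀ l : List (Option F × Metric.sphere (0 : ℂ) 1),
      wordProd (fun P => exp ((P.2 : ℂ) • φ (s (g P.1)))) l =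
        φ (wordProd (fun P => exp ((P.2 : ℂ) • s (g P.1))) l) := fun l => by
    rw [map_wordProd]
    congr 1
    ext1 P
    rw [map_exp_of_complex φ hφc, map_smul]
  have hcoe : ∀ l : List (Option F × Metric.sphere (0 : ℂ) 1),
      ((wordProd (fun P => exp ((P.2 : ℂ) • s (g P.1))) l :) : X →L[ℂ] X) =
        wordProd (fun P => exp ((P.2 : ℂ) • (g P.1 : X →L[ℂ] X))) l := fun l => by
    refine (map_wordProd _ (stabilizerSubalgebra M N).val l).trans ?_
    congr 1
    ext1 P
    exact map_exp_of_complex (stabilizerSubalgebra M N).val continuous_subtype_val _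
  obtain ⟨v, hv, hva⟩ := exists_seminorm_of_norm_wordProd_exp_le (a := fun j => φ (s (g j))) hη0
    (C := C) fun l => by
      rw [hword]
      refine (hφ _).trans ?_
      have h := hC l
      rw [← hcoe] at h
      exact h
  refine ⟨v, hv, fun a ha x => hva (some ⟨a, ha⟩) x, fun x => ?_⟩
  have h1 := hva none x
  have h2 : φ (s (R • b₀)) = R • φ (s b₀) := by
    rw [← map_smul]
    rfl
  have h3 : ‖R‖ = η / ε := by
    rw [Complex.norm_real, Real.norm_of_nonneg (by positivity)]
  change v (φ (s (R • b₀)) x) ≤ η * v x at h1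
  rw [h2, smul_apply, map_smul_eq_mul, h3, div_mul_eq_mul_div, div_le_iff₀ hε] at h1
  refine le_of_mul_le_mul_left (h1.trans_eq ?_) hη0
  ring

end IsSublinearLie

section

variable {Z : Type*} [NormedAddCommGroup Z] [NormedSpace ℂ Z] [CompleteSpace Z]

theorem exists_norm_pow_le_of_spectrum {A : Type*} [NormedRing A] [NormedAlgebra ℂ A]
    [CompleteSpace A] (a : A) (h : ∀ z ∈ spectrum ℂ a, ‖z‖ < 1) : ∃ C, ∀ n, ‖a ^ n‖ ≤ C := by
  obtain ⟨k, hk, hlt⟩ := exists_norm_pow_lt a one_pos h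
  rw [one_pow] at hlt
  refine ⟨∑ j ∈ Finset.range k, ‖a ^ j‖, fun n => ?_⟩
  induction n using Nat.strong_induction_on with
  | _ n ih =>
    rcases lt_or_ge n k with hn | hn
    · exact Finset.single_le_sum (f := fun j => ‖a ^ j‖) (fun j _ => norm_nonneg _)
        (Finset.mem_range.mpr hn)
    · obtain ⟨m, rfl⟩ := Nat.exists_eq_add_of_le hn
      rw [pow_add]
      have h1 := ih m (by lia)
      refine (norm_mul_le _ _).trans ((mul_le_of_le_one_left (norm_nonneg _) hlt.le).trans h1)

theorem eq_zero_of_irreducible_of_commute {ι : Type*} {a : ι → Z →L[ℂ] Z}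
    (hirr : ∀ W : Submodule ℂ Z, IsClosed (W : Set Z) → (∀ i, ∀ x ∈ W, a i x ∈ W) → W = ⊥ ∨ W = ⊤)
    {c : Z →L[ℂ] Z} (hc : IsCompactOperator c) (hcomm : ∀ i, Commute (a i) c)
    (hσ : ∀ z ∈ spectrum ℂ c, z = 0) : c = 0 := by
  by_contra hne
  refine false_of_irreducible_of_seminorm hirr hc hne fun F hF => ?_
  obtain ⟨K, hK⟩ := (hF.image fun i => ‖a i‖).bddAbove
  refine ⟨K, fun ε hε => ?_⟩
  have hε0 : (ε : ℂ) ≠ 0 := Complex.ofReal_ne_zero.mpr hε.ne'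
  obtain ⟨C, hC⟩ := exists_norm_pow_le_of_spectrum ((ε : ℂ)⁻¹ • c) fun z hz => by
    obtain ⟨w, hw, rfl⟩ := spectrum.smul_mem_of_mem_smul (inv_ne_zero hε0) hz
    simp [hσ w hw]
  obtain ⟨v, hv⟩ := exists_seminorm_le_iff (fun n : ℕ => ((ε : ℂ)⁻¹ • c) ^ n) hC
  refine ⟨v, fun x => by simpa using (hv x _).mp le_rfl 0, fun i hi x => (hv _ _).mpr fun n => ?_,
    fun x => (hv _ _).mpr fun n => ?_⟩
  · have h1 : ((((ε : ℂ)⁻¹ • c) ^ n) * a i) x = (a i * ((ε : ℂ)⁻¹ • c) ^ n) x := by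
      rw [((hcomm i).smul_right _ |>.pow_right n).eq]
    have h2 := (hv x _).mp le_rfl n
    change ‖((((ε : ℂ)⁻¹ • c) ^ n) * a i) x‖ ≤ _
    rw [h1]
    exact ((a i).le_of_opNorm_le (hK ⟨i, hi, rfl⟩) _).trans
      (mul_le_mul_of_nonneg_left h2 ((norm_nonneg _).trans (hK ⟨i, hi, rfl⟩)))
  · have h2 := (hv x _).mp le_rfl (n + 1)
    have h3 : (((ε : ℂ)⁻¹ • c) ^ n) (c x) = (ε : ℂ) • (((ε : ℂ)⁻¹ • c) ^ (n + 1)) x := by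
      rw [pow_succ, mul_apply_eq_comp, ← map_smul, smul_apply, smul_inv_smul₀ hε0]
    rw [h3, norm_smul, Complex.norm_real, Real.norm_of_nonneg hε.le]
    exact mul_le_mul_of_nonneg_left h2 hε.le

theorem exists_eq_smul_one_of_irreducible_of_commute {ι : Type*} {a : ι → Z →L[ℂ] Z}
    (hirr : ∀ W : Submodule ℂ Z, IsClosed (W : Set Z) → (∀ i, ∀ x ∈ W, a i x ∈ W) → W = ⊥ ∨ W = ⊤)
    {c : Z →L[ℂ] Z} (hc : IsCompactOperator c) (hcomm : ∀ i, Commute (a i) c) :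
    ∃ μ : ℂ, c = μ • 1 := by
  by_cases hσ : ∀ z ∈ spectrum ℂ c, z = 0
  · exact ⟨0, by rw [zero_smul, eq_zero_of_irreducible_of_commute hirr hc hcomm hσ]⟩
  push Not at hσ
  obtain ⟨μ, hμ, hμ0⟩ := hσ
  obtain ⟨x, hx⟩ := ((hc.hasEigenvalue_iff_mem_spectrum hμ0).mpr hμ).exists_hasEigenvector
  let W : Submodule ℂ Z := LinearMap.ker (c - μ • 1 : Z →L[ℂ] Z).toLinearMap
  have hmem : ∀ y, y ∈ W ↔ c y = μ • y := fun y => by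
    rw [LinearMap.mem_ker]
    exact sub_eq_zero
  refine ⟨μ, ?_⟩
  have hinv : ∀ i, ∀ y ∈ W, a i y ∈ W := fun i y hy => by
    rw [hmem] at hy ⊢
    have h1 : (c * a i) y = (a i * c) y := by rw [(hcomm i).eq]
    change c (a i y) = a i (c y) at h1
    rw [h1, hy, map_smul]
  rcases hirr W (c - μ • 1 : Z →L[ℂ] Z).isClosed_ker hinv with h | h
  · have h1 : x ∈ W := (hmem x).mpr hx.apply_eq_smul
    rw [h] at h1
    exact absurd ((Submodule.mem_bot ℂ).mp h1) hx.2
  · ext y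
    exact (hmem y).mp (h ▸ Submodule.mem_top)

namespace IsSublinearLie

variable {X : Type*} [NormedAddCommGroup X] [NormedSpace ℂ X] [CompleteSpace X]
  {L : Submodule ℂ (X →L[ℂ] X)} (hL : IsSublinearLie L)

include hL

theorem apply_mem_of_le_of_le {M N : Submodule ℂ X}
    (hM : IsClosedInvariant (fun a : L => (a : X →L[ℂ] X)) M)
    (hN : IsClosedInvariant (fun a : L => (a : X →L[ℂ] X)) N) (hNM : N ≤ M)
    (hgap : ∀ W, IsClosedInvariant (fun a : L => (a : X →L[ℂ] X)) W → N ≤ W → W ≤ M →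
      W = N ∨ W = M)
    {W : Submodule ℂ X} (hNW : N ≤ W) (hWM : W ≤ M) (c : L) {x : X} (hx : x ∈ W) :
    (c : X →L[ℂ] X) x ∈ W := by
  obtain ⟨Z, _, _, _, q, φ, hqo, hq, hφ, hφq⟩ := exists_compression hM.isClosed hN.isClosed hNM
  let s := stabilizerLift hM hN
  have hker : ∀ y : M, q y = 0 ↔ (y : X) ∈ N := fun y => by
    rw [← norm_eq_zero, hq, norm_mkQ_eq_zero_iff hN.isClosed]
  obtain ⟨μ, hμ⟩ := exists_eq_smul_one_of_irreducible_of_commute (a := fun a : L => φ (s a))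
    (fun W hW hinv => eq_bot_or_eq_top_of_compression hM hN hNM hgap hqo.surjective hq
      (fun i x => hφq (s i) x) hW hinv)
    (IsCompactOperator.of_compression hM.isClosed hqo (T := s c) (hL.compact _ c.2)
      fun x => hφq _ x) fun i => by
    refine sub_eq_zero.mp ?_
    rw [← map_mul, ← map_mul, ← map_sub]
    ext z
    obtain ⟨y, rfl⟩ := hqo.surjective z
    rw [hφq, zero_apply, hker]
    exact hL.apply_mem_of_mem_quasinilpotents hM hN hNM hgap
      (hL.commutator_mem_quasinilpotents i.2 c.2) y.2
  have h1 : q (⟨c.1 x, hM.apply_mem c x (hWM hx)⟩ - μ • ⟨x, hWM hx⟩) = 0 := by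
    rw [map_sub, map_smul, sub_eq_zero]
    refine (hφq (s c) ⟨x, hWM hx⟩).symm.trans ?_
    rw [hμ]
    rfl
  have h2 := W.add_mem (hNW ((hker _).mp h1)) (W.smul_mem μ hx)
  simpa using h2

theorem exists_isMaxChain : ∃ C : Set {M : Submodule ℂ X // IsClosed (M : Set X)},
    (∀ M ∈ C, ∀ A ∈ L, ∀ x ∈ M.1, A x ∈ M.1) ∧ IsMaxChain (· ≤ ·) C := by
  obtain ⟨C, hC⟩ := exists_isMaxInvariantChain (fun a : L => (a : X →L[ℂ] X))
  refine ⟨{M | M.1 ∈ C}, fun M hM A hA => (hC.invariant _ hM).apply_mem ⟨A, hA⟩,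
    fun V hV W hW _ => hC.total _ hV _ hW, fun D hD hCD => hCD.antisymm fun W hW => ?_⟩
  have hcomp : ∀ V ∈ C, V ≤ W.1 ∨ W.1 ≤ V := fun V hV =>
    hD.total (hCD (a := ⟨V, (hC.invariant V hV).isClosed⟩) hV) hW
  obtain ⟨hN, hM, hNM, hgap⟩ := hC.cut (p := fun V => V ≤ W.1) fun V hV V' hV' hVW hVW' =>
    (hC.total V hV V' hV').resolve_right fun h => hVW' (h.trans hVW)
  refine hC.mem _ ⟨W.2, fun c x hx => hL.apply_mem_of_le_of_le (hC.invariant _ hM)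
    (hC.invariant _ hN) hNM hgap ?_ ?_ c hx⟩ hcomp
  · exact Submodule.topologicalClosure_minimal _ (sSup_le fun V hV => hV.2) W.2
  · exact le_sInf fun V hV => (hcomp V hV.1).resolve_left hV.2

end IsSublinearLie

end

/-- A Lie algebra of compact operators with sublinear spectrum is triangularizable:
there is a chain of closed invariant subspaces which is a maximal chain in the
lattice of all closed subspaces. -/
theorem lie_algebra_sublinear_triangularizable
    {X : Type*} [NormedAddCommGroup X] [NormedSpace ℂ X] [CompleteSpace X]
    (L : Submodule ℂ (X →L[ℂ] X))
    (hLie : ∀ A ∈ L, ∀ B ∈ L, A * B - B * A ∈ L)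
    (hcompact : ∀ A ∈ L, IsCompactOperator A)
    (hsublin : ∀ A ∈ L, ∀ B ∈ L, ∀ lam : ℂ,
      ∀ mu ∈ spectrum ℂ (A + lam • B),
        ∃ α ∈ spectrum ℂ A, ∃ β ∈ spectrum ℂ B, mu = α + lam * β) :
    ∃ C : Set {M : Submodule ℂ X // IsClosed (M : Set X)},
      (∀ M ∈ C, ∀ A ∈ L, ∀ x ∈ M.1, A x ∈ M.1) ∧
      IsMaxChain (· ≤ ·) C := by
  obtain ⟨C, hC, hmax⟩ := (isSublinearLie_topologicalClosure hLie hcompact fun A hA B hB μ hμ => by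
    simpa using hsublin A hA B hB 1 μ (by rwa [one_smul])).exists_isMaxChain
  exact ⟨C, fun M hM A hA => hC M hM A (L.le_topologicalClosure hA), hmax⟩
end
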